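/- There exists a constant C > 0 such that the following holds: for every g ≥ 2, every μ_2 ≥ 0, and μ equal to [2^{μ_2}, 4g−2] or to [2^{μ_2}, (2g)^2], any two square-tiled surfaces in ST^hyp_Ab(μ) can be connected by a sequence of at most C·g powers of cylinder shears (up to isomorphism). -/

import Mathlib

/-! Common definitions: square-tiled surfaces as triples of involutions,
cylinder shears, profiles, etc. -/

inductive Color : Type
  | R | G | B
  deriving DecidableEq

/-- A candidate square-tiled surface on `Fin n`: a triple of permutations
indexed by the three colours. -/
abbrev Surf (n : ℕ) := Color → Equiv.Perm (Fin n)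

/-- `f` is a square-tiled surface on `{1,…,n}` (`n ≥ 1`): the three permutations are
involutions and the subgroup they generate acts transitively. -/
def IsSTS (n : ℕ) (f : Surf n) : Prop :=
  1 ≤ n ∧ (∀ X, f X * f X = 1) ∧
    ∀ x y : Fin n,
      ∃ p ∈ Subgroup.closure ({f Color.R, f Color.G, f Color.B} : Set (Equiv.Perm (Fin n))),
        p x = y

/-- Number of fixed points of a permutation of `Fin n`. -/
def fixedCount {n : ℕ} (π : Equiv.Perm (Fin n)) : ℕ :=
  (Finset.univ.filter fun x => π x = x).card

/-- Number of cycles of length `i` of `π`, fixed points counted as cycles of length 1. -/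
def cycleCount {n : ℕ} (π : Equiv.Perm (Fin n)) (i : ℕ) : ℕ :=
  if i = 1 then fixedCount π else Multiset.count i π.cycleType

/-- The product `τ_R · τ_G · τ_B`. -/
def prodRGB {n : ℕ} (f : Surf n) : Equiv.Perm (Fin n) :=
  f Color.R * f Color.G * f Color.B

/-- Total number of fixed points of the three permutations. -/
def totalFixed {n : ℕ} (f : Surf n) : ℕ :=
  fixedCount (f Color.R) + fixedCount (f Color.G) + fixedCount (f Color.B)

/-- `f` has profile `(μ, k)`: `μ i` is the number of cycles of length `i` of
`τ_R·τ_G·τ_B` (for `i ≥ 1`), and `k` is the total number of fixed points of the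
three involutions. -/
def HasProfile {n : ℕ} (f : Surf n) (μ : ℕ → ℕ) (k : ℕ) : Prop :=
  (∀ i, 1 ≤ i → cycleCount (prodRGB f) i = μ i) ∧ totalFixed f = k

open Classical in
/-- The permutation acting as `σ` on the (`σ`-invariant) set `c` and as the identity
outside of `c`. (Junk value `1` if `c` is not `σ`-invariant.) -/
noncomputable def restrictPerm {α : Type*} (σ : Equiv.Perm α) (c : Set α) : Equiv.Perm α :=
  if h : ∀ x, σ x ∈ c ↔ x ∈ c then
    { toFun := fun x => if x ∈ c then σ x else x
      invFun := fun x => if x ∈ c then σ.symm x else x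
      left_inv := fun x => by
        by_cases hx : x ∈ c
        · simp [hx, (h x).mpr hx]
        · simp [hx]
      right_inv := fun x => by
        by_cases hx : x ∈ c
        · have h1 : σ.symm x ∈ c := (h (σ.symm x)).mp (by simpa using hx)
          simp [hx, h1]
        · simp [hx] }
  else 1

/-- `c` is an `{i,j}`-component of `f`: an orbit of the subgroup generated by
`f i` and `f j`. -/
def IsComponent (n : ℕ) (f : Surf n) (i j : Color) (c : Set (Fin n)) : Prop :=
  ∃ x : Fin n,
    c = MulAction.orbit ↥(Subgroup.closure ({f i, f j} : Set (Equiv.Perm (Fin n)))) x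

/-- The cylinder shear `Shear_{c,i,j}`: replace `f i` by `f i · c_i · c_j` and
`f j` by `f j · c_i · c_j`, keeping the third permutation unchanged. -/
noncomputable def shear {n : ℕ} (f : Surf n) (i j : Color) (c : Set (Fin n)) : Surf n :=
  fun X =>
    if X = i ∨ X = j then f X * restrictPerm (f i) c * restrictPerm (f j) c else f X

/-- `m`-th power of the cylinder shear `Shear_{c,i,j}`. -/
noncomputable def shearPow {n : ℕ} (f : Surf n) (i j : Color) (c : Set (Fin n)) : ℕ → Surf n
  | 0 => f
  | m + 1 => shear (shearPow f i j c m) i j c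

/-- The unordered pair `{i,j}` is `{R,G}` or `{G,B}`. -/
def GoodPair (i j : Color) : Prop :=
  ({i, j} : Set Color) = {Color.R, Color.G} ∨ ({i, j} : Set Color) = {Color.G, Color.B}

/-- `A` (together with its complement) witnesses that `f` is Abelian. -/
def IsAbelianWitness (n : ℕ) (f : Surf n) (A : Set (Fin n)) : Prop :=
  A.Nonempty ∧ Aᶜ.Nonempty ∧ ∀ X : Color, (⇑(f X)) '' A = Aᶜ

/-- `f` is Abelian. -/
def IsAbelian (n : ℕ) (f : Surf n) : Prop :=
  ∃ A : Set (Fin n), IsAbelianWitness n f A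

/-- `f` is path-like: `f G` and `f B` alone generate a transitive subgroup and have
exactly two fixed points in total. -/
def IsPathLike (n : ℕ) (f : Surf n) : Prop :=
  (∀ x y : Fin n,
      ∃ p ∈ Subgroup.closure ({f Color.G, f Color.B} : Set (Equiv.Perm (Fin n))),
        p x = y) ∧
    fixedCount (f Color.G) + fixedCount (f Color.B) = 2

/-- `f` and `f'` are isomorphic square-tiled surfaces. -/
def Isomorphic (n : ℕ) (f f' : Surf n) : Prop :=
  ∃ σ : Equiv.Perm (Fin n), ∀ X, f' X = σ * f X * σ⁻¹

/-- One power of a cylinder shear. -/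
def ShearPowStep (n : ℕ) (f f' : Surf n) : Prop :=
  ∃ (i j : Color) (c : Set (Fin n)) (m : ℕ),
    GoodPair i j ∧ IsComponent n f i j c ∧ 1 ≤ m ∧ f' = shearPow f i j c m

/-- A sequence of `L` powers of cylinder shears from `f` to `f'`. -/
def ShearPowSeq (n : ℕ) : ℕ → Surf n → Surf n → Prop
  | 0, f, f' => f = f'
  | L + 1, f, f' => ∃ g, ShearPowStep n f g ∧ ShearPowSeq n L g f'

/-- A single vertical (i.e. `{R,G}`) cylinder shear. -/
def VertStep (n : ℕ) (f f' : Surf n) : Prop :=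
  ∃ (i j : Color) (c : Set (Fin n)),
    ({i, j} : Set Color) = {Color.R, Color.G} ∧ IsComponent n f i j c ∧ f' = shear f i j c

/-- A power of a horizontal (i.e. `{G,B}`) cylinder shear. -/
def HorizPowStep (n : ℕ) (f f' : Surf n) : Prop :=
  ∃ (i j : Color) (c : Set (Fin n)) (m : ℕ),
    ({i, j} : Set Color) = {Color.G, Color.B} ∧ IsComponent n f i j c ∧ 1 ≤ m ∧
      f' = shearPow f i j c m

/-- A sequence of `L` operations, each a single vertical shear or a power of a
horizontal shear. -/
def MixedSeq (n : ℕ) : ℕ → Surf n → Surf n → Prop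
  | 0, f, f' => f = f'
  | L + 1, f, f' => ∃ g, (VertStep n f g ∨ HorizPowStep n f g) ∧ MixedSeq n L g f'

/-- Profile `([2^{μ2}, 4g-2], 0)` (as far as the partition is concerned;
`totalFixed = 0` gives `k = 0`). -/
def ProfileA (n g μ2 : ℕ) (f : Surf n) : Prop :=
  totalFixed f = 0 ∧ cycleCount (prodRGB f) 2 = μ2 ∧
    cycleCount (prodRGB f) (4 * g - 2) = 1 ∧
    ∀ i, 1 ≤ i → i ≠ 2 → i ≠ 4 * g - 2 → cycleCount (prodRGB f) i = 0

/-- Profile `([2^{μ2}, (2g)^2], 0)`. -/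
def ProfileB (n g μ2 : ℕ) (f : Surf n) : Prop :=
  totalFixed f = 0 ∧ cycleCount (prodRGB f) 2 = μ2 ∧
    cycleCount (prodRGB f) (2 * g) = 2 ∧
    ∀ i, 1 ≤ i → i ≠ 2 → i ≠ 2 * g → cycleCount (prodRGB f) i = 0

/-- `α` is an automorphism of `f`. -/
def IsAut {n : ℕ} (f : Surf n) (α : Equiv.Perm (Fin n)) : Prop :=
  ∀ X, α * f X = f X * α

/-- `q` is (a presentation of) the quotient of `f` by the order-2 automorphism `α`:
there is a surjection `p` whose fibers are exactly the `⟨α⟩`-orbits and which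
intertwines the permutations. -/
def IsQuotientBy (n m : ℕ) (f : Surf n) (α : Equiv.Perm (Fin n)) (q : Surf m) : Prop :=
  ∃ p : Fin n → Fin m, Function.Surjective p ∧
    (∀ x y : Fin n, p x = p y ↔ (y = x ∨ y = α x)) ∧
    ∀ X x, p (f X x) = q X (p x)

/-- `4g - 4` where `g` is the genus of `f`, i.e. `Σ_i μ_i (i-2) - k`. -/
noncomputable def genusFour {n : ℕ} (f : Surf n) : ℤ :=
  (∑ i ∈ Finset.Icc 1 n, (cycleCount (prodRGB f) i : ℤ) * ((i : ℤ) - 2)) - (totalFixed f : ℤ)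

/-- `α` is a hyperelliptic involution of `f`: an order-2 automorphism whose quotient
is a square-tiled surface of genus 0. -/
def IsHyperInvolution {n : ℕ} (f : Surf n) (α : Equiv.Perm (Fin n)) : Prop :=
  IsAut f α ∧ α * α = 1 ∧ α ≠ 1 ∧
    ∃ (m : ℕ) (q : Surf m), IsSTS m q ∧ IsQuotientBy n m f α q ∧ genusFour q = -4

/-- `α` sends every point lying on a cycle of length `2g` of `τ_R·τ_G·τ_B` to a
different cycle (hence exchanges the two cycles of length `2g`). -/
def ExchangesTwoCycles {n : ℕ} (f : Surf n) (α : Equiv.Perm (Fin n)) (g : ℕ) : Prop :=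
  ∀ x : Fin n, ((prodRGB f).cycleOf x).support.card = 2 * g →
    ¬ (prodRGB f).SameCycle x (α x)

/-- Membership in `ST^hyp_Ab([2^{μ2}, 4g-2])`. -/
def InSTHypA (n g μ2 : ℕ) (f : Surf n) : Prop :=
  IsSTS n f ∧ IsAbelian n f ∧ ProfileA n g μ2 f ∧ ∃ α, IsHyperInvolution f α

/-- Membership in `ST^hyp_Ab([2^{μ2}, (2g)^2])`. -/
def InSTHypB (n g μ2 : ℕ) (f : Surf n) : Prop :=
  IsSTS n f ∧ IsAbelian n f ∧ ProfileB n g μ2 f ∧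
    ∃ α, IsHyperInvolution f α ∧ ExchangesTwoCycles f α g

section

open Equiv.Perm

/-! ### Cycle counting and the genus inequality -/

/-- Number of cycles (fixed points included) of a permutation. -/
noncomputable def orbs {S : Type*} (π : Equiv.Perm S) : ℕ :=
  Nat.card (Quotient (SameCycle.setoid π))

/-- The reciprocal of the length of the cycle through `x`. -/
noncomputable def wt {S : Type*} (π : Equiv.Perm S) (x : S) : ℚ :=
  1 / (Set.ncard {y | π.SameCycle x y} : ℚ)

theorem orbs_eq_sum {S : Type*} [Fintype S] (π : Equiv.Perm S) :
    (orbs π : ℚ) = ∑ x, wt π x := by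
  classical
  have : ∀ q : Quotient (SameCycle.setoid π),
      ∑ x ∈ Finset.univ.filter (fun x => (Quotient.mk (SameCycle.setoid π) x) = q), wt π x = 1 := by
    intro q
    induction q using Quotient.inductionOn with
    | h a =>
      have h1 : ∀ x ∈ Finset.univ.filter
          (fun x => (Quotient.mk (SameCycle.setoid π) x) = Quotient.mk _ a),
          wt π x = 1 / (Set.ncard {y | π.SameCycle a y} : ℚ) := by
        intro x hx
        simp only [Finset.mem_filter, Finset.mem_univ, true_and] at hx
        have hx' : π.SameCycle x a := Quotient.exact hx
        have : {y | π.SameCycle x y} = {y | π.SameCycle a y} := by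
          ext y
          exact ⟨fun h => hx'.symm.trans h, fun h => hx'.trans h⟩
        rw [wt, this]
      rw [Finset.sum_congr rfl h1, Finset.sum_const, nsmul_eq_mul]
      have h2 : (Finset.univ.filter
          (fun x => (Quotient.mk (SameCycle.setoid π) x) = Quotient.mk _ a)).card
          = Set.ncard {y | π.SameCycle a y} := by
        rw [← Set.ncard_coe_finset]
        congr 1
        ext y
        simp only [Finset.coe_filter, Finset.mem_univ, true_and, Set.mem_ofPred_eq]
        exact ⟨fun h => (Quotient.exact h : π.SameCycle y a).symm,
          fun h => Quotient.sound (show π.SameCycle y a from h.symm)⟩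
      rw [h2, mul_one_div_cancel]
      have : 0 < Set.ncard {y | π.SameCycle a y} :=
        (Set.ncard_pos (Set.toFinite _)).2 ⟨a, SameCycle.refl _ _⟩
      positivity
  rw [← Finset.sum_fiberwise (s := Finset.univ)
    (g := fun x => (Quotient.mk (SameCycle.setoid π) x))]
  rw [Finset.sum_congr rfl (fun q _ => this q), orbs, Nat.card_eq_fintype_card]
  simp

theorem sameCycle_exists_pow {S : Type*} [Finite S] {π : Equiv.Perm S} {x y : S}
    (h : π.SameCycle x y) : ∃ i : ℕ, (π ^ i) x = y := by
  obtain ⟨i, _, hi⟩ := h.exists_pow_eq'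
  exact ⟨i, hi⟩

theorem sameCycle_pow {S : Type*} (π : Equiv.Perm S) (i : ℕ) (x : S) :
    π.SameCycle x ((π ^ i) x) := ⟨i, by simp⟩

theorem sameCycle_self_apply {S : Type*} (π : Equiv.Perm S) (x : S) :
    π.SameCycle x (π x) := ⟨1, by simp⟩

/-- A set closed under a permutation of a finite set is closed under cycles. -/
theorem mem_of_sameCycle {S : Type*} [Finite S] {π : Equiv.Perm S} {W : Set S}
    (hW : ∀ x ∈ W, π x ∈ W) {x y : S} (h : π.SameCycle x y) (hx : x ∈ W) : y ∈ W := by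
  obtain ⟨i, rfl⟩ := sameCycle_exists_pow h
  induction i with
  | zero => simpa
  | succ i ih =>
    rw [pow_succ', Equiv.Perm.mul_apply]
    exact hW _ (ih (sameCycle_pow _ _ _))

theorem closed_iff {S : Type*} [Finite S] {π : Equiv.Perm S} {W : Set S}
    (hW : ∀ x ∈ W, π x ∈ W) (x : S) : π x ∈ W ↔ x ∈ W :=
  ⟨fun h => mem_of_sameCycle hW (sameCycle_self_apply π x).symm h, hW x⟩

theorem closed_inv {S : Type*} [Finite S] {π : Equiv.Perm S} {W : Set S}
    (hW : ∀ x ∈ W, π x ∈ W) : ∀ x ∈ W, π⁻¹ x ∈ W := fun x hx =>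
  (closed_iff hW _).1 (by simpa using hx)

theorem closed_compl {S : Type*} [Finite S] {π : Equiv.Perm S} {W : Set S}
    (hW : ∀ x ∈ W, π x ∈ W) : ∀ x ∈ Wᶜ, π x ∈ Wᶜ := fun x hx h =>
  hx ((closed_iff hW x).1 h)

theorem pow_agree {S : Type*} {π σ : Equiv.Perm S} {W : Set S}
    (hW : ∀ x ∈ W, π x ∈ W) (h : ∀ x ∈ W, σ x = π x) {x : S} (hx : x ∈ W) (i : ℕ) :
    (σ ^ i) x = (π ^ i) x ∧ (π ^ i) x ∈ W := by
  induction i with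
  | zero => simpa
  | succ i ih =>
    simp only [pow_succ', Equiv.Perm.mul_apply]
    rw [ih.1]
    exact ⟨h _ ih.2, hW _ ih.2⟩

theorem sameCycle_agree {S : Type*} [Finite S] {π σ : Equiv.Perm S} {W : Set S}
    (hW : ∀ x ∈ W, π x ∈ W) (h : ∀ x ∈ W, σ x = π x) {x : S} (hx : x ∈ W) (y : S) :
    σ.SameCycle x y ↔ π.SameCycle x y := by
  constructor
  · intro hy
    obtain ⟨i, rfl⟩ := sameCycle_exists_pow hy
    rw [(pow_agree hW h hx i).1]
    exact sameCycle_pow _ _ _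
  · intro hy
    obtain ⟨i, rfl⟩ := sameCycle_exists_pow hy
    rw [← (pow_agree hW h hx i).1]
    exact sameCycle_pow _ _ _

theorem wt_agree {S : Type*} [Finite S] {π σ : Equiv.Perm S} {W : Set S}
    (hW : ∀ x ∈ W, π x ∈ W) (h : ∀ x ∈ W, σ x = π x) {x : S} (hx : x ∈ W) :
    wt σ x = wt π x := by
  simp only [wt, sameCycle_agree hW h hx]

theorem wt_conj {S : Type*} (g π : Equiv.Perm S) (x : S) :
    wt (g⁻¹ * π * g) x = wt π (g x) := by
  have : {y | (g⁻¹ * π * g).SameCycle x y} = g ⁻¹' {y | π.SameCycle (g x) y} := by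
    ext y
    have := sameCycle_conj (f := π) (g := g⁻¹) (x := x) (y := y)
    simp only [inv_inv] at this
    simp [this]
  rw [wt, wt, this, Set.ncard_preimage_of_injective_subset_range g.injective]
  simp

theorem orbs_conj {S : Type*} [Fintype S] (g π : Equiv.Perm S) :
    orbs (g⁻¹ * π * g) = orbs π := by
  have : (orbs (g⁻¹ * π * g) : ℚ) = orbs π := by
    rw [orbs_eq_sum, orbs_eq_sum]
    simp only [wt_conj]
    exact Equiv.sum_comp g (wt π)
  exact_mod_cast this

theorem orbs_inv {S : Type*} (π : Equiv.Perm S) : orbs π⁻¹ = orbs π := by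
  have : SameCycle.setoid π⁻¹ = SameCycle.setoid π := by
    ext x y
    exact sameCycle_inv
  rw [orbs, orbs, this]

theorem orbs_one {S : Type*} [Fintype S] : orbs (1 : Equiv.Perm S) = Fintype.card S := by
  have : (orbs (1 : Equiv.Perm S) : ℚ) = Fintype.card S := by
    rw [orbs_eq_sum]
    simp [wt]
  exact_mod_cast this

theorem wt_of_fixed {S : Type*} {π : Equiv.Perm S} {x : S} (h : π x = x) : wt π x = 1 := by
  have : {y | π.SameCycle x y} = {x} := by
    ext y
    simp only [Set.mem_ofPred_eq, Set.mem_singleton_iff]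
    constructor
    · rintro ⟨i, rfl⟩
      exact zpow_apply_eq_self_of_apply_eq_self h i
    · rintro rfl
      exact SameCycle.refl _ _
  rw [wt, this]
  simp

theorem wt_of_swap {S : Type*} [Finite S] {π : Equiv.Perm S} {x : S} (h : π (π x) = x)
    (hx : π x ≠ x) : wt π x = 1 / 2 := by
  have : {y | π.SameCycle x y} = {x, π x} := by
    ext y
    simp only [Set.mem_ofPred_eq]
    constructor
    · intro hy
      refine mem_of_sameCycle (W := {x, π x}) ?_ hy (by simp)
      rintro z (rfl | rfl)
      · simp
      · simp [h]
    · rintro (rfl | rfl)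
      · exact SameCycle.refl _ _
      · exact sameCycle_self_apply _ _
  rw [wt, this, Set.ncard_pair (Ne.symm hx)]
  norm_num

/-- Precomposition with a permutation, as a linear map on functions. -/
abbrev pull {S : Type*} (σ : Equiv.Perm S) : (S → ℚ) →ₗ[ℚ] (S → ℚ) :=
  LinearMap.funLeft ℚ ℚ σ

theorem orbs_le_finrank_ker {S : Type*} [Fintype S] (σ : Equiv.Perm S) :
    orbs σ ≤ Module.finrank ℚ (LinearMap.ker (pull σ - 1)) := by
  classical
  let F : (Quotient (SameCycle.setoid σ) → ℚ) →ₗ[ℚ] LinearMap.ker (pull σ - 1) :=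
    LinearMap.codRestrict _ (LinearMap.funLeft ℚ ℚ (Quotient.mk (SameCycle.setoid σ))) (by
      intro c
      rw [LinearMap.mem_ker]
      ext x
      simp only [LinearMap.sub_apply, Module.End.one_apply, Pi.sub_apply, LinearMap.funLeft_apply,
        Pi.zero_apply, sub_eq_zero]
      congr 1
      exact Quotient.sound (show σ.SameCycle (σ x) x from (sameCycle_self_apply σ x).symm))
  have hF : Function.Injective F := by
    intro c d h
    ext q
    induction q using Quotient.inductionOn with
    | h a => exact congrFun (congrArg Subtype.val h) a
  have := LinearMap.finrank_le_finrank_of_injective hF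
  rw [orbs, Nat.card_eq_fintype_card]
  simpa using this

theorem finrank_range_pull_add {S : Type*} [Fintype S] (σ : Equiv.Perm S) :
    Module.finrank ℚ (LinearMap.range (pull σ - 1)) + orbs σ ≤ Fintype.card S := by
  have h1 := LinearMap.finrank_range_add_finrank_ker (pull σ - 1)
  rw [Module.finrank_fintype_fun_eq_card] at h1
  have := orbs_le_finrank_ker σ
  omega

theorem single_sub_single_mem {S : Type*} [DecidableEq S] (σ : Equiv.Perm S) (x : S) :
    (Pi.single x 1 - Pi.single (σ x) 1 : S → ℚ) ∈ LinearMap.range (pull σ - 1) := by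
  refine ⟨Pi.single (σ x) 1, ?_⟩
  ext y
  simp [LinearMap.funLeft_apply, Pi.single_apply, σ.injective.eq_iff]

/-- The genus of a transitive triple of permutations is nonnegative. -/
theorem orbs_add_le {S : Type*} [Fintype S] [Nonempty S] (a b c : Equiv.Perm S)
    (tr : ∀ W : Set S, W.Nonempty → (∀ x ∈ W, a x ∈ W) → (∀ x ∈ W, b x ∈ W) →
      (∀ x ∈ W, c x ∈ W) → W = Set.univ) :
    orbs a + orbs b + orbs c + orbs (a * b * c) ≤ 2 * Fintype.card S + 2 := by
  classical
  set Ia := LinearMap.range (pull a - 1)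
  set Ib := LinearMap.range (pull b - 1)
  set Ic := LinearMap.range (pull c - 1)
  let δ : (Ia × Ib × Ic) →ₗ[ℚ] (S → ℚ) :=
    LinearMap.coprod Ia.subtype (LinearMap.coprod Ib.subtype Ic.subtype)
  have hIa : Ia ≤ LinearMap.range δ := fun v hv => ⟨(⟨v, hv⟩, 0, 0), by simp [δ]⟩
  have hIb : Ib ≤ LinearMap.range δ := fun v hv => ⟨(0, ⟨v, hv⟩, 0), by simp [δ]⟩
  have hIc : Ic ≤ LinearMap.range δ := fun v hv => ⟨(0, 0, ⟨v, hv⟩), by simp [δ]⟩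
  obtain ⟨x0⟩ := ‹Nonempty S›
  have hW : {x | (Pi.single x0 1 - Pi.single x 1 : S → ℚ) ∈ LinearMap.range δ} = Set.univ := by
    have key : ∀ σ : Equiv.Perm S, LinearMap.range (pull σ - 1) ≤ LinearMap.range δ →
        ∀ x ∈ {x | (Pi.single x0 1 - Pi.single x 1 : S → ℚ) ∈ LinearMap.range δ},
        σ x ∈ {x | (Pi.single x0 1 - Pi.single x 1 : S → ℚ) ∈ LinearMap.range δ} := by
      intro σ hσ x hx
      have := Submodule.add_mem _ hx (hσ (single_sub_single_mem σ x))
      simpa using this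
    exact tr _ ⟨x0, by rw [Set.mem_ofPred_eq, sub_self]; exact zero_mem _⟩ (key a hIa) (key b hIb) (key c hIc)
  have htop : Submodule.span ℚ {(Pi.single x0 1 : S → ℚ)} ⊔ LinearMap.range δ = ⊤ := by
    rw [eq_top_iff]
    intro f _
    rw [pi_eq_sum_univ' f]
    refine Submodule.sum_mem _ fun x _ => ?_
    have hx : x ∈ {x | (Pi.single x0 1 - Pi.single x 1 : S → ℚ) ∈ LinearMap.range δ} :=
      hW ▸ Set.mem_univ x
    have h1 := Submodule.sub_mem (Submodule.span ℚ {(Pi.single x0 1 : S → ℚ)} ⊔ LinearMap.range δ)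
      (Submodule.mem_sup_left (Submodule.mem_span_singleton_self _))
      (Submodule.mem_sup_right hx)
    refine Submodule.smul_mem _ _ ?_
    convert h1 using 1
    ext j
    simp [Pi.single_apply, eq_comm]
  have hrank : Fintype.card S ≤ 1 + Module.finrank ℚ (LinearMap.range δ) := by
    have h1 := Submodule.finrank_add_le_finrank_add_finrank
      (Submodule.span ℚ {(Pi.single x0 1 : S → ℚ)}) (LinearMap.range δ)
    rw [htop, finrank_top, Module.finrank_fintype_fun_eq_card] at h1
    have h2 : Module.finrank ℚ (Submodule.span ℚ {(Pi.single x0 1 : S → ℚ)}) = 1 :=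
      finrank_span_singleton (by
        intro h
        have := congrFun h x0
        simp at this)
    omega
  let K := LinearMap.ker (pull (a * b * c) - 1)
  let ψ : K →ₗ[ℚ] (Ia × Ib × Ic) :=
    (LinearMap.prod ((pull a - 1).rangeRestrict)
      (LinearMap.prod ((pull b - 1).rangeRestrict ∘ₗ pull a)
        ((pull c - 1).rangeRestrict ∘ₗ pull b ∘ₗ pull a))) ∘ₗ K.subtype
  have hψ : LinearMap.range ψ ≤ LinearMap.ker δ := by
    rintro _ ⟨⟨f, hf⟩, rfl⟩
    rw [LinearMap.mem_ker] at hf ⊢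
    ext x
    have := congrFun hf x
    simp only [LinearMap.sub_apply, Module.End.one_apply, Pi.sub_apply, LinearMap.funLeft_apply,
      Pi.zero_apply, Equiv.Perm.mul_apply] at this
    simp [δ, ψ, LinearMap.funLeft_apply]
    linarith
  have hker : Module.finrank ℚ (LinearMap.ker ψ) ≤ 1 := by
    let ev : LinearMap.ker ψ →ₗ[ℚ] ℚ :=
      LinearMap.proj x0 ∘ₗ K.subtype ∘ₗ (LinearMap.ker ψ).subtype
    have hev : Function.Injective ev := by
      have inv : ∀ f : K, ψ f = 0 →
          (∀ x, f.1 (a x) = f.1 x) ∧ (∀ x, f.1 (b x) = f.1 x) ∧ (∀ x, f.1 (c x) = f.1 x) := by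
        intro f e
        have ea : ∀ x, f.1 (a x) = f.1 x := fun x => by
          have := congrFun (congrArg (fun t : Ia × Ib × Ic => (t.1 : S → ℚ)) e) x
          simpa [ψ, LinearMap.funLeft_apply, sub_eq_zero] using this
        have eb : ∀ x, f.1 (b x) = f.1 x := fun x => by
          have := congrFun (congrArg (fun t : Ia × Ib × Ic => (t.2.1 : S → ℚ)) e) x
          simpa [ψ, LinearMap.funLeft_apply, sub_eq_zero, ea] using this
        have ec : ∀ x, f.1 (c x) = f.1 x := fun x => by
          have := congrFun (congrArg (fun t : Ia × Ib × Ic => (t.2.2 : S → ℚ)) e) x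
          simpa [ψ, LinearMap.funLeft_apply, sub_eq_zero, ea, eb] using this
        exact ⟨ea, eb, ec⟩
      rintro ⟨f, hf⟩ ⟨g, hg⟩ h0
      have h0 : f.1 x0 = g.1 x0 := h0
      obtain ⟨fa, fb, fc⟩ := inv f hf
      obtain ⟨ga, gb, gc⟩ := inv g hg
      have := tr {x | f.1 x = g.1 x} ⟨x0, h0⟩ (fun x hx => by simpa [fa, ga] using hx)
        (fun x hx => by simpa [fb, gb] using hx) (fun x hx => by simpa [fc, gc] using hx)
      ext x
      have hx : x ∈ {x | f.1 x = g.1 x} := this ▸ Set.mem_univ x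
      exact hx
    simpa using LinearMap.finrank_le_finrank_of_injective hev
  have hK := orbs_le_finrank_ker (a * b * c)
  have h1 := LinearMap.finrank_range_add_finrank_ker ψ
  have h2 := Submodule.finrank_mono hψ
  have h3 := LinearMap.finrank_range_add_finrank_ker δ
  rw [Module.finrank_prod, Module.finrank_prod] at h3
  have ha := finrank_range_pull_add a
  have hb := finrank_range_pull_add b
  have hc := finrank_range_pull_add c
  change orbs (a * b * c) ≤ Module.finrank ℚ K at hK
  change Module.finrank ℚ Ia + _ ≤ _ at ha
  change Module.finrank ℚ Ib + _ ≤ _ at hb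
  change Module.finrank ℚ Ic + _ ≤ _ at hc
  omega

/-! ### Twists and hyperelliptic pairs -/

/-- The cycle of `π` through `x`, as a set. -/
def cyc {S : Type*} (π : Equiv.Perm S) (x : S) : Set S := {y | π.SameCycle x y}

theorem cyc_closed {S : Type*} (π : Equiv.Perm S) (x : S) : ∀ y ∈ cyc π x, π y ∈ cyc π x :=
  fun y hy => SameCycle.trans hy (sameCycle_self_apply π y)

theorem mem_cyc_self {S : Type*} (π : Equiv.Perm S) (x : S) : x ∈ cyc π x := SameCycle.refl _ _

theorem cyc_subset {S : Type*} [Finite S] {π : Equiv.Perm S} {W : Set S}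
    (hW : ∀ x ∈ W, π x ∈ W) {x : S} (hx : x ∈ W) : cyc π x ⊆ W :=
  fun _ hy => mem_of_sameCycle hW hy hx

theorem cyc_eq {S : Type*} {π : Equiv.Perm S} {x y : S} (h : π.SameCycle x y) :
    cyc π x = cyc π y := by
  ext z
  exact ⟨fun hz => h.symm.trans hz, fun hz => h.trans hz⟩

theorem restrictPerm_of_mem {S : Type*} [Finite S] {π : Equiv.Perm S} {W : Set S}
    (hW : ∀ x ∈ W, π x ∈ W) {x : S} (hx : x ∈ W) : restrictPerm π W x = π x := by
  rw [restrictPerm, dif_pos (closed_iff hW)]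
  simp [hx]

theorem restrictPerm_of_not_mem {S : Type*} {π : Equiv.Perm S} {W : Set S} {x : S}
    (hx : x ∉ W) : restrictPerm π W x = x := by
  rw [restrictPerm]
  split_ifs
  · simp [hx]
  · rfl

theorem restrictPerm_pow_of_mem {S : Type*} [Finite S] {π : Equiv.Perm S} {W : Set S}
    (hW : ∀ x ∈ W, π x ∈ W) {x : S} (hx : x ∈ W) (k : ℕ) :
    (restrictPerm π W ^ k) x = (π ^ k) x :=
  (pow_agree hW (fun _ h => restrictPerm_of_mem hW h) hx k).1

theorem restrictPerm_pow_of_not_mem {S : Type*} {π : Equiv.Perm S} {W : Set S} {x : S}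
    (hx : x ∉ W) (k : ℕ) : (restrictPerm π W ^ k) x = x :=
  pow_apply_eq_self_of_apply_eq_self (restrictPerm_of_not_mem hx) k

theorem restrictPerm_sameCycle {S : Type*} [Finite S] {π : Equiv.Perm S} {W : Set S}
    (hW : ∀ x ∈ W, π x ∈ W) (k : ℕ) (x : S) : π.SameCycle x ((restrictPerm π W ^ k) x) := by
  by_cases hx : x ∈ W
  · rw [restrictPerm_pow_of_mem hW hx]
    exact sameCycle_pow _ _ _
  · rw [restrictPerm_pow_of_not_mem hx]

theorem restrictPerm_comm {S : Type*} [Finite S] {π : Equiv.Perm S} {W : Set S}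
    (hW : ∀ x ∈ W, π x ∈ W) : restrictPerm π W * π = π * restrictPerm π W := by
  ext x
  simp only [Equiv.Perm.mul_apply]
  by_cases hx : x ∈ W
  · rw [restrictPerm_of_mem hW hx, restrictPerm_of_mem hW (hW x hx)]
  · rw [restrictPerm_of_not_mem hx, restrictPerm_of_not_mem (closed_compl hW x hx)]

/-- Twisting `J` by `r` on a set where `J` inverts `r` preserves a sum of cycle counts. -/
theorem orbs_twist {S : Type*} [Fintype S] {J r : Equiv.Perm S} {W : Set S}
    (hr : ∀ x ∈ W, r x ∈ W) (hJ : ∀ x ∈ W, J x ∈ W) (hinv : ∀ x ∈ W, r (J (r x)) = J x) :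
    orbs (J * restrictPerm r W) + orbs (J * restrictPerm r W * r) = orbs J + orbs (J * r) := by
  classical
  have hJr : ∀ x ∈ W, (J * r) x ∈ W := fun x hx => hJ _ (hr x hx)
  have hJc := closed_compl hJ
  have hJrc := closed_compl hJr
  have hrc := closed_compl hr
  have hconj : ∀ x ∈ W, (r⁻¹ * J * r) x ∈ W := fun x hx => closed_inv hr _ (hJ _ (hr x hx))
  have e : ∀ x, wt (J * restrictPerm r W) x + wt (J * restrictPerm r W * r) x
      = (wt (J * r) x + if x ∈ W then wt J (r x) else wt J x) := by
    intro x
    by_cases hx : x ∈ W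
    · rw [if_pos hx, ← wt_conj]
      congr 1
      · refine wt_agree hJr (fun y hy => ?_) hx
        simp [restrictPerm_of_mem hr hy]
      · refine wt_agree hconj (fun y hy => ?_) hx
        have := hinv (r y) (hr y hy)
        simp only [Equiv.Perm.mul_apply, restrictPerm_of_mem hr (hr y hy)]
        rw [← this]; simp
    · rw [if_neg hx, add_comm]
      congr 1
      · refine wt_agree (W := Wᶜ) hJrc (fun y hy => ?_) hx
        simp [restrictPerm_of_not_mem (hrc y hy)]
      · refine wt_agree (W := Wᶜ) hJc (fun y hy => ?_) hx
        simp [restrictPerm_of_not_mem hy]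
  have e2 : ∑ x, (if x ∈ W then wt J (r x) else wt J x) = ∑ x, wt J x := by
    rw [← Equiv.sum_comp (restrictPerm r W) (wt J)]
    refine Finset.sum_congr rfl fun x _ => ?_
    by_cases hx : x ∈ W
    · rw [if_pos hx, restrictPerm_of_mem hr hx]
    · rw [if_neg hx, restrictPerm_of_not_mem hx]
  have : ((orbs (J * restrictPerm r W) + orbs (J * restrictPerm r W * r) : ℕ) : ℚ)
      = (orbs J + orbs (J * r) : ℕ) := by
    push_cast
    rw [orbs_eq_sum, orbs_eq_sum, orbs_eq_sum, orbs_eq_sum, ← Finset.sum_add_distrib,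
      Finset.sum_congr rfl (fun x _ => e x), Finset.sum_add_distrib, e2, add_comm]
  exact_mod_cast this

/-- `G` conjugates `r` to its inverse (when `G` is an involution). -/
def Inverts {S : Type*} (G r : Equiv.Perm S) : Prop := ∀ x, r (G (r x)) = G x

theorem Inverts.sameCycle {S : Type*} [Finite S] {G r : Equiv.Perm S} (h : Inverts G r) {x y : S}
    (hxy : r.SameCycle x y) : r.SameCycle (G x) (G y) := by
  obtain ⟨i, rfl⟩ := sameCycle_exists_pow hxy
  induction i with
  | zero => exact SameCycle.refl _ _
  | succ i ih =>
    refine (ih (sameCycle_pow _ _ _)).trans ?_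
    rw [pow_succ', Equiv.Perm.mul_apply, ← h ((r ^ i) x)]
    exact (sameCycle_self_apply _ _).symm

/-- The pair `(r, u)` describing the quotient sphere of a hyperelliptic Abelian surface: `G`
inverts `r` and `u`, the points where `r` and `u` do not commute lie in a single cycle of
`G * u * r` and there are `ℓ` of them. -/
structure Hyp {S : Type*} [Fintype S] (ℓ : ℕ) (r u G : Equiv.Perm S) : Prop where
  sq : ∀ x, G (G x) = x
  inv_r : Inverts G r
  inv_u : Inverts G u
  tr : ∀ W : Set S, W.Nonempty → (∀ x ∈ W, r x ∈ W) → (∀ x ∈ W, u x ∈ W) → W = Set.univ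
  single : ∀ x y, u (r x) ≠ r (u x) → u (r y) ≠ r (u y) → (G * u * r).SameCycle x y
  card : Set.ncard {x | u (r x) ≠ r (u x)} = ℓ
  genus : 2 * Fintype.card S + 2 ≤ orbs (G * u) + orbs G + orbs (G * r) + orbs (G * u * r)

theorem Hyp.swap {S : Type*} [Fintype S] {ℓ : ℕ} {r u G : Equiv.Perm S} (h : Hyp ℓ r u G) :
    Hyp ℓ u r G := by
  have e : G * r * u = (G * u * r)⁻¹ := by
    rw [eq_inv_iff_mul_eq_one]
    ext x
    simp only [Equiv.Perm.mul_apply, Equiv.Perm.one_apply]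
    rw [h.inv_u, h.inv_r, h.sq]
  refine ⟨h.sq, h.inv_u, h.inv_r, fun W a b c => h.tr W a c b, fun x y hx hy => ?_, ?_, ?_⟩
  · rw [e, sameCycle_inv]
    exact h.single x y hx.symm hy.symm
  · rw [← h.card]
    simp only [ne_comm]
  · rw [e, orbs_inv]
    have := h.genus
    omega

theorem Hyp.conj {S : Type*} [Fintype S] {ℓ : ℕ} {r u G : Equiv.Perm S} (h : Hyp ℓ r u G)
    (g : Equiv.Perm S) : Hyp ℓ (g * r * g⁻¹) (g * u * g⁻¹) (g * G * g⁻¹) := by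
  have e : g * G * g⁻¹ * (g * u * g⁻¹) * (g * r * g⁻¹) = g * (G * u * r) * g⁻¹ := by group
  have e1 : g * G * g⁻¹ * (g * u * g⁻¹) = g * (G * u) * g⁻¹ := by group
  have e2 : g * G * g⁻¹ * (g * r * g⁻¹) = g * (G * r) * g⁻¹ := by group
  have hD : {x | (g * u * g⁻¹) ((g * r * g⁻¹) x) ≠ (g * r * g⁻¹) ((g * u * g⁻¹) x)} =
      g.symm ⁻¹' {x | u (r x) ≠ r (u x)} := by
    ext x
    simp
  refine ⟨fun x => by simp [h.sq], fun x => ?_, fun x => ?_, fun W a b c => ?_,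
    fun x y hx hy => ?_, ?_, ?_⟩
  · simpa using h.inv_r (g.symm x)
  · simpa using h.inv_u (g.symm x)
  · have := h.tr (g ⁻¹' W) ?_ ?_ ?_
    · ext x
      have hx : g.symm x ∈ g ⁻¹' W := this ▸ Set.mem_univ _
      simpa using hx
    · obtain ⟨w, hw⟩ := a
      exact ⟨g.symm w, by simpa⟩
    · intro x hx
      simpa using b _ hx
    · intro x hx
      simpa using c _ hx
  · rw [e, sameCycle_conj]
    exact h.single _ _ (by simpa using hx) (by simpa using hy)
  · rw [hD, Set.ncard_preimage_of_injective_subset_range g.symm.injective (by simp), h.card]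
  · rw [e, e1, e2]
    have := fun π => orbs_conj g⁻¹ π
    simp only [inv_inv] at this
    simpa [this] using h.genus

theorem Hyp.inv {S : Type*} [Fintype S] {ℓ : ℕ} {r u G : Equiv.Perm S} (h : Hyp ℓ r u G) :
    Hyp ℓ r⁻¹ u⁻¹ G := by
  have hG : G⁻¹ = G := by
    ext x
    rw [Equiv.Perm.inv_eq_iff_eq, h.sq]
  have key : ∀ s, Inverts G s → G * s * G⁻¹ = s⁻¹ := by
    intro s hs
    rw [hG, eq_inv_iff_mul_eq_one]
    ext x
    simp [hs x, h.sq]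
  have := h.conj G
  rw [key r h.inv_r, key u h.inv_u] at this
  simpa using this

theorem Hyp.nonempty {S : Type*} [Fintype S] {ℓ : ℕ} {r u G : Equiv.Perm S} (h : Hyp ℓ r u G) :
    Nonempty S := by
  by_contra hne
  rw [not_nonempty_iff] at hne
  have := h.genus
  have z : ∀ π : Equiv.Perm S, orbs π = 0 := fun π => by
    have : (orbs π : ℚ) = 0 := by rw [orbs_eq_sum]; simp
    exact_mod_cast this
  simp [z] at this

/-- If `G` exchanges two cycles of `r`, cutting along them disconnects the sphere. -/
theorem Hyp.cap {S : Type*} [Fintype S] {ℓ : ℕ} {r u G : Equiv.Perm S} (h : Hyp ℓ r u G) {x : S}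
    (hx : ¬ r.SameCycle x (G x)) :
    ∃ Y : Set S, (∀ y ∈ Y, r y ∈ Y) ∧ (∀ y ∈ Y, G (u y) ∈ Y) ∧
      (∀ y ∈ Y, ¬ r.SameCycle x y → ¬ r.SameCycle (G x) y → G y ∈ Y) ∧
      (∀ y ∈ Y, u (r y) = r (u y)) ∧ ((x ∉ Y ∧ G x ∈ Y) ∨ (x ∈ Y ∧ G x ∉ Y)) := by
  classical
  have := h.nonempty
  set W : Set S := cyc r x ∪ cyc r (G x) with hWdef
  have hWr : ∀ y ∈ W, r y ∈ W := by
    rintro y (hy | hy)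
    · exact Or.inl (cyc_closed r _ y hy)
    · exact Or.inr (cyc_closed r _ y hy)
  have hWG : ∀ y ∈ W, G y ∈ W := by
    rintro y (hy | hy)
    · exact Or.inr (h.inv_r.sameCycle hy)
    · left
      have := h.inv_r.sameCycle hy
      rwa [h.sq] at this
  have hGne : ∀ y ∈ W, ¬ r.SameCycle y (G y) := by
    rintro y (hy | hy) hyy
    · exact hx (SameCycle.trans hy (hyy.trans (h.inv_r.sameCycle hy).symm))
    · have h2 := h.inv_r.sameCycle hy
      rw [h.sq] at h2
      exact hx (h2.trans (hyy.symm.trans (SameCycle.symm hy)))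
  have hWGc := closed_compl hWG
  have hWrc := closed_compl hWr
  set g := restrictPerm G Wᶜ with hg
  have g_in : ∀ y ∈ W, g y = y := fun y hy => restrictPerm_of_not_mem (fun h => h hy)
  have g_out : ∀ y ∈ Wᶜ, g y = G y := fun y hy => restrictPerm_of_mem hWGc hy
  have gsq : g * g = 1 := by
    ext y
    by_cases hy : y ∈ W
    · simp [g_in y hy]
    · simp [g_out y hy, g_out (G y) (hWGc y hy), h.sq]
  have hlt : orbs G + orbs (G * r) < orbs g + orbs (g * r) := by
    have : ((orbs G + orbs (G * r) : ℕ) : ℚ) < (orbs g + orbs (g * r) : ℕ) := by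
      push_cast
      rw [orbs_eq_sum, orbs_eq_sum, orbs_eq_sum, orbs_eq_sum, ← Finset.sum_add_distrib,
        ← Finset.sum_add_distrib]
      have hin : ∀ y ∈ W, wt G y + wt (G * r) y < wt g y + wt (g * r) y := by
        intro y hy
        rw [wt_of_swap (h.sq y) (fun e => hGne y hy (by rw [e])), wt_of_fixed (g_in y hy),
          wt_of_swap (π := G * r) (by simp [h.inv_r y, h.sq])]
        · have : 0 < wt (g * r) y := by
            have : 0 < Set.ncard {z | (g * r).SameCycle y z} :=
              (Set.ncard_pos (Set.toFinite _)).2 ⟨y, SameCycle.refl _ _⟩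
            rw [wt]; positivity
          linarith
        · intro e
          refine hGne (r y) (hWr y hy) ?_
          rw [Equiv.Perm.mul_apply] at e
          rw [e]
          exact (sameCycle_self_apply _ _).symm
      refine Finset.sum_lt_sum (fun y _ => ?_) ⟨x, Finset.mem_univ _, hin x (Or.inl (mem_cyc_self r x))⟩
      by_cases hy : y ∈ W
      · exact (hin y hy).le
      · refine le_of_eq ?_
        congr 1
        · exact (wt_agree hWGc g_out hy).symm
        · refine (wt_agree (W := Wᶜ) (π := G * r) (fun z hz => hWGc _ (hWrc z hz))
            (fun z hz => ?_) hy).symm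
          exact g_out _ (hWrc z hz)
    exact_mod_cast this
  have hnt : ¬ ∀ W : Set S, W.Nonempty → (∀ x ∈ W, (G * u) x ∈ W) → (∀ x ∈ W, g x ∈ W) →
      (∀ x ∈ W, (g * r) x ∈ W) → W = Set.univ := by
    intro htr
    have h1 := orbs_add_le (G * u) g (g * r) htr
    have h2 : G * u * g * (g * r) = G * u * r := by
      rw [mul_assoc, ← mul_assoc g, gsq, one_mul]
    rw [h2] at h1
    have := h.genus
    omega
  push Not at hnt
  obtain ⟨Z, Zne, ZR, Zg, Zgr, Zu⟩ := hnt
  have Zr : ∀ y ∈ Z, r y ∈ Z := fun y hy => by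
    have := Zg _ (Zgr y hy)
    have e : g ((g * r) y) = r y := by
      rw [← Equiv.Perm.mul_apply, ← mul_assoc, gsq, one_mul]
    rwa [e] at this
  -- A proper invariant set contains exactly one of the two cut cycles.
  have notboth : ∀ Z : Set S, Z.Nonempty → Z ≠ Set.univ → (∀ y ∈ Z, (G * u) y ∈ Z) →
      (∀ y ∈ Z, g y ∈ Z) → (∀ y ∈ Z, r y ∈ Z) → x ∉ Z → G x ∉ Z → False := by
    intro Z Zne Zu ZR Zg Zr h1 h2
    have hZW : ∀ y ∈ Z, y ∉ W := by
      rintro y hy (hyW | hyW)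
      · exact h1 (mem_of_sameCycle Zr (SameCycle.symm hyW) hy)
      · exact h2 (mem_of_sameCycle Zr (SameCycle.symm hyW) hy)
    have ZG : ∀ y ∈ Z, G y ∈ Z := fun y hy => g_out y (hZW y hy) ▸ Zg y hy
    refine Zu (h.tr Z Zne Zr fun y hy => ?_)
    have := ZG _ (ZR y hy)
    rwa [Equiv.Perm.mul_apply, h.sq] at this
  have Zcne : Zᶜ.Nonempty := by
    rw [Set.nonempty_compl]
    exact Zu
  have Zcu : Zᶜ ≠ Set.univ := by
    intro e
    obtain ⟨z, hz⟩ := Zne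
    have : z ∈ Zᶜ := e ▸ Set.mem_univ z
    exact this hz
  have one : (x ∉ Z ∧ G x ∈ Z) ∨ (x ∈ Z ∧ G x ∉ Z) := by
    by_cases a : x ∈ Z <;> by_cases b : G x ∈ Z
    · exact (notboth Zᶜ Zcne Zcu (closed_compl ZR) (closed_compl Zg) (closed_compl Zr)
        (fun c => c a) (fun c => c b)).elim
    · exact Or.inr ⟨a, b⟩
    · exact Or.inl ⟨a, b⟩
    · exact (notboth Z Zne Zu ZR Zg Zr a b).elim
  have Gout : ∀ y, ¬ r.SameCycle x y → ¬ r.SameCycle (G x) y → g y = G y := by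
    intro y h1 h2
    refine g_out y ?_
    rintro (h3 | h3)
    · exact h1 h3
    · exact h2 h3
  have ZRr : ∀ y ∈ Z, (G * u * r) y ∈ Z := fun y hy => ZR _ (Zr y hy)
  by_cases hD : ∃ y ∈ Z, u (r y) ≠ r (u y)
  · obtain ⟨d, hd, hdb⟩ := hD
    refine ⟨Zᶜ, closed_compl Zr, closed_compl ZR, fun y hy h1 h2 => ?_, fun y hy => ?_, ?_⟩
    · exact Gout y h1 h2 ▸ closed_compl Zg y hy
    · by_contra hb
      exact hy (mem_of_sameCycle ZRr (h.single d y hdb hb) hd)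
    · simpa [and_comm, or_comm] using one
  · push Not at hD
    exact ⟨Z, Zr, ZR, fun y hy h1 h2 => Gout y h1 h2 ▸ Zg y hy, hD, one⟩

/-- Existence of a hyperelliptic structure on a pair. -/
def IsHyp {S : Type*} [Fintype S] (ℓ : ℕ) (r u : Equiv.Perm S) : Prop := ∃ G, Hyp ℓ r u G

theorem IsHyp.swap {S : Type*} [Fintype S] {ℓ : ℕ} {r u : Equiv.Perm S} (h : IsHyp ℓ r u) :
    IsHyp ℓ u r :=
  h.imp fun _ => Hyp.swap

theorem IsHyp.conj {S : Type*} [Fintype S] {ℓ : ℕ} {r u : Equiv.Perm S} (h : IsHyp ℓ r u)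
    (g : Equiv.Perm S) : IsHyp ℓ (g * r * g⁻¹) (g * u * g⁻¹) := by
  obtain ⟨G, hG⟩ := h
  exact ⟨_, hG.conj g⟩

theorem IsHyp.inv {S : Type*} [Fintype S] {ℓ : ℕ} {r u : Equiv.Perm S} (h : IsHyp ℓ r u) :
    IsHyp ℓ r⁻¹ u⁻¹ :=
  h.imp fun _ => Hyp.inv

theorem twist_comm_iff {S : Type*} {r u t : Equiv.Perm S} (ht : t * r = r * t) (x : S) :
    (t * u) (r x) = r ((t * u) x) ↔ u (r x) = r (u x) := by
  have h : r (t (u x)) = t (r (u x)) := congrArg (fun σ : Equiv.Perm S => σ (u x)) ht.symm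
  simp only [Equiv.Perm.mul_apply]
  rw [h, t.injective.eq_iff]

theorem Hyp.tr_twist {S : Type*} [Fintype S] {ℓ : ℕ} {r u G : Equiv.Perm S} (h : Hyp ℓ r u G)
    {O : Set S} (hO : ∀ x ∈ O, r x ∈ O) (W : Set S) (hne : W.Nonempty)
    (hr : ∀ x ∈ W, r x ∈ W) (hu : ∀ x ∈ W, (restrictPerm r O * u) x ∈ W) : W = Set.univ := by
  refine h.tr W hne hr fun x hx => ?_
  refine mem_of_sameCycle hr ?_ (hu x hx)
  simpa using (restrictPerm_sameCycle hO 1 (u x)).symm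

theorem Hyp.card_twist {S : Type*} [Fintype S] {ℓ : ℕ} {r u G : Equiv.Perm S} (h : Hyp ℓ r u G)
    {O : Set S} (hO : ∀ x ∈ O, r x ∈ O) :
    Set.ncard {x | (restrictPerm r O * u) (r x) ≠ r ((restrictPerm r O * u) x)} = ℓ := by
  rw [← h.card]
  simp only [ne_eq, twist_comm_iff (restrictPerm_comm hO)]

/-- Twisting along a cycle of `r` stable under `G`. -/
theorem Hyp.twist_stable {S : Type*} [Fintype S] {ℓ : ℕ} {r u G : Equiv.Perm S}
    (h : Hyp ℓ r u G) {O : Set S} (hO : ∀ x ∈ O, r x ∈ O) (hGO : ∀ x ∈ O, G x ∈ O) :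
    IsHyp ℓ r (restrictPerm r O * u) := by
  set t := restrictPerm r O with ht
  have t_in : ∀ x ∈ O, t x = r x := fun x hx => restrictPerm_of_mem hO hx
  have t_out : ∀ x ∉ O, t x = x := fun x hx => restrictPerm_of_not_mem hx
  have hOi := closed_inv hO
  have ti_in : ∀ x ∈ O, t⁻¹ x = r⁻¹ x := fun x hx => by
    rw [Equiv.Perm.inv_eq_iff_eq, t_in _ (hOi x hx)]
    simp
  have ti_out : ∀ x ∉ O, t⁻¹ x = x := fun x hx => by
    rw [Equiv.Perm.inv_eq_iff_eq, t_out _ hx]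
  have hGOc := closed_compl hGO
  have hOc := closed_compl hO
  set J := G * t⁻¹ with hJ
  have J_in : ∀ x ∈ O, J x = r (G x) := fun x hx => by
    rw [hJ, Equiv.Perm.mul_apply, ti_in x hx, ← h.inv_r (r⁻¹ x)]
    simp
  have J_out : ∀ x ∉ O, J x = G x := fun x hx => by
    rw [hJ, Equiv.Perm.mul_apply, ti_out x hx]
  have hJO : ∀ x ∈ O, J x ∈ O := fun x hx => J_in x hx ▸ hO _ (hGO x hx)
  have hJr : Inverts J r := by
    intro x
    by_cases hx : x ∈ O
    · rw [J_in _ (hO x hx), J_in x hx, h.inv_r]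
    · rw [J_out _ (hOc x hx), J_out x hx, h.inv_r]
  have eJ : J * (t * u) = G * u := by rw [hJ]; group
  have Jsq : ∀ x, J (J x) = x := by
    intro x
    by_cases hx : x ∈ O
    · rw [J_in _ (hJO x hx), J_in x hx, h.inv_r, h.sq]
    · rw [J_out x hx, J_out _ (hGOc x hx), h.sq]
  refine ⟨J, Jsq, hJr, fun x => ?_, h.tr_twist hO, fun x y hx hy => ?_, h.card_twist hO, ?_⟩
  · have e : ∀ y, J ((t * u) y) = G (u y) := fun y => congrArg (fun σ : Equiv.Perm S => σ y) eJ
    have e1 : J ((t * u) (J ((t * u) x))) = x := by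
      rw [e, e, h.inv_u, h.sq]
    rw [← Jsq ((t * u) (J ((t * u) x))), e1]
  · rw [eJ]
    rw [ne_eq, twist_comm_iff (restrictPerm_comm hO)] at hx hy
    exact h.single x y hx hy
  · rw [eJ]
    have h1 := orbs_twist hO hJO (fun x _ => hJr x)
    have h2 : J * t = G := by rw [hJ]; group
    rw [← ht, h2] at h1
    have := h.genus
    omega

/-- Twisting along a cycle of `r` not stable under `G`, when the part of the sphere on the other
side of its mirror image contains no singularity. -/
theorem Hyp.twist_of_cap {S : Type*} [Fintype S] {ℓ : ℕ} {r u G : Equiv.Perm S}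
    (h : Hyp ℓ r u G) {x : S} {Y : Set S} (Yr : ∀ y ∈ Y, r y ∈ Y) (YR : ∀ y ∈ Y, G (u y) ∈ Y)
    (YG : ∀ y ∈ Y, ¬ r.SameCycle x y → ¬ r.SameCycle (G x) y → G y ∈ Y)
    (YD : ∀ y ∈ Y, u (r y) = r (u y)) (hx : x ∉ Y) (hGx : G x ∈ Y) :
    IsHyp ℓ r (restrictPerm r (cyc r x) * u) := by
  set O := cyc r x with hOdef
  have hO : ∀ y ∈ O, r y ∈ O := cyc_closed r x
  have hOY : ∀ y ∈ O, y ∉ Y := fun y hy hyY => hx (mem_of_sameCycle Yr (SameCycle.symm hy) hyY)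
  set P := cyc r (G x) with hPdef
  have hPY : P ⊆ Y := cyc_subset Yr hGx
  have GP : ∀ y, G y ∈ O ↔ y ∈ P := by
    intro y
    constructor
    · intro hy
      have := h.inv_r.sameCycle hy
      rwa [h.sq] at this
    · intro hy
      have := h.inv_r.sameCycle hy
      rwa [h.sq] at this
  have GO : ∀ y, G y ∈ P ↔ y ∈ O := fun y => by rw [← GP, h.sq]
  set V : Set S := Y \ P with hV
  have Vr : ∀ y ∈ V, r y ∈ V := fun y hy =>
    ⟨Yr y hy.1, fun hp => hy.2 ((closed_iff (cyc_closed r (G x)) y).1 hp)⟩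
  have VG : ∀ y ∈ V, G y ∈ V := fun y hy =>
    ⟨YG y hy.1 (fun hO' => hOY y hO' hy.1) hy.2, fun hp => hOY y ((GO y).1 hp) hy.1⟩
  have Vrc := closed_compl Vr
  have VGc := closed_compl VG
  have Yrc := closed_compl Yr
  have YRc : ∀ y ∈ Yᶜ, (G * u) y ∈ Yᶜ := closed_compl (π := G * u) YR
  set J := G * restrictPerm r V with hJ
  have J_in : ∀ y ∈ V, J y = G (r y) := fun y hy => by
    rw [hJ, Equiv.Perm.mul_apply, restrictPerm_of_mem Vr hy]
  have J_out : ∀ y ∉ V, J y = G y := fun y hy => by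
    rw [hJ, Equiv.Perm.mul_apply, restrictPerm_of_not_mem hy]
  have hJr : Inverts J r := by
    intro y
    by_cases hy : y ∈ V
    · rw [J_in _ (Vr y hy), J_in y hy, h.inv_r]
    · rw [J_out _ (Vrc y hy), J_out y hy, h.inv_r]
  have Jsq : ∀ y, J (J y) = y := by
    intro y
    by_cases hy : y ∈ V
    · rw [J_in y hy, J_in _ (VG _ (Vr y hy)), h.inv_r, h.sq]
    · rw [J_out y hy, J_out _ (VGc y hy), h.sq]
  set R := G * u * restrictPerm r Y with hR
  have R_in : ∀ y ∈ Y, R y = G (u (r y)) := fun y hy => by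
    rw [hR, Equiv.Perm.mul_apply, restrictPerm_of_mem Yr hy]; rfl
  have R_out : ∀ y ∉ Y, R y = G (u y) := fun y hy => by
    rw [hR, Equiv.Perm.mul_apply, restrictPerm_of_not_mem hy]; rfl
  have hJR : J * R = restrictPerm r O * u := by
    ext y
    simp only [Equiv.Perm.mul_apply]
    by_cases hy : y ∈ Y
    · rw [R_in y hy]
      by_cases hz : G (u (r y)) ∈ P
      · rw [J_out _ (fun hv => hv.2 hz), h.sq]
        have hu : u (r y) ∈ O := (GO _).1 hz
        rw [YD y hy] at hu ⊢
        rw [restrictPerm_of_mem hO ((closed_iff hO _).1 hu)]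
      · have hzV : G (u (r y)) ∈ V := ⟨YR _ (Yr y hy), hz⟩
        have hu : u (r y) ∉ O := fun hu => hz ((GO _).2 hu)
        rw [YD y hy, closed_iff hO] at hu
        rw [J_in _ hzV, restrictPerm_of_not_mem hu, YD y hy]
        have := h.inv_r (G (r (u y)))
        rw [h.sq] at this
        rw [← r.injective.eq_iff, this]
    · have hGy : G (u y) ∉ Y := YRc y hy
      rw [R_out y hy, J_out _ (fun hv => hGy hv.1), h.sq, restrictPerm_of_not_mem]
      intro hu
      exact hGy (hPY ((GO _).2 hu))
  have hRJ : J * (restrictPerm r O * u) = R := by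
    rw [← hJR]
    ext y
    simp [Jsq]
  have Rsq : ∀ y, R (R y) = y := by
    intro y
    by_cases hy : y ∈ Y
    · rw [R_in y hy, R_in _ (YR _ (Yr y hy)), YD y hy, h.inv_r, h.inv_u, h.sq]
    · rw [R_out y hy, R_out (G (u y)) (YRc y hy), h.inv_u, h.sq]
  have hYinv : ∀ y ∈ Y, r ((G * u) (r y)) = (G * u) y := by
    intro y hy
    simp only [Equiv.Perm.mul_apply]
    rw [YD y hy, h.inv_r]
  refine ⟨J, Jsq, hJr, fun y => ?_, h.tr_twist hO, fun y z hy hz => ?_, h.card_twist hO, ?_⟩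
  · have e : ∀ z, J ((restrictPerm r O * u) z) = R z :=
      fun z => congrArg (fun σ : Equiv.Perm S => σ z) hRJ
    have e1 : J ((restrictPerm r O * u) (J ((restrictPerm r O * u) y))) = y := by
      rw [e, e, Rsq]
    rw [← Jsq ((restrictPerm r O * u) (J ((restrictPerm r O * u) y))), e1]
  · rw [hRJ]
    rw [ne_eq, twist_comm_iff (restrictPerm_comm hO)] at hy hz
    have hyY : y ∈ Yᶜ := fun hyY => hy (YD y hyY)
    refine (sameCycle_agree (π := G * u * r) (W := Yᶜ) (fun w hw => YRc _ (Yrc w hw))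
      (fun w hw => ?_) hyY z).2 (h.single y z hy hz)
    rw [Equiv.Perm.mul_apply, R_out _ (Yrc w hw)]
    rfl
  · rw [hRJ]
    have h1 := orbs_twist Vr VG (fun x _ => h.inv_r x)
    have h2 := orbs_twist (J := G * u) Yr YR hYinv
    rw [← hJ] at h1
    rw [← hR] at h2
    have := h.genus
    omega

/-- Twisting along any cycle of `r` preserves hyperellipticity. -/
theorem IsHyp.twist {S : Type*} [Fintype S] {ℓ : ℕ} {r u : Equiv.Perm S} (h : IsHyp ℓ r u)
    (x : S) : IsHyp ℓ r (restrictPerm r (cyc r x) * u) := by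
  obtain ⟨G, hG⟩ := h
  by_cases hx : r.SameCycle x (G x)
  · exact hG.twist_stable (cyc_closed r x) fun y hy => hx.trans (hG.inv_r.sameCycle hy)
  obtain ⟨Y, Yr, YR, YG, YD, ⟨h1, h2⟩ | ⟨h1, h2⟩⟩ := hG.cap hx
  · exact hG.twist_of_cap Yr YR YG YD h1 h2
  · set t := restrictPerm r (cyc r (G x)) with ht
    have h3 : IsHyp ℓ r (t * u) := by
      refine hG.twist_of_cap Yr YR ?_ YD h2 (by rwa [hG.sq])
      rw [hG.sq]
      exact fun y hy a b => YG y hy b a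
    have htr : t * r = r * t := restrictPerm_comm (cyc_closed r _)
    have h4 := h3.conj t⁻¹
    have e1 : t⁻¹ * r * t⁻¹⁻¹ = r := by rw [inv_inv, mul_assoc, ← htr]; group
    have e2 : t⁻¹ * (t * u) * t⁻¹⁻¹ = u * t := by group
    rw [e1, e2] at h4
    have h5 := h4.conj G
    have hGi : G⁻¹ = G := by
      ext y
      rw [Equiv.Perm.inv_eq_iff_eq, hG.sq]
    have key : ∀ s, Inverts G s → G * s * G⁻¹ = s⁻¹ := by
      intro s hs
      rw [hGi, eq_inv_iff_mul_eq_one]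
      ext x
      simp [hs x, hG.sq]
    have e3 : G * t * G⁻¹ = (restrictPerm r (cyc r x))⁻¹ := by
      rw [hGi, eq_inv_iff_mul_eq_one]
      ext y
      simp only [Equiv.Perm.mul_apply, Equiv.Perm.one_apply]
      by_cases hy : y ∈ cyc r x
      · rw [restrictPerm_of_mem (cyc_closed r x) hy, ht, restrictPerm_of_mem (cyc_closed r _),
          hG.inv_r, hG.sq]
        exact hG.inv_r.sameCycle (cyc_closed r x y hy)
      · rw [restrictPerm_of_not_mem hy, ht, restrictPerm_of_not_mem, hG.sq]
        intro hy'
        refine hy ?_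
        have := hG.inv_r.sameCycle hy'
        rwa [hG.sq, hG.sq] at this
    have e4 : G * (u * t) * G⁻¹ = (restrictPerm r (cyc r x) * u)⁻¹ := by
      rw [mul_inv_rev, ← e3, ← key u hG.inv_u]
      group
    rw [key r hG.inv_r, e4] at h5
    simpa using h5.inv

theorem IsHyp.twist_pow {S : Type*} [Fintype S] {ℓ : ℕ} {r u : Equiv.Perm S} (h : IsHyp ℓ r u)
    (x : S) (k : ℕ) : IsHyp ℓ r (restrictPerm r (cyc r x) ^ k * u) := by
  induction k with
  | zero => simpa
  | succ k ih =>
    rw [pow_succ', mul_assoc]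
    exact ih.twist x

/-- `Conn N r u r' u'`: the pair `(r', u')` is obtained from `(r, u)` by at most `N` powers of
twists along cycles of `r` or `u`, up to simultaneous conjugation. -/
inductive Conn {S : Type*} : ℕ → Equiv.Perm S → Equiv.Perm S → Equiv.Perm S → Equiv.Perm S → Prop
  | conj (r u g : Equiv.Perm S) : Conn 0 r u (g * r * g⁻¹) (g * u * g⁻¹)
  | hstep (r u : Equiv.Perm S) (x : S) (k : ℕ) :
      Conn 1 r u r (restrictPerm r (cyc r x) ^ k * u)
  | vstep (r u : Equiv.Perm S) (x : S) (k : ℕ) :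
      Conn 1 r u (restrictPerm u (cyc u x) ^ k * r) u
  | trans {N M : ℕ} {r u r' u' r'' u'' : Equiv.Perm S} :
      Conn N r u r' u' → Conn M r' u' r'' u'' → Conn (N + M) r u r'' u''
  | weaken {N M : ℕ} {r u r' u' : Equiv.Perm S} : Conn N r u r' u' → N ≤ M → Conn M r u r' u'

theorem Conn.refl {S : Type*} (r u : Equiv.Perm S) : Conn 0 r u r u := by
  simpa using Conn.conj r u 1

theorem Conn.swap {S : Type*} {N : ℕ} {r u r' u' : Equiv.Perm S} (h : Conn N r u r' u') :
    Conn N u r u' r' := by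
  induction h with
  | conj r u g => exact Conn.conj u r g
  | hstep r u x k => exact Conn.vstep u r x k
  | vstep r u x k => exact Conn.hstep u r x k
  | trans _ _ h1 h2 => exact h1.trans h2
  | weaken _ h h1 => exact h1.weaken h

theorem Conn.symm {S : Type*} [Finite S] {N : ℕ} {r u r' u' : Equiv.Perm S}
    (h : Conn N r u r' u') : Conn N r' u' r u := by
  have key : ∀ (t : Equiv.Perm S) (k : ℕ), ∃ l : ℕ, t ^ l * t ^ k = 1 := by
    intro t k
    refine ⟨(orderOf t - 1) * k, ?_⟩
    have h1 : orderOf t - 1 + 1 = orderOf t := Nat.sub_add_cancel (orderOf_pos t)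
    rw [← pow_add, ← Nat.succ_mul, Nat.succ_eq_add_one, h1, pow_mul, pow_orderOf_eq_one, one_pow]
  induction h with
  | conj r u g =>
    have := Conn.conj (g * r * g⁻¹) (g * u * g⁻¹) g⁻¹
    have e : ∀ s, g⁻¹ * (g * s * g⁻¹) * g⁻¹⁻¹ = s := fun s => by group
    rwa [e, e] at this
  | hstep r u x k =>
    obtain ⟨l, hl⟩ := key (restrictPerm r (cyc r x)) k
    have := Conn.hstep r (restrictPerm r (cyc r x) ^ k * u) x l
    rwa [← mul_assoc, hl, one_mul] at this
  | vstep r u x k =>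
    obtain ⟨l, hl⟩ := key (restrictPerm u (cyc u x)) k
    have := Conn.vstep (restrictPerm u (cyc u x) ^ k * r) u x l
    rwa [← mul_assoc, hl, one_mul] at this
  | trans _ _ h1 h2 => exact (h2.trans h1).weaken (by omega)
  | weaken _ h h1 => exact h1.weaken h

theorem Conn.isHyp {S : Type*} [Fintype S] {ℓ : ℕ} {N : ℕ} {r u r' u' : Equiv.Perm S}
    (h : Conn N r u r' u') : IsHyp ℓ r u → IsHyp ℓ r' u' := by
  induction h with
  | conj r u g => exact fun h => h.conj g
  | hstep r u x k => exact fun h => h.twist_pow x k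
  | vstep r u x k => exact fun h => (h.swap.twist_pow x k).swap
  | trans _ _ h1 h2 => exact fun h => h2 (h1 h)
  | weaken _ h h1 => exact h1

/-- Twisting on the right of `r`. -/
theorem Conn.vstep_right {S : Type*} [Finite S] (r u : Equiv.Perm S) (x : S) (k : ℕ) :
    Conn 1 r u (r * restrictPerm u (cyc u x) ^ k) u := by
  set t := restrictPerm u (cyc u x) ^ k with ht
  have h1 := (Conn.vstep r u x k).trans (Conn.conj _ _ t⁻¹)
  have hc : t * u = u * t := by
    have : Commute (restrictPerm u (cyc u x)) u := restrictPerm_comm (cyc_closed u x)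
    exact (this.pow_left k).eq
  have e1 : t⁻¹ * (t * r) * t⁻¹⁻¹ = r * t := by group
  have e2 : t⁻¹ * u * t⁻¹⁻¹ = u := by rw [inv_inv, mul_assoc, ← hc]; group
  rwa [← ht, e1, e2] at h1

/-! ### Merging the horizontal cylinders -/

/-- The union of the cycles of `r` containing a singularity. -/
def singCyc {S : Type*} (r u : Equiv.Perm S) : Set S :=
  {x | ∃ d, r.SameCycle x d ∧ u (r d) ≠ r (u d)}

theorem singCyc_congr {S : Type*} {r u : Equiv.Perm S} {x y : S} (h : r.SameCycle x y) :
    x ∈ singCyc r u ↔ y ∈ singCyc r u :=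
  ⟨fun ⟨d, h1, h2⟩ => ⟨d, h.symm.trans h1, h2⟩, fun ⟨d, h1, h2⟩ => ⟨d, h.trans h1, h2⟩⟩

theorem sameCycle_apply_of_not_mem_singCyc {S : Type*} [Finite S] {r u : Equiv.Perm S} {x y : S}
    (hx : x ∉ singCyc r u) (h : r.SameCycle x y) : r.SameCycle (u x) (u y) := by
  obtain ⟨i, rfl⟩ := sameCycle_exists_pow h
  induction i with
  | zero => exact SameCycle.refl _ _
  | succ i ih =>
    refine (ih (sameCycle_pow _ _ _)).trans ?_
    have : u (r ((r ^ i) x)) = r (u ((r ^ i) x)) := by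
      by_contra hne
      exact hx ⟨_, sameCycle_pow _ _ _, hne⟩
    rw [pow_succ', Equiv.Perm.mul_apply, this]
    exact sameCycle_self_apply _ _

/-- The orbit of `y` under `u` reaches a singular cycle of `r` for the first time after `n` steps,
and this cycle is `c`. -/
def Reaches {S : Type*} (r u : Equiv.Perm S) (y : S) (n : ℕ) (c : Set S) : Prop :=
  (∀ j < n, (u ^ j) y ∉ singCyc r u) ∧ (u ^ n) y ∈ singCyc r u ∧ cyc r ((u ^ n) y) = c

theorem Reaches.unique {S : Type*} {r u : Equiv.Perm S} {y : S} {n n' : ℕ} {c c' : Set S}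
    (h : Reaches r u y n c) (h' : Reaches r u y n' c') : n = n' ∧ c = c' := by
  have e : n = n' := by
    rcases lt_trichotomy n n' with hl | hl | hl
    · exact absurd h.2.1 (h'.1 n hl)
    · exact hl
    · exact absurd h'.2.1 (h.1 n' hl)
  subst e
  exact ⟨rfl, h.2.2.symm.trans h'.2.2⟩

theorem Reaches.congr {S : Type*} [Finite S] {r u : Equiv.Perm S} {y y' : S} {n : ℕ} {c : Set S}
    (hy : r.SameCycle y y') (h : Reaches r u y n c) : Reaches r u y' n c := by
  have key : ∀ j ≤ n, r.SameCycle ((u ^ j) y) ((u ^ j) y') := by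
    intro j
    induction j with
    | zero => exact fun _ => hy
    | succ j ih =>
      intro hj
      rw [pow_succ', Equiv.Perm.mul_apply, Equiv.Perm.mul_apply]
      exact sameCycle_apply_of_not_mem_singCyc (h.1 j (by omega)) (ih (by omega))
  exact ⟨fun j hj => (singCyc_congr (key j hj.le)).not.1 (h.1 j hj),
    (singCyc_congr (key n le_rfl)).1 h.2.1, (cyc_eq (key n le_rfl)).symm.trans h.2.2⟩

theorem Hyp.comm_iff {S : Type*} [Fintype S] {ℓ : ℕ} {r u G : Equiv.Perm S} (h : Hyp ℓ r u G)
    (x : S) : u (r x) = r (u x) ↔ G (u (r (G (u (r x))))) = x := by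
  have e : ∀ y, u (G y) = G (u⁻¹ y) := fun y => by
    have := h.inv_u (u⁻¹ y)
    simpa using this
  have e' : ∀ y, r (G y) = G (r⁻¹ y) := fun y => by
    have := h.inv_r (r⁻¹ y)
    simpa using this
  rw [e', e, h.sq, Equiv.Perm.inv_eq_iff_eq, Equiv.Perm.inv_eq_iff_eq]

theorem Hyp.R_sq {S : Type*} [Fintype S] {ℓ : ℕ} {r u G : Equiv.Perm S} (h : Hyp ℓ r u G)
    (x : S) : G (u (G (u x))) = x := by
  rw [h.inv_u, h.sq]

/-- On a regular cycle of `r` the involution `R = G * u` inverts `r`. -/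
theorem Hyp.R_regular {S : Type*} [Fintype S] {ℓ : ℕ} {r u G : Equiv.Perm S} (h : Hyp ℓ r u G)
    {x : S} (hx : x ∈ singCyc r u) : G (u x) ∈ singCyc r u := by
  by_contra hn
  set e := G (u x) with he
  have hreg : ∀ y, r.SameCycle e y → u (r y) = r (u y) := fun y hy => by
    by_contra hne
    exact hn ⟨y, hy, hne⟩
  have hxe : G (u e) = x := h.R_sq x
  have key : ∀ i : ℕ, (r ^ i) (G (u ((r ^ i) e))) = x := by
    intro i
    induction i with
    | zero => simpa using hxe
    | succ i ih =>
      rw [← ih]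
      have h1 := (h.comm_iff _).1 (hreg _ (sameCycle_pow r i e))
      have h2 : r (G (u (r ((r ^ i) e)))) = G (u ((r ^ i) e)) := by
        rw [← h.R_sq (r (G (u (r ((r ^ i) e)))))]
        rw [h1]
      have e2 : (r ^ (i + 1)) e = r ((r ^ i) e) := by rw [pow_succ', Equiv.Perm.mul_apply]
      rw [e2, pow_succ, Equiv.Perm.mul_apply, h2]
  obtain ⟨d, hxd, hd⟩ := hx
  obtain ⟨i, rfl⟩ := sameCycle_exists_pow hxd.symm
  -- `d` is the image of a regular point under `G * u * r`
  have hd' : G (u ((r ^ i) e)) = d := (r ^ i).injective (key i)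
  set y := r⁻¹ ((r ^ i) e) with hy
  have hry : r y = (r ^ i) e := by rw [hy]; simp
  have hyreg := (h.comm_iff y).1 (hreg y
    ((sameCycle_pow r i e).trans (by rw [← hry]; exact (sameCycle_self_apply _ _).symm)))
  refine hd ((h.comm_iff d).2 ?_)
  rw [hry, hd'] at hyreg
  rw [hyreg, hry, hd']

/-- The orbit under `u` of a mirror image of a singular cycle of `r` comes back to that cycle
before meeting any other singular cycle. -/
theorem Hyp.reaches_mirror {S : Type*} [Fintype S] {ℓ : ℕ} {r u G : Equiv.Perm S}
    (h : Hyp ℓ r u G) {x y : S} (hx : x ∈ singCyc r u) (hy : r.SameCycle (G x) y) :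
    ∃ n, Reaches r u y n (cyc r x) := by
  by_cases hGx : r.SameCycle x (G x)
  · have hxy := hGx.trans hy
    exact ⟨0, by simp, by simpa using (singCyc_congr hxy).1 hx, by simpa using (cyc_eq hxy).symm⟩
  obtain ⟨Y, Yr, YR, YG, YD, hY⟩ := h.cap hGx
  have Ysing : ∀ z ∈ Y, z ∉ singCyc r u := by
    rintro z hz ⟨d, hzd, hd⟩
    exact hd (YD d (mem_of_sameCycle Yr hzd hz))
  have hxY : x ∉ Y := fun hxY => Ysing x hxY hx
  have hGxY : G x ∈ Y := by
    rcases hY with hY | hY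
    · exact hY.2
    · exact absurd hY.1 hxY
  have hyY : y ∈ Y := mem_of_sameCycle Yr hy hGxY
  have hOY : ∀ z ∈ Y, ¬ r.SameCycle x z := fun z hz hxz =>
    hxY (mem_of_sameCycle Yr hxz.symm hz)
  have hu : ∀ z ∈ Y, (u z ∈ Y ∧ ¬ r.SameCycle (G x) (u z)) ∨ r.SameCycle x (u z) := by
    intro z hz
    have hRz := YR z hz
    by_cases hP : r.SameCycle (G x) (G (u z))
    · right
      have := h.inv_r.sameCycle hP
      rwa [h.sq, h.sq] at this
    · left
      have h1 := YG _ hRz (hOY _ hRz) hP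
      rw [h.sq] at h1
      refine ⟨h1, fun h2 => ?_⟩
      have := h.inv_r.sameCycle h2
      rw [h.sq] at this
      exact hOY _ hRz this
  have hex : ∃ i, (u ^ i) y ∉ Y := by
    by_contra hall
    push Not at hall
    have h1 := hu _ (hall (orderOf u - 1))
    have h2 : u ((u ^ (orderOf u - 1)) y) = y := by
      rw [← Equiv.Perm.mul_apply, ← pow_succ', Nat.sub_add_cancel (orderOf_pos u),
        pow_orderOf_eq_one, Equiv.Perm.one_apply]
    rw [h2] at h1
    rcases h1 with h1 | h1
    · exact h1.2 hy
    · exact hOY y hyY h1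
  classical
  have hi := Nat.find_spec hex
  have hmin : ∀ j < Nat.find hex, (u ^ j) y ∈ Y := fun j hj => not_not.1 (Nat.find_min hex hj)
  set i := Nat.find hex
  have hxi : r.SameCycle x ((u ^ i) y) := by
    rcases Nat.eq_zero_or_pos i with h0 | h0
    · rw [h0] at hi
      exact absurd hyY hi
    · have h1 := hu _ (hmin (i - 1) (by omega))
      rw [← Equiv.Perm.mul_apply, ← pow_succ', Nat.sub_add_cancel h0] at h1
      rcases h1 with h1 | h1
      · exact absurd h1.1 hi
      · exact h1
  exact ⟨i, fun j hj => Ysing _ (hmin j hj), (singCyc_congr hxi).1 hx, (cyc_eq hxi).symm⟩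

/-- Twisting `r` along a cycle of `u` that meets every cycle of `r` at most once merges all the
cycles of `r` it meets. -/
theorem merge {S : Type*} [Finite S] {r u : Equiv.Perm S} {x : S}
    (hinj : ∀ y ∈ cyc u x, ∀ z ∈ cyc u x, r.SameCycle y z → y = z) :
    ∀ y ∈ cyc u x, cyc r y ⊆ cyc (r * restrictPerm u (cyc u x)) x := by
  set c := restrictPerm u (cyc u x) with hc
  have c_in : ∀ y ∈ cyc u x, c y = u y := fun y hy => restrictPerm_of_mem (cyc_closed u x) hy
  have step : ∀ y ∈ cyc u x, cyc r (u y) ⊆ cyc (r * c) y := by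
    intro y hy z hz
    have huy := cyc_closed u x y hy
    have key : ∀ k : ℕ, (r * c).SameCycle y ((r ^ (k + 1)) (u y)) := by
      have h0 : (r * c) y = r (u y) := by rw [Equiv.Perm.mul_apply, c_in y hy]
      intro k
      induction k with
      | zero =>
        rw [zero_add, pow_one, ← h0]
        exact sameCycle_self_apply _ _
      | succ k ih =>
        by_cases hk : (r ^ (k + 1)) (u y) ∈ cyc u x
        · have := hinj _ huy _ hk (sameCycle_pow _ _ _)
          rw [pow_succ', Equiv.Perm.mul_apply, ← this, ← h0]
          exact sameCycle_self_apply _ _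
        · refine ih.trans ?_
          have : (r * c) ((r ^ (k + 1)) (u y)) = (r ^ (k + 1 + 1)) (u y) := by
            rw [Equiv.Perm.mul_apply, hc, restrictPerm_of_not_mem hk, ← Equiv.Perm.mul_apply,
              ← pow_succ']
          rw [← this]
          exact sameCycle_self_apply _ _
    have hz' : r.SameCycle (r (u y)) z := (sameCycle_self_apply r (u y)).symm.trans hz
    obtain ⟨i, rfl⟩ := sameCycle_exists_pow hz'
    have := key i
    rwa [pow_succ, Equiv.Perm.mul_apply] at this
  have hall : ∀ y ∈ cyc u x, (r * c).SameCycle x y := by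
    intro y hy
    refine mem_of_sameCycle (π := u) (W := {y | y ∈ cyc u x ∧ (r * c).SameCycle x y}) ?_ hy
      ⟨mem_cyc_self u x, SameCycle.refl _ _⟩ |>.2
    rintro z ⟨hz, hxz⟩
    exact ⟨cyc_closed u x z hz, hxz.trans (step z hz (mem_cyc_self r _))⟩
  intro y hy z hz
  have hy' : u⁻¹ y ∈ cyc u x := closed_inv (cyc_closed u x) y hy
  have := step _ hy'
  rw [show u (u⁻¹ y) = y by simp] at this
  exact (hall _ hy').trans (this hz)

/-- Number of cycles of `r` containing a singularity. -/
noncomputable def singCount {S : Type*} (r u : Equiv.Perm S) : ℕ :=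
  Set.ncard (cyc r '' {x | u (r x) ≠ r (u x)})

theorem cyc_eq_iff {S : Type*} {r : Equiv.Perm S} {x y : S} :
    cyc r x = cyc r y ↔ r.SameCycle x y :=
  ⟨fun h => by
    have := mem_cyc_self r y
    rwa [← h] at this, cyc_eq⟩

theorem cyc_mem_image_of_singCyc {S : Type*} {r u : Equiv.Perm S} {x : S} {W : Set S}
    (hx : x ∈ singCyc r u) (hW : cyc r x ⊆ W) :
    cyc r x ∈ cyc r '' ({x | u (r x) ≠ r (u x)} ∩ W) := by
  obtain ⟨d, h1, h2⟩ := hx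
  exact ⟨d, ⟨h2, hW h1⟩, (cyc_eq h1).symm⟩

theorem singCount_merge_lt {S : Type*} [Finite S] {r u : Equiv.Perm S} {x e : S}
    (hinj : ∀ y ∈ cyc u x, ∀ z ∈ cyc u x, r.SameCycle y z → y = z) (he : e ∈ cyc u x)
    (hne : x ≠ e) (hxs : x ∈ singCyc r u) (hes : e ∈ singCyc r u) :
    singCount (r * restrictPerm u (cyc u x)) u < singCount r u := by
  set K := cyc u x with hK
  set r' := r * restrictPerm u K with hr'
  set U : Set S := {z | ∃ y ∈ K, r.SameCycle y z} with hU
  have KU : K ⊆ U := fun y hy => ⟨y, hy, SameCycle.refl _ _⟩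
  have Ur : ∀ z ∈ U, r z ∈ U := fun z ⟨y, hy, hz⟩ => ⟨y, hy, hz.trans (sameCycle_self_apply _ _)⟩
  have Urc := closed_compl Ur
  have agree : ∀ z ∉ K, r' z = r z := fun z hz => by
    rw [hr', Equiv.Perm.mul_apply, restrictPerm_of_not_mem hz]
  have cyc_out : ∀ z ∈ Uᶜ, cyc r' z = cyc r z := by
    intro z hz
    ext w
    exact sameCycle_agree Urc (fun y hy => agree y fun h => hy (KU h)) hz w
  have Kc := closed_compl (cyc_closed u x)
  set D : Set S := {x | u (r x) ≠ r (u x)} with hD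
  have h1 : cyc r' '' {x | u (r' x) ≠ r' (u x)} ⊆ insert (cyc r' x) (cyc r '' (D ∩ Uᶜ)) := by
    rintro _ ⟨z, hz, rfl⟩
    by_cases hzU : z ∈ U
    · left
      obtain ⟨y, hy, hyz⟩ := hzU
      exact (cyc_eq (merge hinj y hy hyz)).symm
    · right
      refine ⟨z, ⟨?_, hzU⟩, (cyc_out z hzU).symm⟩
      have hzK : z ∉ K := fun h => hzU (KU h)
      rw [Set.mem_ofPred_eq, agree z hzK, agree _ (Kc z hzK)] at hz
      exact hz
  have h2 : insert (cyc r x) (insert (cyc r e) (cyc r '' (D ∩ Uᶜ))) ⊆ cyc r '' D := by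
    intro s hs
    rcases hs with rfl | rfl | hs
    · have := cyc_mem_image_of_singCyc hxs (W := Set.univ) (Set.subset_univ _)
      rwa [Set.inter_univ] at this
    · have := cyc_mem_image_of_singCyc hes (W := Set.univ) (Set.subset_univ _)
      rwa [Set.inter_univ] at this
    · exact Set.image_mono Set.inter_subset_left hs
  have out : ∀ y ∈ K, cyc r y ∉ cyc r '' (D ∩ Uᶜ) := by
    rintro y hy ⟨z, hz, hyz⟩
    exact hz.2 ⟨y, hy, (cyc_eq_iff.1 hyz).symm⟩
  have hxe : cyc r x ≠ cyc r e := fun h =>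
    hne (hinj x (mem_cyc_self u x) e he (cyc_eq_iff.1 h))
  have h3 := Set.ncard_le_ncard h1 (Set.toFinite _)
  have h4 := Set.ncard_le_ncard h2 (Set.toFinite _)
  have h5 := Set.ncard_insert_le (cyc r' x) (cyc r '' (D ∩ Uᶜ))
  rw [Set.ncard_insert_of_notMem (a := cyc r x) _ (Set.toFinite _),
    Set.ncard_insert_of_notMem (out e he) (Set.toFinite _)] at h4
  · change Set.ncard (cyc r' '' {x | u (r' x) ≠ r' (u x)}) < Set.ncard (cyc r '' D)
    omega
  · rintro (h | h)
    · exact hxe h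
    · exact out x (mem_cyc_self u x) h

theorem Reaches.twist {S : Type*} {r u t : Equiv.Perm S} {x e : S} {a : ℕ} {c : Set S}
    (h : Reaches r u (u x) a c) (ht : ∀ y ∉ singCyc r u, t y = y)
    (he : t ((u ^ a) (u x)) = e) (hes : e ∈ singCyc r u) (hec : cyc r e = c) :
    ((t * u) ^ (a + 1)) x = e ∧ ∀ j ≤ a, Reaches r u (((t * u) ^ (j + 1)) x) (a - j) c := by
  have h1 : ∀ j < a, ((t * u) ^ (j + 1)) x = (u ^ j) (u x) := by
    intro j
    induction j with
    | zero =>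
      intro h0
      simpa using ht _ (h.1 0 h0)
    | succ j ih =>
      intro hj
      rw [pow_succ', Equiv.Perm.mul_apply, ih (by omega), Equiv.Perm.mul_apply,
        ← Equiv.Perm.mul_apply u, ← pow_succ', ht _ (h.1 _ hj)]
  have h2 : ((t * u) ^ (a + 1)) x = e := by
    cases a with
    | zero => simpa using he
    | succ b =>
      rw [pow_succ', Equiv.Perm.mul_apply, h1 b (by omega), Equiv.Perm.mul_apply,
        ← Equiv.Perm.mul_apply u, ← pow_succ', he]
  refine ⟨h2, fun j hj => ?_⟩
  rcases hj.eq_or_lt with rfl | hj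
  · rw [h2, Nat.sub_self]
    exact ⟨by simp, by simpa, by simpa⟩
  · rw [h1 j hj]
    have e : ∀ i, (u ^ i) ((u ^ j) (u x)) = (u ^ (i + j)) (u x) := fun i => by
      rw [← Equiv.Perm.mul_apply, ← pow_add]
    refine ⟨fun i hi => ?_, ?_, ?_⟩
    · rw [e]
      exact h.1 _ (by omega)
    · rw [e, Nat.sub_add_cancel hj.le]
      exact h.2.1
    · rw [e, Nat.sub_add_cancel hj.le]
      exact h.2.2

theorem exists_restrictPerm_pow {S : Type*} [Finite S] {r : Equiv.Perm S} {x y : S}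
    (h : r.SameCycle y x) : ∃ k : ℕ, (restrictPerm r (cyc r x) ^ k) y = x := by
  obtain ⟨k, hk⟩ := sameCycle_exists_pow h
  exact ⟨k, by rw [restrictPerm_pow_of_mem (cyc_closed r x) h.symm, hk]⟩

theorem singCyc_twist {S : Type*} {r u t : Equiv.Perm S} (ht : t * r = r * t) :
    singCyc r (t * u) = singCyc r u := by
  ext x
  simp only [singCyc, ne_eq, twist_comm_iff ht]

theorem singCount_twist {S : Type*} {r u t : Equiv.Perm S} (ht : t * r = r * t) :
    singCount r (t * u) = singCount r u := by
  simp only [singCount, ne_eq, twist_comm_iff ht]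

/-- If the mirror image of `x` lies in another cycle of `r`, the number of singular cycles can be
decreased. -/
theorem Hyp.decrease {S : Type*} [Fintype S] {ℓ : ℕ} {r u G : Equiv.Perm S} (h : Hyp ℓ r u G)
    {x : S} (hx : x ∈ singCyc r u) (hne : ¬ r.SameCycle x (G (u x))) :
    ∃ r' u', Conn 3 r u r' u' ∧ singCount r' u' < singCount r u := by
  set e := G (u x) with hedef
  have he : e ∈ singCyc r u := h.R_regular hx
  have hux : u x = G e := by rw [hedef, h.sq]
  have hue : u e = G x := by
    have := h.R_sq x
    rw [← this, h.sq]
  obtain ⟨a, ha⟩ := h.reaches_mirror he (y := u x) (by rw [hux])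
  obtain ⟨b, hb⟩ := h.reaches_mirror hx (y := u e) (by rw [hue])
  obtain ⟨k, hk⟩ := exists_restrictPerm_pow (cyc_eq_iff.1 ha.2.2)
  obtain ⟨l, hl⟩ := exists_restrictPerm_pow (cyc_eq_iff.1 hb.2.2)
  set t := restrictPerm r (cyc r x) ^ l * restrictPerm r (cyc r e) ^ k with ht
  have htr : t * r = r * t := by
    have h1 : Commute (restrictPerm r (cyc r x)) r := restrictPerm_comm (cyc_closed r x)
    have h2 : Commute (restrictPerm r (cyc r e)) r := restrictPerm_comm (cyc_closed r e)
    exact ((h1.pow_left l).mul_left (h2.pow_left k)).eq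
  have t_out : ∀ y ∉ singCyc r u, t y = y := by
    intro y hy
    have h1 : y ∉ cyc r x := fun hy' => hy ((singCyc_congr hy').1 hx)
    have h2 : y ∉ cyc r e := fun hy' => hy ((singCyc_congr hy').1 he)
    rw [ht, Equiv.Perm.mul_apply, restrictPerm_pow_of_not_mem h2, restrictPerm_pow_of_not_mem h1]
  have te : t ((u ^ a) (u x)) = e := by
    rw [ht, Equiv.Perm.mul_apply, hk]
    exact restrictPerm_pow_of_not_mem (W := cyc r x) hne l
  have tx : t ((u ^ b) (u e)) = x := by
    have h1 : (u ^ b) (u e) ∉ cyc r e := fun hy =>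
      hne ((cyc_eq_iff.1 hb.2.2).symm.trans (SameCycle.symm hy))
    rw [ht, Equiv.Perm.mul_apply, restrictPerm_pow_of_not_mem h1, hl]
  obtain ⟨pa, qa⟩ := ha.twist t_out te he rfl
  obtain ⟨pb, qb⟩ := hb.twist t_out tx hx rfl
  set v := t * u with hv
  have hK : ∀ y ∈ cyc v x, (∃ j ≤ a, y = (v ^ (j + 1)) x) ∨ (∃ j ≤ b, y = (v ^ (j + 1)) e) := by
    intro y hy
    refine mem_of_sameCycle (π := v)
      (W := {y | (∃ j ≤ a, y = (v ^ (j + 1)) x) ∨ (∃ j ≤ b, y = (v ^ (j + 1)) e)}) ?_ hy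
      (Or.inr ⟨b, le_rfl, pb.symm⟩)
    rintro z (⟨j, hj, rfl⟩ | ⟨j, hj, rfl⟩)
    · rcases hj.eq_or_lt with rfl | hj
      · exact Or.inr ⟨0, Nat.zero_le _, by rw [pa]; simp⟩
      · exact Or.inl ⟨j + 1, hj, by rw [← Equiv.Perm.mul_apply, ← pow_succ']⟩
    · rcases hj.eq_or_lt with rfl | hj
      · exact Or.inl ⟨0, Nat.zero_le _, by rw [pb]; simp⟩
      · exact Or.inr ⟨j + 1, hj, by rw [← Equiv.Perm.mul_apply, ← pow_succ']⟩
  have hcne : cyc r x ≠ cyc r e := fun hc => hne (cyc_eq_iff.1 hc)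
  have hinj : ∀ y ∈ cyc v x, ∀ z ∈ cyc v x, r.SameCycle y z → y = z := by
    intro y hy z hz hyz
    rcases hK y hy with ⟨j, hj, rfl⟩ | ⟨j, hj, rfl⟩ <;>
      rcases hK z hz with ⟨j', hj', rfl⟩ | ⟨j', hj', rfl⟩
    · have := (((qa j hj).congr hyz).unique (qa j' hj')).1
      rw [show j = j' by omega]
    · exact absurd (((qa j hj).congr hyz).unique (qb j' hj')).2 hcne.symm
    · exact absurd (((qb j hj).congr hyz).unique (qa j' hj')).2 hcne
    · have := (((qb j hj).congr hyz).unique (qb j' hj')).1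
      rw [show j = j' by omega]
  refine ⟨r * restrictPerm v (cyc v x) ^ 1, v, ?_, ?_⟩
  · have h1 := Conn.hstep r u e k
    have h2 := Conn.hstep r (restrictPerm r (cyc r e) ^ k * u) x l
    rw [← mul_assoc, ← ht] at h2
    exact (h1.trans h2).trans (Conn.vstep_right r v x 1)
  · rw [pow_one, ← singCount_twist htr (u := u)]
    refine singCount_merge_lt hinj (e := e) ?_ ?_ ?_ ?_
    · rw [← pa]
      exact sameCycle_pow _ _ _
    · rintro hxe
      exact hne (by rw [← hxe])
    · rwa [singCyc_twist htr]
    · rwa [singCyc_twist htr]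

/-- If every singular cycle of `r` is its own mirror image, it becomes the only cycle. -/
theorem Hyp.merge_all {S : Type*} [Fintype S] {ℓ : ℕ} {r u G : Equiv.Perm S} (h : Hyp ℓ r u G)
    {x : S} (hx : x ∈ singCyc r u) (hall : ∀ y ∈ cyc r x, r.SameCycle y (G (u y))) :
    ∃ r' u', Conn 2 r u r' u' ∧ ∀ y z, r'.SameCycle y z := by
  have hGx : ∀ y ∈ cyc r x, r.SameCycle (G x) (u y) := by
    intro y hy
    have h1 := h.inv_r.sameCycle (SameCycle.trans hy (hall y hy))
    rwa [h.sq] at h1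
  obtain ⟨a, ha⟩ := h.reaches_mirror hx (y := u x) (hGx x (mem_cyc_self r x))
  obtain ⟨k, hk⟩ := exists_restrictPerm_pow (cyc_eq_iff.1 ha.2.2)
  set t := restrictPerm r (cyc r x) ^ k with ht
  have t_same : ∀ y, r.SameCycle y (t y) := restrictPerm_sameCycle (cyc_closed r x) k
  have t_out : ∀ y ∉ singCyc r u, t y = y := fun y hy =>
    restrictPerm_pow_of_not_mem (W := cyc r x) (fun hy' => hy ((singCyc_congr hy').1 hx)) _
  obtain ⟨pa, qa⟩ := ha.twist t_out hk hx rfl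
  set v := t * u with hv
  have hK : ∀ y ∈ cyc v x, ∃ j ≤ a, y = (v ^ (j + 1)) x := by
    intro y hy
    refine mem_of_sameCycle (π := v) (W := {y | ∃ j ≤ a, y = (v ^ (j + 1)) x}) ?_ hy
      ⟨a, le_rfl, pa.symm⟩
    rintro z ⟨j, hj, rfl⟩
    rcases hj.eq_or_lt with rfl | hj
    · exact ⟨0, Nat.zero_le _, by rw [pa]; simp⟩
    · exact ⟨j + 1, hj, by rw [← Equiv.Perm.mul_apply, ← pow_succ']⟩
  have hinj : ∀ y ∈ cyc v x, ∀ z ∈ cyc v x, r.SameCycle y z → y = z := by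
    intro y hy z hz hyz
    obtain ⟨j, hj, rfl⟩ := hK y hy
    obtain ⟨j', hj', rfl⟩ := hK z hz
    have := (((qa j hj).congr hyz).unique (qa j' hj')).1
    rw [show j = j' by omega]
  have hU : {z | ∃ y ∈ cyc v x, r.SameCycle y z} = Set.univ := by
    refine h.tr _ ⟨x, x, mem_cyc_self v x, SameCycle.refl _ _⟩ ?_ ?_
    · rintro z ⟨y, hy, hz⟩
      exact ⟨y, hy, hz.trans (sameCycle_self_apply _ _)⟩
    · rintro z ⟨y, hy, hz⟩
      refine ⟨v y, cyc_closed v x y hy, ?_⟩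
      have h1 : r.SameCycle (u y) (u z) := by
        by_cases hys : y ∈ singCyc r u
        · have hyx : y = x := by
            obtain ⟨j, hj, rfl⟩ := hK y hy
            have h2 := qa j hj
            have : a - j = 0 := by
              by_contra h0
              exact h2.1 0 (by omega) (by simpa using hys)
            rw [show j = a by omega, pa]
          subst hyx
          exact (hGx y (mem_cyc_self r y)).symm.trans (hGx z hz)
        · exact sameCycle_apply_of_not_mem_singCyc hys hz
      exact (t_same (u y)).symm.trans h1
  refine ⟨r * restrictPerm v (cyc v x) ^ 1, v, (Conn.hstep r u x k).trans
    (Conn.vstep_right r v x 1), ?_⟩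
  have hfull : ∀ z, (r * restrictPerm v (cyc v x)).SameCycle x z := by
    intro z
    obtain ⟨y, hy, hz⟩ : z ∈ {z | ∃ y ∈ cyc v x, r.SameCycle y z} := hU ▸ Set.mem_univ z
    exact merge hinj y hy hz
  rw [pow_one]
  exact fun y z => (hfull y).symm.trans (hfull z)

/-- A hyperelliptic pair is connected to one for which `r` is a single cycle. -/
theorem IsHyp.exists_full {S : Type*} [Fintype S] {ℓ : ℕ} (hℓ : 0 < ℓ) {r u : Equiv.Perm S}
    (h : IsHyp ℓ r u) : ∃ r' u', Conn (3 * ℓ + 2) r u r' u' ∧ ∀ y z, r'.SameCycle y z := by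
  have main : ∀ F : ℕ, ∀ r u : Equiv.Perm S, IsHyp ℓ r u → singCount r u ≤ F →
      ∃ r' u', Conn (3 * F + 2) r u r' u' ∧ ∀ y z, r'.SameCycle y z := by
    intro F
    induction F with
    | zero =>
      rintro r u ⟨G, h⟩ hF
      rw [Nat.le_zero, singCount, Set.ncard_eq_zero (Set.toFinite _), Set.image_eq_empty] at hF
      have := h.card
      rw [hF, Set.ncard_empty] at this
      omega
    | succ F ih =>
      rintro r u ⟨G, h⟩ hF
      by_cases hall : ∀ y ∈ singCyc r u, r.SameCycle y (G (u y))
      · have hne : {x | u (r x) ≠ r (u x)}.Nonempty := by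
          rw [← Set.ncard_pos (Set.toFinite _), h.card]
          exact hℓ
        obtain ⟨x, hx⟩ := hne
        have hx' : x ∈ singCyc r u := ⟨x, SameCycle.refl _ _, hx⟩
        obtain ⟨r', u', hc, hf⟩ := h.merge_all hx'
          (fun y hy => hall y ((singCyc_congr hy).1 hx'))
        exact ⟨r', u', hc.weaken (by omega), hf⟩
      · push Not at hall
        obtain ⟨x, hx, hne⟩ := hall
        obtain ⟨r1, u1, hc, hlt⟩ := h.decrease hx hne
        obtain ⟨r', u', hc', hf⟩ := ih r1 u1 (hc.isHyp ⟨G, h⟩) (by omega)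
        exact ⟨r', u', (hc.trans hc').weaken (by omega), hf⟩
  refine main ℓ r u h ?_
  obtain ⟨G, h⟩ := h
  rw [← h.card]
  exact Set.ncard_image_le (Set.toFinite _)

/-! ### Coordinates along a full cycle and block structure -/

/-- `P` enumerates the points along the cyclic permutation `r` of `m` points. -/
structure Coord {S : Type*} (r : Equiv.Perm S) (P : ℕ → S) (m : ℕ) : Prop where
  inj : ∀ i < m, ∀ j < m, P i = P j → i = j
  surj : ∀ z, ∃ i < m, P i = z
  step : ∀ i, i + 1 < m → r (P i) = P (i + 1)
  last : ∀ i, i + 1 = m → r (P i) = P 0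

theorem exists_coord {S : Type*} [Fintype S] {r : Equiv.Perm S}
    (hr : ∀ y z, r.SameCycle y z) (x : S) :
    ∃ P : ℕ → S, Coord r P (Fintype.card S) ∧ P 0 = x := by
  have hc : r.IsCycleOn (Finset.univ : Finset S) :=
    ⟨by simp [Set.bijOn_univ], fun y _ z _ => hr y z⟩
  refine ⟨fun i => (r ^ i) x, ⟨fun i hi j hj hij => ?_, fun z => ?_, fun i hi => ?_,
    fun i hi => ?_⟩, rfl⟩
  · have := (hc.pow_apply_eq_pow_apply (Finset.mem_univ x)).1 hij
    rw [Finset.card_univ] at this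
    exact Nat.ModEq.eq_of_lt_of_lt this hi hj
  · exact hc.exists_pow_eq (Finset.mem_univ x) (Finset.mem_univ z)
  · rw [pow_succ', Equiv.Perm.mul_apply]
  · have := hc.pow_card_apply (Finset.mem_univ x)
    rw [Finset.card_univ, ← hi, pow_succ', Equiv.Perm.mul_apply] at this
    simpa using this

/-- Reversal of each of the consecutive blocks of lengths `L`. -/
def rho : List ℕ → ℕ → ℕ
  | [], i => i
  | b :: L, i => if i < b then b - 1 - i else b + rho L (i - b)

theorem two_le_orbs {S : Type*} [Finite S] {π : Equiv.Perm S} {W : Set S}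
    (hW : ∀ x ∈ W, π x ∈ W) {x y : S} (hx : x ∈ W) (hy : y ∉ W) : 2 ≤ orbs π := by
  have : Nontrivial (Quotient (SameCycle.setoid π)) :=
    ⟨⟦x⟧, ⟦y⟧, fun h => hy (mem_of_sameCycle hW (Quotient.exact h) hx)⟩
  exact Finite.one_lt_card

theorem orbs_eq_one {S : Type*} [Nonempty S] {π : Equiv.Perm S}
    (h : ∀ x y, π.SameCycle x y) : orbs π = 1 := by
  have : Subsingleton (Quotient (SameCycle.setoid π)) :=
    ⟨fun a b => Quotient.inductionOn₂ a b fun x y => Quotient.sound (h x y)⟩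
  exact Nat.card_of_subsingleton (⟦Classical.arbitrary S⟧ : Quotient (SameCycle.setoid π))

theorem orbs_mul_swap {S : Type*} [Fintype S] [DecidableEq S] {R : Equiv.Perm S} {x y : S}
    (hxy : x ≠ y) (hx : R x = y) (hy : R y = x) : orbs R + 1 ≤ orbs (R * Equiv.swap x y) := by
  have hW : ∀ z ∈ ({x, y} : Set S)ᶜ, R z ∈ ({x, y} : Set S)ᶜ :=
    closed_compl fun z hz => by
      rcases hz with rfl | rfl
      · exact Or.inr hx
      · exact Or.inl hy
  have hout : ∀ z ∈ ({x, y} : Set S)ᶜ, (R * Equiv.swap x y) z = R z := fun z hz => by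
    rw [Equiv.Perm.mul_apply, Equiv.swap_apply_of_ne_of_ne (fun h => hz (Or.inl h))
      (fun h => hz (Or.inr h))]
  have hwt : ∀ z, wt (R * Equiv.swap x y) z
      = wt R z + ((if z = x then 1 / 2 else 0) + (if z = y then 1 / 2 else 0)) := by
    intro z
    by_cases h1 : z = x
    · subst h1
      rw [wt_of_fixed (by simp [hy]), wt_of_swap (by rw [hx, hy]) (by rw [hx]; exact hxy.symm)]
      simp [hxy]
      norm_num
    · by_cases h2 : z = y
      · subst h2
        rw [wt_of_fixed (by simp [hx]), wt_of_swap (by rw [hy, hx]) (by rw [hy]; exact hxy)]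
        simp [h1]
        norm_num
      · rw [wt_agree hW hout (by simp [h1, h2])]
        simp [h1, h2]
  have : ((orbs R + 1 : ℕ) : ℚ) = (orbs (R * Equiv.swap x y) : ℕ) := by
    push_cast
    rw [orbs_eq_sum, orbs_eq_sum, Finset.sum_congr rfl fun z _ => hwt z, Finset.sum_add_distrib,
      Finset.sum_add_distrib, Finset.sum_ite_eq', Finset.sum_ite_eq']
    simp
    norm_num
  exact (Nat.cast_injective this).le

/-- If the arcs between two points exchanged by `G * u` both contained singularities, the genus
would be positive. -/
theorem Hyp.arc {S : Type*} [Fintype S] {ℓ : ℕ} {r u G : Equiv.Perm S} (h : Hyp ℓ r u G)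
    (hr : ∀ y z, r.SameCycle y z) {P : ℕ → S} {m : ℕ} (hP : Coord r P m) {i j : ℕ} (hij : i < j)
    (hj : j < m) (hR : G (u (P i)) = P j) {k : ℕ} (hk : k < m) (hki : k < i ∨ j ≤ k)
    (hkD : u (r (P k)) ≠ r (u (P k))) {l : ℕ} (hil : i ≤ l) (hlj : l < j) :
    u (r (P l)) = r (u (P l)) := by
  classical
  by_contra hlD
  have := h.nonempty
  have hxy : P i ≠ P j := fun e => hij.ne (hP.inj _ (by omega) _ hj e)
  have hR' : G (u (P j)) = P i := by
    rw [← hR]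
    exact h.R_sq _
  set σ := Equiv.swap (P i) (P j) with hσ
  have o1 := orbs_mul_swap (R := G * u) hxy hR hR'
  rw [← hσ] at o1
  have hGr := orbs_add_le G (G * r) 1 fun W hne a b _ => by
    refine h.tr W hne ?_ ?_ <;> intro x hx
    · have := a _ (b x hx)
      rwa [Equiv.Perm.mul_apply, h.sq] at this
    · refine mem_of_sameCycle (π := r) (fun y hy => ?_) (hr x (u x)) hx
      have := a _ (b y hy)
      rwa [Equiv.Perm.mul_apply, h.sq] at this
  have e1 : G * (G * r) * 1 = r := by
    ext x
    simp [h.sq]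
  rw [e1, orbs_eq_one hr, orbs_one] at hGr
  set A : Set S := {z | ∃ k, i ≤ k ∧ k < j ∧ P k = z} with hA
  have mem : ∀ k < m, P k ∈ A ↔ i ≤ k ∧ k < j := by
    intro k hk
    constructor
    · rintro ⟨k', h1, h2, h3⟩
      rw [hP.inj k hk k' (by omega) h3.symm]
      exact ⟨h1, h2⟩
    · exact fun ⟨h1, h2⟩ => ⟨k, h1, h2, rfl⟩
  have ne : ∀ k < m, k ≠ i → k ≠ j → σ (P k) = P k := fun k hk h1 h2 =>
    Equiv.swap_apply_of_ne_of_ne (fun e => h1 (hP.inj _ hk _ (by omega) e))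
      (fun e => h2 (hP.inj _ hk _ (by omega) e))
  have hstep : ∀ k, i ≤ k → k + 1 < j → (σ * r) (P k) = P (k + 1) := fun k h1 h2 => by
    rw [Equiv.Perm.mul_apply, hP.step k (by omega), ne _ (by omega) (by omega) (by omega)]
  have hstep' : ∀ k, k < m → (k + 1 < i ∨ j ≤ k) → k + 1 < m → (σ * r) (P k) = P (k + 1) :=
    fun k h1 h2 h3 => by
      rw [Equiv.Perm.mul_apply, hP.step k h3, ne _ (by omega) (by omega) (by omega)]
  have hend : ∀ k, k + 1 = j → (σ * r) (P k) = P i := fun k h1 => by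
    rw [Equiv.Perm.mul_apply, hP.step k (by omega), h1, hσ, Equiv.swap_apply_right]
  have hend' : ∀ k, k + 1 = i → (σ * r) (P k) = P j := fun k h1 => by
    rw [Equiv.Perm.mul_apply, hP.step k (by omega), h1, hσ, Equiv.swap_apply_left]
  have hlast : ∀ k, k + 1 = m → (σ * r) (P k) = if i = 0 then P j else P 0 := fun k h1 => by
    rw [Equiv.Perm.mul_apply, hP.last k h1]
    split_ifs with h0
    · rw [← h0, hσ, Equiv.swap_apply_left]
    · rw [ne _ (by omega) (by omega) (by omega)]
  have hAcl : ∀ z ∈ A, (σ * r) z ∈ A := by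
    rintro _ ⟨k, h1, h2, rfl⟩
    by_cases h3 : k + 1 = j
    · rw [hend k h3]
      exact ⟨i, le_rfl, hij, rfl⟩
    · rw [hstep k h1 (by omega)]
      exact ⟨k + 1, by omega, by omega, rfl⟩
  have o2 : 2 ≤ orbs (σ * r) := two_le_orbs hAcl (x := P i) (y := P j)
    ⟨i, le_rfl, hij, rfl⟩ (fun h => by have := (mem j hj).1 h; omega)
  -- The two arcs are single cycles of `σ * r`.
  have arc1 : ∀ n, i + n < j → (σ * r).SameCycle (P i) (P (i + n)) := by
    intro n
    induction n with
    | zero => exact fun _ => SameCycle.refl _ _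
    | succ n ih =>
      intro hn
      refine (ih (by omega)).trans ?_
      rw [← add_assoc, ← hstep (i + n) (by omega) (by omega)]
      exact sameCycle_self_apply _ _
  have arc2 : ∀ n, j + n < m → (σ * r).SameCycle (P j) (P (j + n)) := by
    intro n
    induction n with
    | zero => exact fun _ => SameCycle.refl _ _
    | succ n ih =>
      intro hn
      refine (ih (by omega)).trans ?_
      rw [← add_assoc, ← hstep' (j + n) (by omega) (by omega) (by omega)]
      exact sameCycle_self_apply _ _
  have arc3 : ∀ n, n < i → (σ * r).SameCycle (P j) (P n) := by
    intro n
    induction n with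
    | zero =>
      intro hi
      refine (arc2 (m - 1 - j) (by omega)).trans ?_
      have := hlast (j + (m - 1 - j)) (by omega)
      rw [if_neg (by omega)] at this
      rw [← this]
      exact sameCycle_self_apply _ _
    | succ n ih =>
      intro hn
      refine (ih (by omega)).trans ?_
      rw [← hstep' n (by omega) (by omega) (by omega)]
      exact sameCycle_self_apply _ _
  have inA : ∀ k, i ≤ k → k < j → (σ * r).SameCycle (P i) (P k) := fun k h1 h2 => by
    have := arc1 (k - i) (by omega)
    rwa [show i + (k - i) = k by omega] at this
  have outA : ∀ k < m, (k < i ∨ j ≤ k) → (σ * r).SameCycle (P j) (P k) := fun k h1 h2 => by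
    by_cases h3 : j ≤ k
    · have := arc2 (k - j) (by omega)
      rwa [show j + (k - j) = k by omega] at this
    · exact arc3 k (by omega)
  have e2 : G * u * σ * (σ * r) * 1 = G * u * r := by
    rw [mul_one, mul_assoc, ← mul_assoc σ, Equiv.swap_mul_self, one_mul]
  have hGe := orbs_add_le (G * u * σ) (σ * r) 1 fun W hne a b _ => by
    have hlk : (G * u * r).SameCycle (P l) (P k) := h.single _ _ hlD hkD
    have hab : ∀ z ∈ W, (G * u * r) z ∈ W := fun z hz => by
      have := a _ (b z hz)
      rwa [← Equiv.Perm.mul_apply, ← mul_one (G * u * σ * (σ * r)), e2] at this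
    have hik : P i ∈ W ↔ P j ∈ W :=
      ⟨fun hi => mem_of_sameCycle b (outA k hk hki).symm (mem_of_sameCycle hab hlk
        (mem_of_sameCycle b (inA l hil hlj) hi)),
      fun hi => mem_of_sameCycle b (inA l hil hlj).symm (mem_of_sameCycle hab hlk.symm
        (mem_of_sameCycle b (outA k hk hki) hi))⟩
    have key : P i ∈ W → W = Set.univ := fun hi => by
      refine Set.eq_univ_of_forall fun z => ?_
      obtain ⟨n, hn, rfl⟩ := hP.surj z
      by_cases h1 : i ≤ n ∧ n < j
      · exact mem_of_sameCycle b (inA n h1.1 h1.2) hi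
      · exact mem_of_sameCycle b (outA n hn (by omega)) (hik.1 hi)
    obtain ⟨z, hz⟩ := hne
    obtain ⟨n, hn, rfl⟩ := hP.surj z
    by_cases h1 : i ≤ n ∧ n < j
    · exact key (mem_of_sameCycle b (inA n h1.1 h1.2).symm hz)
    · exact key (hik.2 (mem_of_sameCycle b (outA n hn (by omega)).symm hz))
  rw [e2, orbs_one] at hGe
  have := h.genus
  omega

theorem Hyp.comm_iff_rev {S : Type*} [Fintype S] {ℓ : ℕ} {r u G : Equiv.Perm S}
    (h : Hyp ℓ r u G) (x : S) : u (r x) = r (u x) ↔ r (G (u (r x))) = G (u x) := by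
  rw [← h.inv_r (u x), r.injective.eq_iff, G.injective.eq_iff]

/-- The block structure of `G * u` with respect to the cyclic order given by `r`. -/
theorem Hyp.blocks {S : Type*} [Fintype S] {ℓ : ℕ} {r u G : Equiv.Perm S} (h : Hyp ℓ r u G)
    (hr : ∀ y z, r.SameCycle y z) {P : ℕ → S} {m : ℕ} (hP : Coord r P (m + 1))
    (hD : u (r (P m)) ≠ r (u (P m))) :
    ∃ L : List ℕ, (∀ b ∈ L, 1 ≤ b) ∧ L.sum = m + 1 ∧
      Set.ncard {k | k < m + 1 ∧ u (r (P k)) ≠ r (u (P k))} = L.length ∧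
      ∀ i < m + 1, G (u (P i)) = P (rho L i) := by
  have main : ∀ n k, k + n = m + 1 →
      (∀ i, k ≤ i → i < m + 1 → ∃ j, k ≤ j ∧ j < m + 1 ∧ G (u (P i)) = P j) →
      ∃ L : List ℕ, (∀ b ∈ L, 1 ≤ b) ∧ L.sum = n ∧
        Set.ncard {i | k ≤ i ∧ i < m + 1 ∧ u (r (P i)) ≠ r (u (P i))} = L.length ∧
        ∀ i < n, G (u (P (k + i))) = P (k + rho L i) := by
    intro n
    induction n using Nat.strong_induction_on with
    | _ n ih =>
    intro k hk hcl
    rcases Nat.eq_zero_or_pos n with rfl | hn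
    · refine ⟨[], by simp, rfl, ?_, by simp⟩
      rw [List.length_nil, ← Set.ncard_empty ℕ]
      congr 1
      ext i
      simp only [Set.mem_ofPred_eq, Set.mem_empty_iff_false, iff_false, not_and]
      omega
    obtain ⟨j, hkj, hjm, hj⟩ := hcl k le_rfl (by omega)
    have hnoD : ∀ l, k ≤ l → l < j → u (r (P l)) = r (u (P l)) := fun l h1 h2 =>
      h.arc hr hP (by omega) hjm hj (k := m) (by omega) (Or.inr (by omega)) hD h1 h2
    have hrev : ∀ i, k + i ≤ j → G (u (P (k + i))) = P (j - i) := by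
      intro i
      induction i with
      | zero => exact fun _ => hj
      | succ i ihi =>
        intro hi
        have h1 := ihi (by omega)
        have h2 := (h.comm_iff_rev _).1 (hnoD (k + i) (by omega) (by omega))
        rw [h1, hP.step _ (by omega), show j - i = j - (i + 1) + 1 by omega,
          ← hP.step (j - (i + 1)) (by omega)] at h2
        exact r.injective h2
    have hDj : u (r (P j)) ≠ r (u (P j)) := by
      intro hc
      rw [h.comm_iff_rev] at hc
      have h1 : G (u (P j)) = P k := by rw [← hj]; exact h.R_sq _
      rw [h1] at hc
      rcases Nat.lt_or_ge j m with h2 | h2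
      · rw [hP.step j (by omega)] at hc
        obtain ⟨l, hl1, hl2, hl⟩ := hcl (j + 1) (by omega) (by omega)
        rw [hl] at hc
        rcases (Nat.succ_le_of_lt hl2).eq_or_lt with h3 | h3
        · rw [hP.last l h3] at hc
          have hk0 : 0 = k := hP.inj _ (by omega) _ (by omega) hc
          have hlm : l = m := by omega
          subst hlm
          apply hD
          rw [h.comm_iff_rev, hP.last l rfl]
          have h4 : G (u (P l)) = P (j + 1) := by rw [← hl]; exact h.R_sq _
          rw [h4, hk0, hj, hP.step j (by omega)]
        · rw [hP.step l h3] at hc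
          have := hP.inj _ (by omega) _ (by omega) hc
          omega
      · have hjm' : j = m := by omega
        subst hjm'
        exact hD ((h.comm_iff_rev _).2 (by rw [h1]; exact hc))
    obtain ⟨L, hL1, hL2, hL3, hL4⟩ := ih (m - j) (by omega) (j + 1) (by omega) (by
      intro i hi him
      obtain ⟨l, hl1, hl2, hl⟩ := hcl i (by omega) him
      refine ⟨l, ?_, hl2, hl⟩
      by_contra hlj
      have h1 := hrev (l - k) (by omega)
      rw [show k + (l - k) = l by omega] at h1
      have h2 : G (u (P l)) = P i := by rw [← hl]; exact h.R_sq _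
      have := hP.inj _ (by omega) _ (by omega) (h1.symm.trans h2)
      omega)
    refine ⟨(j + 1 - k) :: L, ?_, ?_, ?_, ?_⟩
    · simp only [List.mem_cons, forall_eq_or_imp]
      exact ⟨by omega, hL1⟩
    · rw [List.sum_cons, hL2]
      omega
    · rw [List.length_cons, ← hL3, ← Set.ncard_insert_of_notMem (a := j) _ (Set.finite_lt_nat
        (m + 1) |>.subset fun i hi => hi.2.1)]
      · congr 1
        ext i
        simp only [Set.mem_ofPred_eq, Set.mem_insert_iff]
        constructor
        · rintro ⟨h1, h2, h3⟩
          rcases lt_trichotomy i j with h4 | h4 | h4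
          · exact absurd (hnoD i h1 h4) h3
          · exact Or.inl h4
          · exact Or.inr ⟨h4, h2, h3⟩
        · rintro (rfl | ⟨h1, h2, h3⟩)
          · exact ⟨hkj, hjm, hDj⟩
          · exact ⟨by omega, h2, h3⟩
      · simp
    · intro i hi
      rw [rho]
      split_ifs with h1
      · rw [hrev i (by omega)]
        congr 1
        omega
      · have := hL4 (i - (j + 1 - k)) (by omega)
        rw [show j + 1 + (i - (j + 1 - k)) = k + i by omega] at this
        rw [this]
        congr 1
        omega
  obtain ⟨L, h1, h2, h3, h4⟩ := main (m + 1) 0 (by omega) (fun i _ _ => by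
    obtain ⟨j, hj, hz⟩ := hP.surj (G (u (P i)))
    exact ⟨j, by omega, hj, hz.symm⟩)
  refine ⟨L, h1, h2, ?_, ?_⟩
  · simpa using h3
  · simpa using h4

/-- In the coordinates `P` along the full cycle `r`, the pair `(r, u)` is given by involutions `G`
and `R`, the first inverting `r` and the second reversing blocks of lengths `L`. -/
structure IsPath {S : Type*} (L : List ℕ) (r u G R : Equiv.Perm S) (P : ℕ → S) : Prop where
  pos : ∀ b ∈ L, 1 ≤ b
  coord : Coord r P L.sum
  sq : ∀ x, G (G x) = x
  inv : Inverts G r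
  eq : u = G * R
  rev : ∀ i < L.sum, R (P i) = P (rho L i)

/-- Pairs with block lengths `L`. -/
def PathPair {S : Type*} (L : List ℕ) (r u : Equiv.Perm S) : Prop := ∃ G R P, IsPath L r u G R P

theorem Hyp.exists_path {S : Type*} [Fintype S] {ℓ : ℕ} (hℓ : 0 < ℓ) {r u G : Equiv.Perm S}
    (h : Hyp ℓ r u G) (hr : ∀ y z, r.SameCycle y z) :
    ∃ L : List ℕ, L.sum = Fintype.card S ∧ L.length = ℓ ∧ (∀ b ∈ L, 1 ≤ b) ∧
      PathPair L r u := by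
  have hne : {x | u (r x) ≠ r (u x)}.Nonempty := by
    rw [← Set.ncard_pos (Set.toFinite _), h.card]
    exact hℓ
  obtain ⟨x, hx⟩ := hne
  obtain ⟨P, hP, hP0⟩ := exists_coord hr (r x)
  have := h.nonempty
  obtain ⟨m, hm⟩ := Nat.exists_eq_succ_of_ne_zero (Fintype.card_ne_zero (α := S))
  rw [hm] at hP
  have hPm : P m = x := r.injective ((hP.last m rfl).trans hP0)
  obtain ⟨L, h1, h2, h3, h4⟩ := h.blocks hr hP (by rw [hPm]; exact hx)
  refine ⟨L, h2.trans hm.symm, ?_, h1, G, G * u, P, h1, by rwa [h2], h.sq, h.inv_r, ?_, ?_⟩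
  · rw [← h3, ← h.card]
    refine Set.ncard_congr (fun k _ => P k) (fun k hk => hk.2)
      (fun a b ha hb => hP.inj a ha.1 b hb.1) fun z hz => ?_
    obtain ⟨k, hk, rfl⟩ := hP.surj z
    exact ⟨k, ⟨hk, hz⟩, rfl⟩
  · ext z
    simp [h.sq]
  · rw [h2]
    exact h4

/-! ### Operations on block lengths -/

theorem rho_lt {L : List ℕ} {i : ℕ} (h : i < L.sum) : rho L i < L.sum := by
  induction L generalizing i with
  | nil => simp at h
  | cons b L ih =>
    rw [List.sum_cons] at h ⊢
    rw [rho]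
    split_ifs with hb
    · omega
    · have := ih (i := i - b) (by omega)
      omega

theorem rho_append (L M : List ℕ) (i : ℕ) :
    rho (L ++ M) i = if i < L.sum then rho L i else L.sum + rho M (i - L.sum) := by
  induction L generalizing i with
  | nil => simp
  | cons b L ih =>
    simp only [List.cons_append, rho, ih, List.sum_cons]
    split_ifs with h1 h2 h3 h4 h5 <;> try omega
    rw [show i - b - L.sum = i - (b + L.sum) by omega]
    omega

theorem Coord.comp {S : Type*} {r r' : Equiv.Perm S} {P : ℕ → S} {m : ℕ} (h : Coord r P m)
    {φ : ℕ → ℕ} (hφ : ∀ i < m, φ i < m) (inj : ∀ i < m, ∀ j < m, φ i = φ j → i = j)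
    (step : ∀ i, i + 1 < m → r' (P (φ i)) = P (φ (i + 1)))
    (last : ∀ i, i + 1 = m → r' (P (φ i)) = P (φ 0)) : Coord r' (fun i => P (φ i)) m := by
  refine ⟨fun i hi j hj hij => inj i hi j hj (h.inj _ (hφ i hi) _ (hφ j hj) hij), fun z => ?_,
    step, last⟩
  obtain ⟨k, hk, rfl⟩ := h.surj z
  have := Finset.surjOn_of_injOn_of_card_le (s := Finset.range m) (t := Finset.range m) φ
    (fun i hi => by simpa using hφ i (by simpa using hi))
    (fun i hi j hj hij => inj i (by simpa using hi) j (by simpa using hj) hij) le_rfl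
  obtain ⟨i, hi, hik⟩ := this (a := k) (by simpa using hk)
  exact ⟨i, by simpa using hi, by rw [hik]⟩

theorem Coord.apply {S : Type*} {r : Equiv.Perm S} {P : ℕ → S} {m : ℕ} (h : Coord r P m) {i : ℕ}
    (hi : i < m) : r (P i) = P (if i + 1 = m then 0 else i + 1) := by
  split_ifs with h1
  · exact h.last i h1
  · exact h.step i (by omega)

theorem Coord.pow_apply {S : Type*} {r : Equiv.Perm S} {P : ℕ → S} {m : ℕ} (h : Coord r P m)
    {i : ℕ} (hi : i < m) : (r ^ i) (P 0) = P i := by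
  induction i with
  | zero => rfl
  | succ i ih =>
    rw [pow_succ', Equiv.Perm.mul_apply, ih (by omega), h.step i hi]

theorem Coord.sameCycle {S : Type*} {r : Equiv.Perm S} {P : ℕ → S} {m : ℕ} (h : Coord r P m)
    (y z : S) : r.SameCycle y z := by
  have : ∀ z, r.SameCycle (P 0) z := fun z => by
    obtain ⟨i, hi, rfl⟩ := h.surj z
    rw [← h.pow_apply hi]
    exact sameCycle_pow _ _ _
  exact (this y).symm.trans (this z)

theorem restrictPerm_eq_self {S : Type*} [Finite S] {r : Equiv.Perm S}
    (h : ∀ y z, r.SameCycle y z) (x : S) : restrictPerm r (cyc r x) = r := by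
  ext z
  exact restrictPerm_of_mem (cyc_closed r x) (h x z)

theorem PathPair.rotate_one {S : Type*} {a : ℕ} {L : List ℕ} {r u : Equiv.Perm S}
    (h : PathPair (a :: L) r u) : PathPair (L ++ [a]) r u := by
  obtain ⟨G, R, P, h⟩ := h
  have hc := h.coord
  have hrev := h.rev
  rw [List.sum_cons] at hc hrev
  have ha := h.pos a (by simp)
  have hs : (L ++ [a]).sum = a + L.sum := by simp [add_comm]
  refine ⟨G, R, fun i => P (if i < L.sum then i + a else i - L.sum), ?_, ?_, h.sq, h.inv, h.eq, ?_⟩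
  · intro b hb
    refine h.pos b ?_
    simpa [or_comm] using hb
  · rw [hs]
    refine hc.comp ?_ ?_ ?_ ?_
    · intro i hi
      split_ifs <;> omega
    · intro i hi j hj hij
      split_ifs at hij <;> omega
    · intro i hi
      rw [hc.apply (by split_ifs <;> omega)]
      congr 1
      split_ifs <;> omega
    · intro i hi
      rw [hc.apply (by split_ifs <;> omega)]
      congr 1
      split_ifs <;> omega
  · intro i hi
    rw [hs] at hi
    rw [hrev _ (by split_ifs <;> omega), rho_append]
    congr 1
    by_cases h1 : i < L.sum
    · rw [if_pos h1, if_pos h1, if_pos (rho_lt h1), rho, if_neg (by omega)]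
      simp [add_comm]
    · rw [if_neg h1, if_neg h1, if_neg (by omega), rho, rho, if_pos (by omega), if_pos (by omega)]
      omega

theorem PathPair.rotate {S : Type*} {L M : List ℕ} {r u : Equiv.Perm S}
    (h : PathPair (L ++ M) r u) : PathPair (M ++ L) r u := by
  induction L generalizing M with
  | nil => simpa using h
  | cons a L ih =>
    have := ih (M := M ++ [a]) (by simpa using PathPair.rotate_one h)
    simpa using this

theorem eq_of_commute_of_apply_eq {S : Type*} [Finite S] {r s t : Equiv.Perm S}
    (hr : ∀ y z, r.SameCycle y z) (hs : s * r = r * s) (ht : t * r = r * t) {x : S}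
    (hx : s x = t x) : s = t := by
  ext z
  obtain ⟨i, rfl⟩ := sameCycle_exists_pow (hr x z)
  have hs' : Commute s (r ^ i) := Commute.pow_right hs i
  have ht' : Commute t (r ^ i) := Commute.pow_right ht i
  rw [← Equiv.Perm.mul_apply, ← Equiv.Perm.mul_apply, hs'.eq, ht'.eq, Equiv.Perm.mul_apply,
    Equiv.Perm.mul_apply, hx]

theorem Inverts.mul_comm {S : Type*} {r G H : Equiv.Perm S} (hG : Inverts G r)
    (hH : Inverts H r) : G * H * r = r * (G * H) := by
  ext x
  simp only [Equiv.Perm.mul_apply]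
  rw [← hG (H (r x)), hH]

/-- Two pairs with the same block lengths differ by a single twist. -/
theorem PathPair.conn {S : Type*} [Finite S] {L : List ℕ} (hL : 0 < L.sum)
    {r u r' u' : Equiv.Perm S} (h : PathPair L r u) (h' : PathPair L r' u') :
    Conn 1 r u r' u' := by
  obtain ⟨G, R, P, h⟩ := h
  obtain ⟨G', R', P', h'⟩ := h'
  have bij : ∀ {r : Equiv.Perm S} {P : ℕ → S} (_ : Coord r P L.sum),
      Function.Bijective (fun i : Fin L.sum => P i) := fun hc =>
    ⟨fun i j hij => Fin.ext (hc.inj i i.2 j j.2 hij), fun z => by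
      obtain ⟨i, hi, rfl⟩ := hc.surj z
      exact ⟨⟨i, hi⟩, rfl⟩⟩
  set g : Equiv.Perm S := (Equiv.ofBijective _ (bij h.coord)).symm.trans
    (Equiv.ofBijective _ (bij h'.coord)) with hgdef
  have hg : ∀ i < L.sum, g (P i) = P' i := by
    intro i hi
    have : (Equiv.ofBijective _ (bij h.coord)).symm (P i) = ⟨i, hi⟩ := by
      rw [Equiv.symm_apply_eq]
      rfl
    rw [hgdef, Equiv.trans_apply, this]
    rfl
  have hgi : ∀ i < L.sum, g⁻¹ (P' i) = P i := fun i hi => by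
    rw [Equiv.Perm.inv_eq_iff_eq, hg i hi]
  have e1 : g * r * g⁻¹ = r' := by
    ext z
    obtain ⟨i, hi, rfl⟩ := h'.coord.surj z
    rw [Equiv.Perm.mul_apply, Equiv.Perm.mul_apply, hgi i hi, h.coord.apply hi, h'.coord.apply hi,
      hg _ (by split_ifs <;> omega)]
  have e2 : g * R * g⁻¹ = R' := by
    ext z
    obtain ⟨i, hi, rfl⟩ := h'.coord.surj z
    rw [Equiv.Perm.mul_apply, Equiv.Perm.mul_apply, hgi i hi, h.rev i hi, h'.rev i hi,
      hg _ (rho_lt hi)]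
  set H := g * G * g⁻¹ with hH
  have Hsq : ∀ x, H (H x) = x := fun x => by simp [hH, h.sq]
  have Hinv : Inverts H r' := fun x => by
    rw [← e1]
    simpa [hH] using h.inv (g.symm x)
  have e3 : g * u * g⁻¹ = H * R' := by
    rw [h.eq, ← e2, hH]
    group
  have full : ∀ y z, r'.SameCycle y z := h'.coord.sameCycle
  have hcomm := h'.inv.mul_comm Hinv
  obtain ⟨k, hk⟩ := sameCycle_exists_pow (full (P' 0) ((G' * H) (P' 0)))
  have e4 : r' ^ k = G' * H :=
    eq_of_commute_of_apply_eq full ((Commute.refl r').pow_left k).eq hcomm hk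
  have c := (Conn.conj r u g).trans (Conn.hstep _ _ (P' 0) k)
  rw [e1, e3, restrictPerm_eq_self full, e4, mul_assoc, ← mul_assoc H,
    show H * H = 1 from Equiv.ext Hsq, one_mul, ← h'.eq] at c
  exact c

/-- `Mv N L L'`: a pair with block lengths `L` is at distance at most `N` from one with block
lengths `L'`. -/
def Mv (S : Type*) (N : ℕ) (L L' : List ℕ) : Prop :=
  ∀ r u : Equiv.Perm S, PathPair L r u → ∃ r' u', Conn N r u r' u' ∧ PathPair L' r' u'

theorem Mv.refl (S : Type*) (L : List ℕ) : Mv S 0 L L :=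
  fun r u h => ⟨r, u, Conn.refl r u, h⟩

theorem Mv.trans {S : Type*} {N M : ℕ} {L L' L'' : List ℕ} (h : Mv S N L L')
    (h' : Mv S M L' L'') : Mv S (N + M) L L'' := fun r u hp => by
  obtain ⟨r1, u1, c1, p1⟩ := h r u hp
  obtain ⟨r2, u2, c2, p2⟩ := h' r1 u1 p1
  exact ⟨r2, u2, c1.trans c2, p2⟩

theorem Mv.weaken {S : Type*} {N M : ℕ} {L L' : List ℕ} (h : Mv S N L L') (hNM : N ≤ M) :
    Mv S M L L' := fun r u hp => by
  obtain ⟨r1, u1, c1, p1⟩ := h r u hp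
  exact ⟨r1, u1, c1.weaken hNM, p1⟩

theorem Mv.rotate (S : Type*) (L M : List ℕ) : Mv S 0 (L ++ M) (M ++ L) :=
  fun r u h => ⟨r, u, Conn.refl r u, h.rotate⟩

theorem restrictPerm_eq_swap {S : Type*} [Finite S] [DecidableEq S] {u : Equiv.Perm S} {x y : S}
    (hx : u x = y) (hy : u y = x) : restrictPerm u (cyc u x) = Equiv.swap x y := by
  have hc : cyc u x = {x, y} := by
    refine Set.Subset.antisymm (cyc_subset ?_ (Or.inl rfl)) ?_
    · rintro z (rfl | rfl)
      · exact Or.inr hx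
      · exact Or.inl hy
    · rintro z (rfl | rfl)
      · exact mem_cyc_self u z
      · rw [← hx]
        exact sameCycle_self_apply _ _
  ext z
  by_cases hz : z ∈ cyc u x
  · rw [restrictPerm_of_mem (cyc_closed u x) hz]
    rw [hc] at hz
    rcases hz with rfl | rfl
    · simp [hx]
    · simp [hy]
  · rw [restrictPerm_of_not_mem hz]
    rw [hc] at hz
    rw [Equiv.swap_apply_of_ne_of_ne (fun h => hz (Or.inl h)) (fun h => hz (Or.inr h))]

theorem Conn.swap_right {S : Type*} [Finite S] [DecidableEq S] {u : Equiv.Perm S} {x y : S}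
    (r : Equiv.Perm S) (hx : u x = y) (hy : u y = x) : Conn 1 r u (r * Equiv.swap x y) u := by
  have := Conn.vstep_right r u x 1
  rwa [pow_one, restrictPerm_eq_swap hx hy] at this

theorem Inverts.mul_of_commute {S : Type*} {r G σ : Equiv.Perm S} (h : Inverts G r)
    (hσ : ∀ x, σ (σ x) = x) (hc : ∀ x, G (σ x) = σ (G x)) : Inverts (G * σ) (r * σ) := by
  intro x
  simp only [Equiv.Perm.mul_apply]
  rw [hc (r (σ x)), hσ, h]

theorem commute_swap_apply {S : Type*} [DecidableEq S] {G : Equiv.Perm S} {x y : S}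
    (h : (G x = x ∧ G y = y) ∨ (G x = y ∧ G y = x)) (z : S) :
    G (Equiv.swap x y z) = Equiv.swap x y (G z) := by
  rcases h with ⟨hx, hy⟩ | ⟨hx, hy⟩
  · rw [G.injective.map_swap, hx, hy]
  · rw [G.injective.map_swap, hx, hy, Equiv.swap_comm]

theorem sq_mul_of_commute {S : Type*} {G σ : Equiv.Perm S} (sq : ∀ x, G (G x) = x)
    (hσ : ∀ x, σ (σ x) = x) (hc : ∀ x, G (σ x) = σ (G x)) (x : S) :
    (G * σ) ((G * σ) x) = x := by
  simp only [Equiv.Perm.mul_apply]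
  rw [← hc, sq, hσ]

theorem Inverts.twist {S : Type*} [Finite S] {r G : Equiv.Perm S} (h : Inverts G r)
    (sq : ∀ x, G (G x) = x) {s : S} (hs : r.SameCycle s (G s)) (k : ℕ) :
    (∀ x, (restrictPerm r (cyc r s) ^ k * G) ((restrictPerm r (cyc r s) ^ k * G) x) = x) ∧
      Inverts (restrictPerm r (cyc r s) ^ k * G) r := by
  induction k with
  | zero => simpa using ⟨sq, h⟩
  | succ k ih =>
    set T := restrictPerm r (cyc r s) with hT
    set H := T ^ k * G with hH
    have e : T ^ (k + 1) * G = T * H := by rw [pow_succ', mul_assoc]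
    rw [e]
    obtain ⟨Hsq, Hinv⟩ := ih
    have Hs : ∀ x ∈ cyc r s, H x ∈ cyc r s := fun x hx =>
      (hs.trans (h.sameCycle hx)).trans (restrictPerm_sameCycle (cyc_closed r s) k _)
    have Hc := closed_compl Hs
    have rc := closed_compl (cyc_closed r s)
    have t_in : ∀ x ∈ cyc r s, T x = r x := fun x hx => restrictPerm_of_mem (cyc_closed r s) hx
    have t_out : ∀ x ∉ cyc r s, T x = x := fun x hx => restrictPerm_of_not_mem hx
    constructor
    · intro x
      simp only [Equiv.Perm.mul_apply]
      by_cases hx : x ∈ cyc r s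
      · rw [t_in _ (Hs x hx), t_in _ (Hs _ (cyc_closed r s _ (Hs x hx))), Hinv, Hsq]
      · rw [t_out _ (Hc x hx), t_out _ (Hc _ (Hc x hx)), Hsq]
    · intro x
      simp only [Equiv.Perm.mul_apply]
      by_cases hx : x ∈ cyc r s
      · rw [t_in _ (Hs _ (cyc_closed r s x hx)), Hinv, t_in _ (Hs x hx)]
      · rw [t_out _ (Hc _ (rc x hx)), t_out _ (Hc x hx), Hinv]

/-- Twisting along the cycle of `s` to prescribe the image of `s` under `G`. -/
theorem exists_twist_align {S : Type*} [Finite S] {r G : Equiv.Perm S} (h : Inverts G r)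
    (sq : ∀ x, G (G x) = x) (R : Equiv.Perm S) {s w : S} (hs : r.SameCycle s (G s))
    (hw : r.SameCycle s w) :
    ∃ G' : Equiv.Perm S, Conn 1 r (G * R) r (G' * R) ∧ Inverts G' r ∧ (∀ x, G' (G' x) = x) ∧
      G' s = w ∧ ∀ z, ¬ r.SameCycle s z → G' z = G z := by
  obtain ⟨k, hk⟩ := sameCycle_exists_pow (hs.symm.trans hw)
  have ht := h.twist sq hs k
  refine ⟨restrictPerm r (cyc r s) ^ k * G, ?_, ht.2, ht.1, ?_, fun z hz => ?_⟩
  · rw [mul_assoc]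
    exact Conn.hstep _ _ _ _
  · rw [Equiv.Perm.mul_apply, restrictPerm_pow_of_mem (cyc_closed r s) hs, hk]
  · rw [Equiv.Perm.mul_apply, restrictPerm_pow_of_not_mem (W := cyc r s)]
    intro hz'
    refine hz (hs.trans ?_)
    have := h.sameCycle hz'
    rw [sq] at this
    exact (h.sameCycle hs).trans (by rw [sq]; exact hs.trans this) |>.trans (SameCycle.refl _ _)


/-- Joining two cycles of `r` preserved by `G` along points exchanged by `R`. -/
theorem exists_swap_join {S : Type*} [Finite S] [DecidableEq S] {r G R : Equiv.Perm S}
    (h : Inverts G r) (sq : ∀ x, G (G x) = x) {s e : S} (hs : r.SameCycle s (G s))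
    (he : r.SameCycle e (G e)) (hse : ¬ r.SameCycle s e) (hRs : R s = e) (hRe : R e = s) :
    ∃ G' : Equiv.Perm S, Conn 3 r (G * R) (r * Equiv.swap s e) (G' * (Equiv.swap s e * R)) ∧
      Inverts G' (r * Equiv.swap s e) ∧ ∀ x, G' (G' x) = x := by
  obtain ⟨G1, c1, i1, sq1, h1, o1⟩ := exists_twist_align h sq R hs (SameCycle.refl r s)
  have he1 : r.SameCycle e (G1 e) := by rwa [o1 e hse]
  obtain ⟨G2, c2, i2, sq2, h2, o2⟩ := exists_twist_align i1 sq1 R he1 (SameCycle.refl r e)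
  have hs2 : G2 s = s := by rw [o2 s fun hh => hse hh.symm, h1]
  have c3 := Conn.swap_right (u := G2 * R) (x := s) (y := e) r
    (by rw [Equiv.Perm.mul_apply, hRs, h2]) (by rw [Equiv.Perm.mul_apply, hRe, hs2])
  have hc := commute_swap_apply (G := G2) (Or.inl ⟨hs2, h2⟩)
  refine ⟨G2 * Equiv.swap s e, ?_, i2.mul_of_commute (Equiv.swap_apply_self s e) hc,
    sq_mul_of_commute sq2 (Equiv.swap_apply_self s e) hc⟩
  have := (c1.trans c2).trans c3
  rwa [show G2 * Equiv.swap s e * (Equiv.swap s e * R) = G2 * R by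
    rw [mul_assoc, Equiv.swap_mul_self_mul]]

theorem exists_double_swap_odd {S : Type*} [Finite S] [DecidableEq S] {r G R : Equiv.Perm S}
    (h : Inverts G r) (sq : ∀ x, G (G x) = x) (full : ∀ y z, r.SameCycle y z) {x y s e : S}
    (hx : R x = x) (hy : R y = y)
    (hs : (r * Equiv.swap x y).SameCycle x s) (he : (r * Equiv.swap x y).SameCycle y e)
    (hse : ¬ (r * Equiv.swap x y).SameCycle s e) (hRs : R s = e) (hRe : R e = s)
    (hsx : s ≠ x) (hsy : s ≠ y) (hex : e ≠ x) (hey : e ≠ y) :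
    ∃ G' : Equiv.Perm S, Conn 5 r (G * R) (r * Equiv.swap x y * Equiv.swap s e)
        (G' * (Equiv.swap s e * (Equiv.swap x y * R))) ∧
      Inverts G' (r * Equiv.swap x y * Equiv.swap s e) ∧ ∀ x, G' (G' x) = x := by
  obtain ⟨G1, c1, i1, sq1, h1, -⟩ := exists_twist_align h sq R (full x (G x)) (full x y)
  have h1' : G1 y = x := by rw [← h1, sq1]
  have c2 := Conn.swap_right (u := G1 * R) (x := x) (y := y) r
    (by rw [Equiv.Perm.mul_apply, hx, h1]) (by rw [Equiv.Perm.mul_apply, hy, h1'])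
  have hc := commute_swap_apply (G := G1) (Or.inr ⟨h1, h1'⟩)
  have i2 := i1.mul_of_commute (Equiv.swap_apply_self x y) hc
  have gx : (G1 * Equiv.swap x y) x = x := by simp [h1']
  have gy : (G1 * Equiv.swap x y) y = y := by simp [h1]
  have ts := i2.sameCycle hs
  have te := i2.sameCycle he
  rw [gx] at ts
  rw [gy] at te
  obtain ⟨G2, c3, i3, sq3⟩ := exists_swap_join (R := Equiv.swap x y * R) i2
    (sq_mul_of_commute sq1 (Equiv.swap_apply_self x y) hc) (hs.symm.trans ts) (he.symm.trans te) hse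
    (by rw [Equiv.Perm.mul_apply, hRs, Equiv.swap_apply_of_ne_of_ne hex hey])
    (by rw [Equiv.Perm.mul_apply, hRe, Equiv.swap_apply_of_ne_of_ne hsx hsy])
  rw [show G1 * Equiv.swap x y * (Equiv.swap x y * R) = G1 * R by
    rw [mul_assoc, Equiv.swap_mul_self_mul]] at c3
  exact ⟨G2, (c1.trans c2).trans c3, i3, sq3⟩

theorem exists_double_swap_even {S : Type*} [Finite S] [DecidableEq S] {r G R : Equiv.Perm S}
    (h : Inverts G r) (sq : ∀ x, G (G x) = x) (full : ∀ y z, r.SameCycle y z) {x y s e : S}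
    (hx : R x = r x) (hy : R y = r y)
    (hs : (r * Equiv.swap x y).SameCycle x s) (he : (r * Equiv.swap x y).SameCycle y e)
    (hse : ¬ (r * Equiv.swap x y).SameCycle s e) (hRs : R s = e) (hRe : R e = s) :
    ∃ G' : Equiv.Perm S, Conn 5 r (G * R) (r * Equiv.swap x y * Equiv.swap s e)
        (G' * (Equiv.swap s e * R)) ∧
      Inverts G' (r * Equiv.swap x y * Equiv.swap s e) ∧ ∀ x, G' (G' x) = x := by
  obtain ⟨G1, c1, i1, sq1, h1, -⟩ := exists_twist_align h sq R (full x (G x)) (full x (r y))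
  have h2 : G1 (r x) = y := r.injective (by rw [i1, h1])
  have h3 : G1 (r y) = x := by rw [← h1, sq1]
  have h4 : G1 y = r x := by rw [← h2, sq1]
  have c2 := Conn.swap_right (u := G1 * R) (x := x) (y := y) r
    (by rw [Equiv.Perm.mul_apply, hx, h2]) (by rw [Equiv.Perm.mul_apply, hy, h3])
  have i2 : Inverts G1 (r * Equiv.swap x y) := by
    intro z
    simp only [Equiv.Perm.mul_apply]
    by_cases zx : z = x
    · rw [zx, Equiv.swap_apply_left, h3, Equiv.swap_apply_left, h1]
    by_cases zy : z = y
    · rw [zy, Equiv.swap_apply_right, h2, Equiv.swap_apply_right, h4]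
    rw [Equiv.swap_apply_of_ne_of_ne zx zy, Equiv.swap_apply_of_ne_of_ne, i1]
    · rw [← h3]
      exact fun hh => zy (r.injective (G1.injective hh))
    · rw [← h2]
      exact fun hh => zx (r.injective (G1.injective hh))
  have ts := i2.sameCycle hs
  have te := i2.sameCycle he
  have gx : (r * Equiv.swap x y) x = G1 x := by simp [h1]
  have gy : (r * Equiv.swap x y) y = G1 y := by simp [h4]
  rw [← gx, sameCycle_apply_left] at ts
  rw [← gy, sameCycle_apply_left] at te
  obtain ⟨G2, c3, i3, sq3⟩ := exists_swap_join (R := R) i2 sq1 (hs.symm.trans ts)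
    (he.symm.trans te) hse hRs hRe
  exact ⟨G2, (c1.trans c2).trans c3, i3, sq3⟩

theorem rho_fst {a k : ℕ} (L : List ℕ) (h : k < a) : rho (a :: L) k = a - 1 - k := by
  rw [rho, if_pos h]

theorem rho_mid {L1 : List ℕ} {k : ℕ} (a : ℕ) (L : List ℕ) (h : k < L1.sum) :
    rho (a :: (L1 ++ L)) (a + k) = a + rho L1 k := by
  rw [rho, if_neg (by omega), rho_append, if_pos (by omega), Nat.add_sub_cancel_left]

theorem rho_snd {b k : ℕ} (a : ℕ) (L1 L2 : List ℕ) (h : k < b) :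
    rho (a :: (L1 ++ b :: L2)) (a + L1.sum + k) = a + L1.sum + (b - 1 - k) := by
  rw [rho, if_neg (by omega), rho_append, if_neg (by omega), rho, if_pos (by omega)]
  omega

theorem rho_end (a b k : ℕ) (L1 L2 : List ℕ) :
    rho (a :: (L1 ++ b :: L2)) (a + L1.sum + b + k) = a + L1.sum + b + rho L2 k := by
  rw [rho, if_neg (by omega), rho_append, if_neg (by omega), rho, if_neg (by omega)]
  rw [show a + L1.sum + b + k - a - L1.sum - b = k by omega]
  omega

/-- Exchange of two indices. -/
def idxSwap (i j k : ℕ) : ℕ := if k = i then j else if k = j then i else k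

theorem idxSwap_cases (i j k : ℕ) : (k = i ∧ idxSwap i j k = j) ∨
    (k ≠ i ∧ k = j ∧ idxSwap i j k = i) ∨ (k ≠ i ∧ k ≠ j ∧ idxSwap i j k = k) := by
  rw [idxSwap]
  split_ifs <;> omega

theorem Coord.swap_apply {S : Type*} [DecidableEq S] {r : Equiv.Perm S} {P : ℕ → S} {m : ℕ}
    (h : Coord r P m) {i j k : ℕ} (hi : i < m) (hj : j < m) (hk : k < m) :
    Equiv.swap (P i) (P j) (P k) = P (idxSwap i j k) := by
  rw [idxSwap]
  split_ifs with h1 h2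
  · rw [h1, Equiv.swap_apply_left]
  · rw [h2, Equiv.swap_apply_right]
  · exact Equiv.swap_apply_of_ne_of_ne (fun hh => h1 (h.inj k hk i hi hh))
      (fun hh => h2 (h.inj k hk j hj hh))

theorem sameCycle_of_chain {S : Type*} {r : Equiv.Perm S} {P : ℕ → S} {i j : ℕ} (hij : i ≤ j)
    (h : ∀ k, i ≤ k → k < j → r (P k) = P (k + 1)) : r.SameCycle (P i) (P j) := by
  induction j, hij using Nat.le_induction with
  | base => exact SameCycle.refl _ _
  | succ j hij ih =>
    rw [← h j hij (Nat.lt_succ_self j), sameCycle_apply_right]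
    exact ih fun k h1 h2 => h k h1 (by omega)

/-- The cycles of `r` after exchanging the images of two points. -/
theorem Coord.swap_cycles {S : Type*} [Finite S] [DecidableEq S] {r : Equiv.Perm S} {P : ℕ → S} {m : ℕ}
    (h : Coord r P m) {x y e : ℕ} (hxe : x < e) (hey : e < y) (hy : y < m) :
    (r * Equiv.swap (P x) (P y)).SameCycle (P x) (P 0) ∧
      (r * Equiv.swap (P x) (P y)).SameCycle (P y) (P e) ∧
      ¬ (r * Equiv.swap (P x) (P y)).SameCycle (P 0) (P e) := by
  set ρ := r * Equiv.swap (P x) (P y) with hρ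
  have hk : ∀ k < m, ∀ l, (idxSwap x y k + 1 = l ∧ l < m) ∨ (idxSwap x y k + 1 = m ∧ l = 0) →
      ρ (P k) = P l := fun k hk l hl => by
    rw [hρ, Equiv.Perm.mul_apply, h.swap_apply (by omega) hy hk, h.apply (by omega)]
    congr 1
    split_ifs <;> omega
  have hs : ∀ k, k < y → k ≠ x → ρ (P k) = P (k + 1) := fun k h1 h2 => by
    have := idxSwap_cases x y k
    exact hk k (by omega) _ (by omega)
  refine ⟨(sameCycle_of_chain (Nat.zero_le x) fun k _ h2 => hs k (by omega) (by omega)).symm,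
    ?_, fun hh => ?_⟩
  · have h1 : ρ (P y) = P (x + 1) := by
      have := idxSwap_cases x y y
      exact hk y hy _ (by omega)
    rw [← sameCycle_apply_left, h1]
    exact sameCycle_of_chain (by omega) fun k h1 h2 => hs k (by omega) (by omega)
  · have hB : ∀ z ∈ {z | ∃ k, x < k ∧ k ≤ y ∧ P k = z}, ρ z ∈ {z | ∃ k, x < k ∧ k ≤ y ∧ P k = z} := by
      rintro _ ⟨k, h1, h2, rfl⟩
      have := idxSwap_cases x y k
      by_cases hky : k = y
      · exact ⟨x + 1, by omega, by omega, (hk k (by omega) _ (by omega)).symm⟩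
      · exact ⟨k + 1, by omega, by omega, (hk k (by omega) _ (by omega)).symm⟩
    obtain ⟨k, h1, h2, h3⟩ := mem_of_sameCycle hB (SameCycle.symm hh) ⟨e, hxe, by omega, rfl⟩
    have := h.inj k (by omega) 0 (by omega) h3
    omega

/-- Reordering of the coordinates under the transfer of a block. -/
def shuffle (a n x q i : ℕ) : ℕ :=
  if i = 0 then 0 else if i ≤ n + q + 1 then a + i - 1
  else if i ≤ n + q + 1 + (a - 1 - x) then x + (i - (n + q + 1))
  else if i ≤ n + q + 1 + (a - 1) then i - (n + q + 1 + (a - 1 - x)) else i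

theorem shuffle_cases (a n x q i : ℕ) : (i = 0 ∧ shuffle a n x q i = 0) ∨
    (1 ≤ i ∧ i ≤ n + q + 1 ∧ shuffle a n x q i = a + i - 1) ∨
    (n + q + 1 < i ∧ i ≤ n + q + 1 + (a - 1 - x) ∧ shuffle a n x q i = x + (i - (n + q + 1))) ∨
    (n + q + 1 + (a - 1 - x) < i ∧ i ≤ n + q + 1 + (a - 1) ∧
      shuffle a n x q i = i - (n + q + 1 + (a - 1 - x))) ∨
    (n + q + 1 + (a - 1 - x) < i ∧ n + q + 1 + (a - 1) < i ∧ shuffle a n x q i = i) := by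
  rw [shuffle]
  split_ifs <;> omega

theorem Coord.shuffle {S : Type*} [DecidableEq S] {r : Equiv.Perm S} {P : ℕ → S} {m : ℕ}
    (h : Coord r P m) {a n x q : ℕ} (hx : x + 1 < a) (hm : a + n + q < m) :
    Coord (r * Equiv.swap (P x) (P (a + n + q)) * Equiv.swap (P 0) (P (a - 1)))
      (fun i => P (shuffle a n x q i)) m := by
  have hφ : ∀ i < m, _root_.shuffle a n x q i < m := fun i hi => by
    have := shuffle_cases a n x q i
    omega
  have key : ∀ k < m, ∀ l,
      (idxSwap x (a + n + q) (idxSwap 0 (a - 1) k) + 1 = l ∧ l < m) ∨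
        (idxSwap x (a + n + q) (idxSwap 0 (a - 1) k) + 1 = m ∧ l = 0) →
      (r * Equiv.swap (P x) (P (a + n + q)) * Equiv.swap (P 0) (P (a - 1))) (P k) = P l :=
    fun k hk l hl => by
    have h1 := idxSwap_cases 0 (a - 1) k
    rw [Equiv.Perm.mul_apply, Equiv.Perm.mul_apply, h.swap_apply (by omega) (by omega) hk,
      h.swap_apply (by omega) hm (by omega), h.apply (by omega)]
    congr 1
    split_ifs <;> omega
  refine h.comp hφ ?_ ?_ ?_
  · intro i hi j hj hij
    have h1 := shuffle_cases a n x q i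
    have h2 := shuffle_cases a n x q j
    omega
  · intro i hi
    refine key _ (hφ i (by omega)) _ ?_
    have h1 := shuffle_cases a n x q i
    have h2 := shuffle_cases a n x q (i + 1)
    have h3 := idxSwap_cases 0 (a - 1) (_root_.shuffle a n x q i)
    have h4 := idxSwap_cases x (a + n + q) (idxSwap 0 (a - 1) (_root_.shuffle a n x q i))
    rcases h1 with h1 | h1 | h1 | h1 | h1 <;> omega
  · intro i hi
    refine key _ (hφ i (by omega)) _ ?_
    have h1 := shuffle_cases a n x q i
    have h2 := shuffle_cases a n x q 0
    have h3 := idxSwap_cases 0 (a - 1) (_root_.shuffle a n x q i)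
    have h4 := idxSwap_cases x (a + n + q) (idxSwap 0 (a - 1) (_root_.shuffle a n x q i))
    rcases h1 with h1 | h1 | h1 | h1 | h1 <;> omega

theorem rev_shuffle {L1 L2 : List ℕ} {a b x q : ℕ} (f : ℕ → ℕ) (ha : x + 1 < a) (hq : q < b)
    (hA : ∀ t, a ≤ t → t < a + L1.sum → f t = t) (hD : ∀ t, a + L1.sum + b ≤ t → f t = t)
    (hab : a + 2 * q = b + 2 * x)
    (hC : ∀ i t v,
      (t < a ∧ shuffle a L1.sum x q i < a ∧ t + shuffle a L1.sum x q i + 1 = a ∨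
        a + L1.sum ≤ t ∧ t < a + L1.sum + b ∧
          shuffle a L1.sum x q i + t + 1 = 2 * (a + L1.sum) + b) →
      (i = 0 ∧ v = 0 ∨ L1.sum + 1 ≤ i ∧ i < L1.sum + a + b ∧ i + v = 2 * L1.sum + a + b) →
      f t = shuffle a L1.sum x q v) (i : ℕ) :
    f (rho (a :: (L1 ++ b :: L2)) (shuffle a L1.sum x q i)) =
      shuffle a L1.sum x q (rho (1 :: (L1 ++ (a + b - 1) :: L2)) i) := by
  have hs := shuffle_cases a L1.sum x q i
  rcases Nat.eq_zero_or_pos i with h0 | h0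
  · subst h0
    rw [rho_fst _ one_pos, rho_fst _ (by omega)]
    exact hC 0 _ _ (by omega) (by omega)
  by_cases h1 : i < 1 + L1.sum
  · obtain ⟨j, rfl⟩ : ∃ j, i = 1 + j := ⟨i - 1, by omega⟩
    have hj := rho_lt (L := L1) (i := j) (by omega)
    have h2 := shuffle_cases a L1.sum x q (1 + rho L1 j)
    rw [rho_mid 1 _ (by omega), show shuffle a L1.sum x q (1 + j) = a + j by omega,
      rho_mid a _ (by omega), hA _ (by omega) (by omega)]
    omega
  by_cases h2 : i < L1.sum + a + b
  · obtain ⟨j, rfl⟩ := Nat.exists_eq_add_of_le (not_lt.1 h1)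
    rw [rho_snd 1 L1 L2 (by omega)]
    by_cases hk : shuffle a L1.sum x q (1 + L1.sum + j) < a
    · rw [rho_fst _ hk]
      exact hC (1 + L1.sum + j) _ _ (by omega) (by omega)
    · obtain ⟨k, hk⟩ := Nat.exists_eq_add_of_le
        (show a + L1.sum ≤ shuffle a L1.sum x q (1 + L1.sum + j) by omega)
      have hkb : k < b := by omega
      have := hC (1 + L1.sum + j) (a + L1.sum + (b - 1 - k))
        (1 + L1.sum + (a + b - 1 - 1 - j)) (by omega) (by omega)
      rwa [hk, rho_snd a L1 L2 hkb]
  · obtain ⟨j, hj⟩ := Nat.exists_eq_add_of_le (not_lt.1 h2)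
    have e1 := rho_end 1 (a + b - 1) j L1 L2
    have e2 := rho_end a b j L1 L2
    rw [show 1 + L1.sum + (a + b - 1) = L1.sum + a + b by omega] at e1
    rw [show a + L1.sum + b = L1.sum + a + b by omega] at e2
    rw [show shuffle a L1.sum x q i = i by omega, hj, e1, e2, hD _ (by omega)]
    have := shuffle_cases a L1.sum x q (L1.sum + a + b + rho L2 j)
    omega

theorem rev_shuffle_odd (L1 L2 : List ℕ) {p : ℕ} (q i : ℕ) (hp : 1 ≤ p) :
    idxSwap 0 (2 * p) (idxSwap p (2 * p + 1 + L1.sum + q)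
      (rho ((2 * p + 1) :: (L1 ++ (2 * q + 1) :: L2)) (shuffle (2 * p + 1) L1.sum p q i))) =
    shuffle (2 * p + 1) L1.sum p q (rho (1 :: (L1 ++ (2 * p + 1 + (2 * q + 1) - 1) :: L2)) i) := by
  refine rev_shuffle (fun t => idxSwap 0 (2 * p) (idxSwap p (2 * p + 1 + L1.sum + q) t)) (by omega)
    (by omega) (fun t h1 h2 => ?_) (fun t h1 => ?_) (by omega) (fun i t v h1 h2 => ?_) i
  · have e2 := idxSwap_cases p (2 * p + 1 + L1.sum + q) t
    have e3 := idxSwap_cases 0 (2 * p) (idxSwap p (2 * p + 1 + L1.sum + q) t)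
    omega
  · have e2 := idxSwap_cases p (2 * p + 1 + L1.sum + q) t
    have e3 := idxSwap_cases 0 (2 * p) (idxSwap p (2 * p + 1 + L1.sum + q) t)
    omega
  · have hsh := shuffle_cases (2 * p + 1) L1.sum p q i
    have e1 := shuffle_cases (2 * p + 1) L1.sum p q v
    have e2 := idxSwap_cases p (2 * p + 1 + L1.sum + q) t
    have e3 := idxSwap_cases 0 (2 * p) (idxSwap p (2 * p + 1 + L1.sum + q) t)
    rcases hsh with h | h | h | h | h <;> rcases h1 with h1 | h1 <;> rcases h2 with h2 | h2 <;> omega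

theorem rev_shuffle_even (L1 L2 : List ℕ) (p q i : ℕ) :
    idxSwap 0 (2 * p + 1)
      (rho ((2 * p + 2) :: (L1 ++ (2 * q + 2) :: L2)) (shuffle (2 * p + 2) L1.sum p q i)) =
    shuffle (2 * p + 2) L1.sum p q (rho (1 :: (L1 ++ (2 * p + 2 + (2 * q + 2) - 1) :: L2)) i) := by
  refine rev_shuffle (idxSwap 0 (2 * p + 1)) (by omega)
    (by omega) (fun t h1 h2 => ?_) (fun t h1 => ?_) (by omega) (fun i t v h1 h2 => ?_) i
  · have e3 := idxSwap_cases 0 (2 * p + 1) t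
    omega
  · have e3 := idxSwap_cases 0 (2 * p + 1) t
    omega
  · have hsh := shuffle_cases (2 * p + 2) L1.sum p q i
    have e1 := shuffle_cases (2 * p + 2) L1.sum p q v
    have e3 := idxSwap_cases 0 (2 * p + 1) t
    rcases hsh with h | h | h | h | h <;> rcases h1 with h1 | h1 <;> rcases h2 with h2 | h2 <;> omega

/-- Transferring a block into a block of the same parity. -/
theorem Mv.merge (S : Type*) [Finite S] (a b : ℕ) (L1 L2 : List ℕ) (hab : a % 2 = b % 2) :
    Mv S 5 (a :: (L1 ++ b :: L2)) (1 :: (L1 ++ (a + b - 1) :: L2)) := by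
  classical
  intro r u h
  obtain ⟨G, R, P, h⟩ := h
  have ha := h.pos a (by simp)
  have hb := h.pos b (by simp)
  by_cases ha1 : a = 1
  · subst ha1
    refine ⟨r, u, (Conn.refl r u).weaken (by omega), ?_⟩
    rw [Nat.add_sub_cancel_left]
    exact ⟨G, R, P, h⟩
  have hpos : ∀ c ∈ 1 :: (L1 ++ (a + b - 1) :: L2), 1 ≤ c := by
    intro c hc
    simp only [List.mem_cons, List.mem_append] at hc
    have := h.pos c
    simp only [List.mem_cons, List.mem_append] at this
    rcases hc with hc | hc | hc | hc
    · omega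
    · exact this (by tauto)
    · omega
    · exact this (by tauto)
  set m := (a :: (L1 ++ b :: L2)).sum with hm
  have hm1 : (1 :: (L1 ++ (a + b - 1) :: L2)).sum = m := by
    simp only [hm, List.sum_cons, List.sum_append]
    omega
  have hm2 : m = a + (L1.sum + (b + L2.sum)) := by
    simp only [hm, List.sum_cons, List.sum_append]
  have hc := h.coord
  have full := hc.sameCycle
  have rv : ∀ i < m, ∀ j, rho (a :: (L1 ++ b :: L2)) i = j → R (P i) = P j := fun i hi j hj => by
    rw [h.rev i hi, hj]
  have r_snd : ∀ k < b, rho (a :: (L1 ++ b :: L2)) (a + L1.sum + k) = a + L1.sum + (b - 1 - k) :=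
    fun k hk => rho_snd a L1 L2 hk
  have hRs : R (P 0) = P (a - 1) := rv _ (by omega) _ (by rw [rho_fst _ (by omega)]; rfl)
  have hRe : R (P (a - 1)) = P 0 := rv _ (by omega) _ (by rw [rho_fst _ (by omega)]; omega)
  have ne : ∀ i < m, ∀ j < m, i ≠ j → P i ≠ P j := fun i hi j hj hij hh => hij (hc.inj i hi j hj hh)
  rcases Nat.even_or_odd' a with ⟨p', hp | hp⟩
  · obtain ⟨p, rfl⟩ : ∃ p, a = 2 * p + 2 := ⟨p' - 1, by omega⟩
    obtain ⟨q, rfl⟩ : ∃ q, b = 2 * q + 2 := ⟨b / 2 - 1, by omega⟩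
    obtain ⟨h1, h2, h3⟩ := hc.swap_cycles (x := p) (e := 2 * p + 1) (y := 2 * p + 2 + L1.sum + q)
      (by omega) (by omega) (by omega)
    obtain ⟨G', c, i', sq'⟩ := exists_double_swap_even h.inv h.sq full
      (by
        rw [hc.apply (by omega), if_neg (by omega)]
        exact rv _ (by omega) _ (by rw [rho_fst _ (by omega)]; omega))
      (by
        rw [hc.apply (by omega), if_neg (by omega)]
        exact rv _ (by omega) _ (by rw [r_snd _ (by omega)]; omega))
      h1 h2 h3 hRs hRe
    rw [h.eq]
    refine ⟨_, _, c, G', _, fun i => P (shuffle (2 * p + 2) L1.sum p q i), hpos, ?_, sq', i', rfl, ?_⟩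
    · rw [hm1]
      exact hc.shuffle (by omega) (by omega)
    · intro i hi
      rw [hm1] at hi
      have hs := shuffle_cases (2 * p + 2) L1.sum p q i
      have hl : shuffle (2 * p + 2) L1.sum p q i < m := by omega
      rw [Equiv.Perm.mul_apply, h.rev _ hl, hc.swap_apply (by omega) (by omega) (rho_lt hl)]
      exact congrArg P (rev_shuffle_even L1 L2 p q i)
  · obtain ⟨p, rfl⟩ : ∃ p, a = 2 * p + 1 := ⟨p', by omega⟩
    obtain ⟨q, rfl⟩ : ∃ q, b = 2 * q + 1 := ⟨b / 2, by omega⟩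
    obtain ⟨h1, h2, h3⟩ := hc.swap_cycles (x := p) (e := 2 * p) (y := 2 * p + 1 + L1.sum + q)
      (by omega) (by omega) (by omega)
    obtain ⟨G', c, i', sq'⟩ := exists_double_swap_odd h.inv h.sq full
      (rv p (by omega) _ (by rw [rho_fst _ (by omega)]; omega))
      (rv (2 * p + 1 + L1.sum + q) (by omega) _ (by rw [r_snd _ (by omega)]; omega))
      h1 h2 h3 hRs hRe (ne _ (by omega) _ (by omega) (by omega))
      (ne _ (by omega) _ (by omega) (by omega)) (ne _ (by omega) _ (by omega) (by omega))
      (ne _ (by omega) _ (by omega) (by omega))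
    rw [h.eq]
    refine ⟨_, _, c, G', _, fun i => P (shuffle (2 * p + 1) L1.sum p q i),
      hpos, ?_, sq', i', rfl, ?_⟩
    · rw [hm1]
      exact hc.shuffle (by omega) (by omega)
    · intro i hi
      rw [hm1] at hi
      have hs := shuffle_cases (2 * p + 1) L1.sum p q i
      have hl : shuffle (2 * p + 1) L1.sum p q i < m := by omega
      have hl' := rho_lt hl
      have hw := idxSwap_cases p (2 * p + 1 + L1.sum + q)
        (rho ((2 * p + 1) :: (L1 ++ (2 * q + 1) :: L2)) (shuffle (2 * p + 1) L1.sum p q i))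
      rw [Equiv.Perm.mul_apply, Equiv.Perm.mul_apply, h.rev _ hl,
        hc.swap_apply (by omega) (by omega) hl', hc.swap_apply (by omega) (by omega) (by omega)]
      exact congrArg P (rev_shuffle_odd L1 L2 q i (by omega))

/-- Rotation of the indices `0, …, d` by `k`. -/
def idxRot (d k i : ℕ) : ℕ := if d < i then i else if i + k ≤ d then i + k else i + k - (d + 1)

theorem idxRot_cases (d k i : ℕ) : (d < i ∧ idxRot d k i = i) ∨
    (i ≤ d ∧ i + k ≤ d ∧ idxRot d k i = i + k) ∨
    (i ≤ d ∧ d < i + k ∧ idxRot d k i = i + k - (d + 1)) := by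
  rw [idxRot]
  split_ifs <;> omega

/-- A permutation rotating `P 0, …, P d`, restricted to this cycle and iterated. -/
theorem Coord.pow_idxRot {S : Type*} [Finite S] {r u : Equiv.Perm S} {P : ℕ → S} {m d : ℕ}
    (h : Coord r P m) (hu : ∀ i, i < d → u (P i) = P (i + 1)) (hd : u (P d) = P 0) (hdm : d < m)
    {k : ℕ} (hk : k ≤ d) {i : ℕ} (hi : i < m) :
    (restrictPerm u (cyc u (P 0)) ^ k) (P i) = P (idxRot d k i) := by
  have hin : ∀ j, j ≤ d → P j ∈ cyc u (P 0) := fun j hj =>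
    sameCycle_of_chain (Nat.zero_le j) fun l _ h2 => hu l (by omega)
  have hB : ∀ z ∈ {z | ∃ j ≤ d, P j = z}, u z ∈ {z | ∃ j ≤ d, P j = z} := by
    rintro _ ⟨j, hj, rfl⟩
    rcases hj.eq_or_lt with rfl | hj
    · exact ⟨0, by omega, hd.symm⟩
    · exact ⟨j + 1, by omega, (hu j hj).symm⟩
  by_cases hid : i ≤ d
  · rw [restrictPerm_pow_of_mem (cyc_closed u (P 0)) (hin i hid)]
    induction k with
    | zero =>
      have := idxRot_cases d 0 i
      rw [pow_zero, Equiv.Perm.one_apply, show idxRot d 0 i = i by omega]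
    | succ k ih =>
      rw [pow_succ', Equiv.Perm.mul_apply, ih (by omega)]
      have h1 := idxRot_cases d k i
      have h2 := idxRot_cases d (k + 1) i
      by_cases h3 : idxRot d k i = d
      · rw [h3, hd, show idxRot d (k + 1) i = 0 by omega]
      · rw [hu _ (by omega), show idxRot d (k + 1) i = idxRot d k i + 1 by omega]
  · have hout : P i ∉ cyc u (P 0) := fun hh => by
      obtain ⟨j, hj, hji⟩ := cyc_subset hB ⟨0, Nat.zero_le d, rfl⟩ hh
      have := h.inj j (by omega) i hi hji
      omega
    rw [restrictPerm_pow_of_not_mem hout]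
    have := idxRot_cases d k i
    rw [show idxRot d k i = i by omega]

/-- Reordering of the coordinates under the splitting of an even block. -/
def zigzag (t j : ℕ) : ℕ :=
  if j ≤ 2 * t then
    if j = 0 then 0 else if j % 2 = 0 then 2 * t + 1 - j / 2 else t - j / 2
  else j

theorem zigzag_cases (t j : ℕ) : (j = 0 ∧ zigzag t j = 0) ∨
    (1 ≤ j ∧ j ≤ 2 * t ∧ j % 2 = 0 ∧ zigzag t j = 2 * t + 1 - j / 2) ∨
    (j ≤ 2 * t ∧ j % 2 = 1 ∧ zigzag t j = t - j / 2) ∨ (2 * t < j ∧ zigzag t j = j) := by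
  rw [zigzag]
  split_ifs <;> omega

/-- Splitting an even block followed by a trivial one. -/
theorem Mv.split (S : Type*) [Finite S] (t : ℕ) (L : List ℕ) (ht : 1 ≤ t) :
    Mv S 2 (2 * t :: 1 :: L) (2 :: (2 * t - 1) :: L) := by
  intro r u h
  obtain ⟨G, R, P, h⟩ := h
  have hpos : ∀ c ∈ 2 :: (2 * t - 1) :: L, 1 ≤ c := by
    intro c hc
    simp only [List.mem_cons] at hc
    rcases hc with hc | hc | hc
    · omega
    · omega
    · exact h.pos c (by simp [hc])
  set m := (2 * t :: 1 :: L).sum with hm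
  have hm1 : (2 :: (2 * t - 1) :: L).sum = m := by
    simp only [hm, List.sum_cons]
    omega
  have hm2 : m = 2 * t + (1 + L.sum) := by
    simp only [hm, List.sum_cons]
  have hc := h.coord
  have full := hc.sameCycle
  have rho1 : ∀ k, rho (2 * t :: 1 :: L) (2 * t + 1 + k) = 2 * t + 1 + rho L k := fun k => by
    rw [rho, if_neg (by omega), rho, if_neg (by omega)]
    rw [show 2 * t + 1 + k - 2 * t - 1 = k by omega]
    omega
  have rho2 : ∀ k, rho (2 :: (2 * t - 1) :: L) (2 * t + 1 + k) = 2 * t + 1 + rho L k := fun k => by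
    rw [rho, if_neg (by omega), rho, if_neg (by omega)]
    rw [show 2 * t + 1 + k - 2 - (2 * t - 1) = k by omega]
    omega
  obtain ⟨G1, c1, i1, sq1, h1, -⟩ := exists_twist_align h.inv h.sq R (full (P 0) (G (P 0)))
    (full (P 0) (P (2 * t)))
  rw [← h.eq] at c1
  have g1 : ∀ i, i ≤ 2 * t → G1 (P i) = P (2 * t - i) := by
    intro i
    induction i with
    | zero => exact fun _ => h1
    | succ i ih =>
      intro hi
      have e1 := i1 (P i)
      rw [hc.step i (by omega), ih (by omega)] at e1
      refine r.injective (e1.trans ?_)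
      rw [hc.step _ (by omega), show 2 * t - (i + 1) + 1 = 2 * t - i by omega]
  set v := G1 * R with hv
  have vs : ∀ i, i < 2 * t → v (P i) = P (i + 1) := fun i hi => by
    rw [hv, Equiv.Perm.mul_apply, h.rev i (by omega), rho_fst _ hi, g1 _ (by omega)]
    congr 1
    omega
  have vl : v (P (2 * t)) = P 0 := by
    rw [hv, Equiv.Perm.mul_apply, h.rev _ (by omega), rho, if_neg (by omega), rho,
      if_pos (by omega), show 2 * t + (1 - 1 - (2 * t - 2 * t)) = 2 * t by omega, g1 _ le_rfl,
      Nat.sub_self]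
  set T := restrictPerm v (cyc v (P 0)) ^ (t - 1) with hT
  have hTP : ∀ i < m, T (P i) = P (idxRot (2 * t) (t - 1) i) := fun i hi =>
    hc.pow_idxRot vs vl (by omega) (by omega) hi
  have g1out : ∀ i < m, 2 * t < i → ∃ j < m, 2 * t < j ∧ G1 (P i) = P j := fun i hi hti => by
    obtain ⟨j, hj, hji⟩ := hc.surj (G1 (P i))
    refine ⟨j, hj, ?_, hji.symm⟩
    by_contra hcon
    have e1 := g1 j (by omega)
    rw [hji, sq1] at e1
    have := hc.inj i hi _ (by omega) e1
    omega
  have TGT : ∀ z, T (G1 (T z)) = G1 z := by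
    intro z
    obtain ⟨i, hi, rfl⟩ := hc.surj z
    have e1 := idxRot_cases (2 * t) (t - 1) i
    rw [hTP i hi]
    by_cases hit : i ≤ 2 * t
    · have e2 := idxRot_cases (2 * t) (t - 1) (2 * t - idxRot (2 * t) (t - 1) i)
      rw [g1 _ (by omega), g1 i hit, hTP _ (by omega)]
      congr 1
      omega
    · obtain ⟨j, hj, hjt, hij⟩ := g1out i hi (by omega)
      have e2 := idxRot_cases (2 * t) (t - 1) j
      rw [show idxRot (2 * t) (t - 1) i = i by omega, hij, hTP j hj]
      congr 1
      omega
  have c2 := Conn.vstep_right r v (P 0) (t - 1)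
  rw [← hT] at c2
  have sqG : ∀ x, (G1 * T) ((G1 * T) x) = x := fun x => by
    simp only [Equiv.Perm.mul_apply]
    rw [TGT, sq1]
  have hz : ∀ i < m, zigzag t i < m := fun i hi => by
    have := zigzag_cases t i
    omega
  have key : ∀ i < m, ∀ l, (idxRot (2 * t) (t - 1) i + 1 = l ∧ l < m) ∨
      (idxRot (2 * t) (t - 1) i + 1 = m ∧ l = 0) → (r * T) (P i) = P l := fun i hi l hl => by
    rw [Equiv.Perm.mul_apply, hTP i hi, hc.apply (by omega)]
    congr 1
    split_ifs <;> omega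
  refine ⟨_, _, c1.trans c2, G1 * T, G1 * T * v, fun i => P (zigzag t i), hpos, ?_, sqG, ?_, ?_, ?_⟩
  · rw [hm1]
    refine hc.comp hz ?_ ?_ ?_
    · intro i hi j hj hij
      have e1 := zigzag_cases t i
      have e2 := zigzag_cases t j
      omega
    · intro i hi
      refine key _ (hz i (by omega)) _ ?_
      have e1 := zigzag_cases t i
      have e2 := zigzag_cases t (i + 1)
      have e3 := idxRot_cases (2 * t) (t - 1) (zigzag t i)
      rcases e1 with e1 | e1 | e1 | e1 <;> omega
    · intro i hi
      refine key _ (hz i (by omega)) _ ?_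
      have e1 := zigzag_cases t i
      have e2 := zigzag_cases t 0
      have e3 := idxRot_cases (2 * t) (t - 1) (zigzag t i)
      rcases e1 with e1 | e1 | e1 | e1 <;> omega
  · intro x
    simp only [Equiv.Perm.mul_apply]
    rw [TGT, i1]
  · exact Equiv.ext fun x => (sqG (v x)).symm
  · intro i hi
    rw [hm1] at hi
    have e1 := zigzag_cases t i
    by_cases hit : i ≤ 2 * t
    · have hrot : (G1 * T * v) (P (zigzag t i)) = P (2 * t - idxRot (2 * t) t (zigzag t i)) := by
        have e2 := idxRot_cases (2 * t) t (zigzag t i)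
        rw [Equiv.Perm.mul_apply]
        by_cases hz2 : zigzag t i = 2 * t
        · have e3 := idxRot_cases (2 * t) (t - 1) 0
          rw [hz2] at e2 ⊢
          rw [vl, Equiv.Perm.mul_apply, hTP 0 (by omega), g1 _ (by omega)]
          congr 1
          omega
        · have e3 := idxRot_cases (2 * t) (t - 1) (zigzag t i + 1)
          rw [vs _ (by omega), Equiv.Perm.mul_apply, hTP _ (by omega), g1 _ (by omega)]
          congr 1
          omega
      rw [hrot]
      have e2 := idxRot_cases (2 * t) t (zigzag t i)
      have e3 : (i < 2 ∧ rho (2 :: (2 * t - 1) :: L) i = 1 - i) ∨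
          (2 ≤ i ∧ rho (2 :: (2 * t - 1) :: L) i = 2 * t + 2 - i) := by
        rw [rho, rho]
        split_ifs <;> omega
      have e4 := zigzag_cases t (rho (2 :: (2 * t - 1) :: L) i)
      congr 1
      rcases e1 with e1 | e1 | e1 | e1 <;> omega
    · obtain ⟨k, rfl⟩ := Nat.exists_eq_add_of_le (show 2 * t + 1 ≤ i by omega)
      have hk := rho_lt (L := L) (i := k) (by omega)
      have e2 := zigzag_cases t (2 * t + 1 + rho L k)
      obtain ⟨j, hj, hjt, hij⟩ := g1out (2 * t + 1 + rho L k) (by omega) (by omega)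
      have e3 := idxRot_cases (2 * t) (t - 1) j
      rw [rho2, show zigzag t (2 * t + 1 + k) = 2 * t + 1 + k by omega,
        show zigzag t (2 * t + 1 + rho L k) = 2 * t + 1 + rho L k by omega, hv,
        Equiv.Perm.mul_apply, Equiv.Perm.mul_apply, Equiv.Perm.mul_apply, h.rev _ (by omega), rho1,
        hij, hTP j hj, show idxRot (2 * t) (t - 1) j = j by omega, ← hij, sq1]

/-- Moves between lists of positive block lengths, with the obvious invariants. -/
def Red (S : Type*) (N : ℕ) (L L' : List ℕ) : Prop :=
  (∀ x ∈ L, 1 ≤ x) → (∀ x ∈ L', 1 ≤ x) ∧ L'.sum = L.sum ∧ L'.length = L.length ∧ Mv S N L L'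

theorem Red.trans {S : Type*} {N M : ℕ} {L L' L'' : List ℕ} (h : Red S N L L')
    (h' : Red S M L' L'') : Red S (N + M) L L'' := fun hp => by
  obtain ⟨p1, s1, l1, m1⟩ := h hp
  obtain ⟨p2, s2, l2, m2⟩ := h' p1
  exact ⟨p2, s2.trans s1, l2.trans l1, m1.trans m2⟩

theorem Red.refl (S : Type*) (L : List ℕ) : Red S 0 L L := fun hp => ⟨hp, rfl, rfl, Mv.refl S L⟩

theorem Red.weaken {S : Type*} {N M : ℕ} {L L' : List ℕ} (h : Red S N L L') (hNM : N ≤ M) :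
    Red S M L L' := fun hp => by
  obtain ⟨p1, s1, l1, m1⟩ := h hp
  exact ⟨p1, s1, l1, m1.weaken hNM⟩

theorem Red.rotate (S : Type*) (L M : List ℕ) : Red S 0 (L ++ M) (M ++ L) := fun hp =>
  ⟨fun x hx => hp x (by simpa [or_comm] using hx), by simp [add_comm], by simp [add_comm],
    Mv.rotate S L M⟩

theorem Red.merge (S : Type*) [Finite S] (a b : ℕ) (L1 L2 : List ℕ) (hab : a % 2 = b % 2) :
    Red S 5 (a :: (L1 ++ b :: L2)) (1 :: (L1 ++ (a + b - 1) :: L2)) := fun hp => by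
  have ha := hp a (by simp)
  have hb := hp b (by simp)
  refine ⟨fun c hc => ?_, ?_, by simp, Mv.merge S a b L1 L2 hab⟩
  · simp only [List.mem_cons, List.mem_append] at hc
    have := hp c
    simp only [List.mem_cons, List.mem_append] at this
    rcases hc with hc | hc | hc | hc
    · omega
    · exact this (by tauto)
    · omega
    · exact this (by tauto)
  · simp only [List.sum_cons, List.sum_append]
    omega

theorem Red.split (S : Type*) [Finite S] (d : ℕ) (L : List ℕ) (hd : d % 2 = 0) :
    Red S 2 (d :: 1 :: L) (2 :: (d - 1) :: L) := fun hp => by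
  have ha := hp d (by simp)
  have e : d = 2 * (d / 2) := by omega
  refine ⟨fun c hc => ?_, ?_, by simp, ?_⟩
  · simp only [List.mem_cons] at hc
    rcases hc with hc | hc | hc
    · omega
    · omega
    · exact hp c (by simp [hc])
  · simp only [List.sum_cons]
    omega
  · rw [e]
    exact Mv.split S _ L (by omega)

/-- All blocks trivial. -/
def Ones (Z : List ℕ) : Prop := ∀ x ∈ Z, x = 1

theorem Ones.append {Z Z' : List ℕ} (h : Ones Z) (h' : Ones Z') : Ones (Z ++ Z') := fun x hx => by
  rcases List.mem_append.1 hx with hx | hx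
  · exact h x hx
  · exact h' x hx

theorem Ones.cons {Z : List ℕ} (h : Ones Z) : Ones (1 :: Z) := fun x hx => by
  rcases List.mem_cons.1 hx with hx | hx
  · exact hx
  · exact h x hx

theorem Ones.nil : Ones [] := fun x hx => by simp at hx

/-- Reduction to at most two nontrivial blocks, at most one of which is odd. -/
def Reduces (S : Type*) (N : ℕ) (L : List ℕ) : Prop :=
  (∃ c Z, c % 2 = 1 ∧ Ones Z ∧ Red S N L (c :: Z)) ∨
    ∃ d c Z Z', d % 2 = 0 ∧ c % 2 = 1 ∧ Ones Z ∧ Ones Z' ∧ Red S N L (d :: (Z ++ c :: Z'))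

theorem Red.reduces {S : Type*} {N M K : ℕ} {L L' : List ℕ} (h : Red S N L L')
    (h' : Reduces S M L') (hK : N + M ≤ K) : Reduces S K L := by
  rcases h' with ⟨c, Z, h1, h2, h3⟩ | ⟨d, c, Z, Z', h1, h2, h3, h4, h5⟩
  · exact Or.inl ⟨c, Z, h1, h2, (h.trans h3).weaken hK⟩
  · exact Or.inr ⟨d, c, Z, Z', h1, h2, h3, h4, (h.trans h5).weaken hK⟩

theorem reduces_aux (S : Type*) [Finite S] (Y : List ℕ) (hp : ∀ x ∈ Y, 1 ≤ x) :
    (∀ c Z1 Z2, c % 2 = 1 → Ones Z1 → Ones Z2 →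
      Reduces S (10 * Y.length) (c :: (Z1 ++ (Y ++ Z2)))) ∧
    ∀ d c Z1 Z2 Z3, 1 ≤ d → d % 2 = 0 → c % 2 = 1 → Ones Z1 → Ones Z2 → Ones Z3 →
      Reduces S (10 * Y.length) (d :: (Z1 ++ (Y ++ (Z2 ++ c :: Z3)))) := by
  induction Y with
  | nil =>
    refine ⟨fun c Z1 Z2 hc h1 h2 => Or.inl ⟨c, _, hc, h1.append h2, Red.refl S _⟩,
      fun d c Z1 Z2 Z3 _ hd hc h1 h2 h3 =>
        Or.inr ⟨d, c, _, Z3, hd, hc, h1.append h2, h3, ?_⟩⟩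
    simpa using Red.refl S (d :: (Z1 ++ Z2 ++ c :: Z3))
  | cons y Y ih =>
    obtain ⟨ihA, ihB⟩ := ih fun x hx => hp x (by simp [hx])
    have hy1 := hp y (by simp)
    constructor
    · intro c Z1 Z2 hc h1 h2
      rcases Nat.mod_two_eq_zero_or_one y with hy | hy
      · have e := Red.rotate S (c :: Z1) (y :: Y ++ Z2)
        have f := ihB y c [] Z2 Z1 hy1 hy hc Ones.nil h2 h1
        simp only [List.append_assoc, List.cons_append, List.nil_append] at e f ⊢
        exact e.reduces f (by simp)
      · have e0 := Red.merge S c y Z1 (Y ++ Z2) (by omega)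
        have e := Red.rotate S (1 :: Z1) ((c + y - 1) :: Y ++ Z2)
        have f := ihA (c + y - 1) [] (Z2 ++ 1 :: Z1) (by omega) Ones.nil (h2.append h1.cons)
        simp only [List.append_assoc, List.cons_append, List.nil_append] at e0 e f ⊢
        exact (e0.trans e).reduces f (by simp; omega)
    · intro d c Z1 Z2 Z3 hd1 hd hc h1 h2 h3
      rcases Nat.mod_two_eq_zero_or_one y with hy | hy
      · have e0 := Red.merge S d y Z1 (Y ++ (Z2 ++ c :: Z3)) (by omega)
        have e1 := Red.rotate S (1 :: Z1) ((d + y - 1) :: (Y ++ (Z2 ++ c :: Z3)))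
        have e2 := Red.merge S (d + y - 1) c (Y ++ Z2) (Z3 ++ 1 :: Z1) (by omega)
        have e3 := Red.rotate S (1 :: (Y ++ Z2)) ((d + y - 1 + c - 1) :: (Z3 ++ 1 :: Z1))
        have f := ihA (d + y - 1 + c - 1) (Z3 ++ 1 :: (Z1 ++ [1])) Z2
        have hf := f (by omega) (h3.append (h1.append Ones.nil.cons).cons) h2
        simp only [List.append_assoc, List.cons_append, List.nil_append] at e0 e1 e2 e3 hf ⊢
        exact (((e0.trans e1).trans e2).trans e3).reduces hf (by simp; omega)
      · have e0 := Red.rotate S (d :: Z1) (y :: (Y ++ (Z2 ++ c :: Z3)))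
        have e1 := Red.merge S y c (Y ++ Z2) (Z3 ++ d :: Z1) (by omega)
        have e2 := Red.rotate S (1 :: (Y ++ (Z2 ++ (y + c - 1) :: Z3))) (d :: Z1)
        have f := ihB d (y + c - 1) (Z1 ++ [1]) Z2 Z3 hd1 hd (by omega) (h1.append Ones.nil.cons) h2 h3
        simp only [List.append_assoc, List.cons_append, List.nil_append] at e0 e1 e2 f ⊢
        exact ((e0.trans e1).trans e2).reduces f (by simp; omega)

theorem exists_reduces (S : Type*) [Finite S] {L : List ℕ} (hL : 2 ≤ L.length)
    (hp : ∀ x ∈ L, 1 ≤ x) :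
    Reduces S (10 * L.length + 5) L := by
  by_cases h : ∃ c ∈ L, c % 2 = 1
  · obtain ⟨c, hcL, hc⟩ := h
    obtain ⟨X, Y, rfl⟩ := List.append_of_mem hcL
    have e := Red.rotate S X (c :: Y)
    have f := (reduces_aux S (Y ++ X) fun x hx => hp x (by
      simp only [List.mem_append, List.mem_cons] at hx ⊢; tauto)).1 c [] [] hc Ones.nil Ones.nil
    simp only [List.cons_append, List.nil_append, List.append_nil] at e f
    exact e.reduces f (by simp; omega)
  · push Not at h
    obtain ⟨x, y, Y, rfl⟩ : ∃ x y Y, L = x :: y :: Y := by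
      match L, hL with
      | x :: y :: Y, _ => exact ⟨x, y, Y, rfl⟩
    have hx := h x (by simp)
    have hy := h y (by simp)
    have hx1 := hp x (by simp)
    have hy1 := hp y (by simp)
    have e := Red.merge S x y [] Y (by omega)
    have f := (reduces_aux S ((x + y - 1) :: Y) fun z hz => by
      rcases List.mem_cons.1 hz with hz | hz
      · omega
      · exact hp z (by simp [hz])).1 1 [] [] rfl Ones.nil Ones.nil
    simp only [List.nil_append, List.append_nil] at e f
    exact e.reduces f (by simp; omega)

/-- The normal form for `ℓ` blocks of total length `m`. -/
def canon (m ℓ : ℕ) : List ℕ :=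
  if (m - ℓ) % 2 = 0 then (m - ℓ + 1) :: List.replicate (ℓ - 1) 1
  else 2 :: (m - ℓ) :: List.replicate (ℓ - 2) 1

theorem Ones.eq_replicate {Z : List ℕ} (h : Ones Z) : Z = List.replicate Z.length 1 :=
  List.eq_replicate_iff.2 ⟨rfl, h⟩

theorem Ones.sum {Z : List ℕ} (h : Ones Z) : Z.sum = Z.length := by
  rw [h.eq_replicate]
  simp

theorem canon_odd {c : ℕ} {Z : List ℕ} (hc : c % 2 = 1) (hZ : Ones Z) :
    c :: Z = canon (c :: Z).sum (c :: Z).length := by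
  have : (c :: Z).sum - (c :: Z).length = c - 1 := by
    rw [List.sum_cons, List.length_cons, hZ.sum]
    omega
  rw [canon, this, if_pos (by omega), List.length_cons, Nat.add_sub_cancel, ← hZ.eq_replicate]
  congr 1
  omega

theorem canon_even {e : ℕ} {Z : List ℕ} (he : e % 2 = 1) (hZ : Ones Z) :
    2 :: e :: Z = canon (2 :: e :: Z).sum (2 :: e :: Z).length := by
  have : (2 :: e :: Z).sum - (2 :: e :: Z).length = e := by
    simp only [List.sum_cons, List.length_cons, hZ.sum]
    omega
  rw [canon, this, if_neg (by omega), List.length_cons, List.length_cons,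
    show Z.length + 1 + 1 - 2 = Z.length by omega, ← hZ.eq_replicate]

theorem red_even (S : Type*) [Finite S] {d c : ℕ} {Z Z' : List ℕ} (hd : d % 2 = 0) (hd0 : 2 ≤ d)
    (hc : c % 2 = 1) (hZ : Ones Z) (hZ' : Ones Z') :
    ∃ e Z'', e % 2 = 1 ∧ Ones Z'' ∧ Red S 12 (d :: 1 :: (Z ++ c :: Z')) (2 :: e :: Z'') := by
  have e0 := Red.split S d (Z ++ c :: Z') hd
  have e1 := Red.rotate S [2] ((d - 1) :: (Z ++ c :: Z'))
  have e2 := Red.merge S (d - 1) c Z (Z' ++ [2]) (by omega)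
  have e3 := Red.rotate S (1 :: Z) ((d - 1 + c - 1) :: (Z' ++ [2]))
  have e4 := Red.merge S (d - 1 + c - 1) 1 (Z' ++ [2]) Z (by omega)
  have e5 := Red.rotate S (1 :: Z') (2 :: (d - 1 + c - 1 + 1 - 1) :: Z)
  simp only [List.append_assoc, List.cons_append, List.nil_append] at e0 e1 e2 e3 e4 e5
  exact ⟨_, _, by omega, hZ.append hZ'.cons,
    (((((e0.trans e1).trans e2).trans e3).trans e4).trans e5).weaken (by omega)⟩

theorem red_canon (S : Type*) [Finite S] {L : List ℕ} (hL : 3 ≤ L.length)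
    (hp : ∀ x ∈ L, 1 ≤ x) :
    Red S (10 * L.length + 22) L (canon L.sum L.length) := by
  have fin : ∀ {N : ℕ} {K : List ℕ}, Red S N L K → N ≤ 10 * L.length + 22 →
      K = canon K.sum K.length → Red S (10 * L.length + 22) L (canon L.sum L.length) :=
    fun {N K} h hN hK => by
      obtain ⟨-, h1, h2, -⟩ := h hp
      rw [h1, h2] at hK
      rw [← hK]
      exact h.weaken hN
  rcases exists_reduces S (L := L) (by omega) hp with
    ⟨c, Z, h1, h2, h3⟩ | ⟨d, c, Z, Z', h1, h2, h3, h4, h5⟩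
  · exact fin h3 (by omega) (canon_odd h1 h2)
  · obtain ⟨pos, -, hl, -⟩ := h5 hp
    have hd := pos d (by simp)
    simp only [List.length_cons, List.length_append] at hl
    cases Z with
    | cons z Z =>
      obtain rfl : z = 1 := h3 z (by simp)
      obtain ⟨e, Z'', he, hZ'', h6⟩ := red_even (Z := Z) S h1 (by omega) h2
        (fun x hx => h3 x (by simp [hx])) h4
      exact fin (h5.trans h6) (by omega) (canon_even he hZ'')
    | nil =>
      cases Z' with
      | nil =>
        simp only [List.length_nil] at hl
        omega
      | cons z Z' =>
        obtain rfl : z = 1 := h4 z (by simp)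
        have e0 := Red.rotate S [d] (c :: 1 :: Z')
        have e1 := Red.merge S c 1 [] (Z' ++ [d]) (by omega)
        have e2 := Red.rotate S (1 :: (c + 1 - 1) :: Z') [d]
        obtain ⟨e, Z'', he, hZ'', h6⟩ := red_even (c := c + 1 - 1) (Z := []) (Z' := Z') S h1
          (by omega) (by omega) Ones.nil fun x hx => h4 x (by simp [hx])
        simp only [List.cons_append, List.nil_append] at e0 e1 e2 h5 h6
        exact fin ((((h5.trans e0).trans e1).trans e2).trans h6) (by omega) (canon_even he hZ'')

/-- Any two pairs with a hyperelliptic structure of the same type are connected. -/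
theorem IsHyp.conn {S : Type*} [Fintype S] {ℓ : ℕ} {r u r' u' : Equiv.Perm S} (hℓ : 3 ≤ ℓ)
    (h : IsHyp ℓ r u) (h' : IsHyp ℓ r' u') : Conn (26 * ℓ + 49) r u r' u' := by
  have key : ∀ {r u : Equiv.Perm S}, IsHyp ℓ r u → ∃ r' u', Conn (13 * ℓ + 24) r u r' u' ∧
      PathPair (canon (Fintype.card S) ℓ) r' u' := by
    intro r u h
    obtain ⟨r1, u1, c1, h1⟩ := h.exists_full (by omega)
    obtain ⟨G, hG⟩ := c1.isHyp h
    obtain ⟨L, hs, hl, hp, hL⟩ := hG.exists_path (by omega) h1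
    obtain ⟨-, -, -, hm⟩ := red_canon S (L := L) (by omega) hp hp
    rw [hs, hl] at hm
    obtain ⟨r2, u2, c2, h2⟩ := hm r1 u1 hL
    exact ⟨r2, u2, (c1.trans c2).weaken (by omega), h2⟩
  obtain ⟨r1, u1, c1, h1⟩ := key h
  obtain ⟨r2, u2, c2, h2⟩ := key h'
  have hpos : 0 < (canon (Fintype.card S) ℓ).sum := by
    rw [canon]
    split_ifs <;> simp
  exact ((c1.trans (h1.conn hpos h2)).trans c2.symm).weaken (by omega)

/-- The surface `f` is obtained from two copies of `S`, exchanged by the involutions according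
to the permutations `L`. -/
def Models {S : Type*} {n : ℕ} (φ : S × Bool ≃ Fin n) (f : Surf n) (L : Color → Equiv.Perm S) :
    Prop :=
  ∀ X x, f X (φ (x, true)) = φ (L X x, false) ∧ f X (φ (L X x, false)) = φ (x, true)

/-- Regluing one of the two copies of `S`. -/
noncomputable def reglue {S : Type*} {n : ℕ} (φ : S × Bool ≃ Fin n) (v w : Equiv.Perm S) : S × Bool ≃ Fin n :=
  (Equiv.ofBijective (fun p : S × Bool => if p.2 then (v p.1, true) else (w p.1, false)) (by
    constructor
    · rintro ⟨x, b⟩ ⟨y, c⟩ h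
      cases b <;> cases c <;> simp_all
    · rintro ⟨x, b⟩
      cases b
      · exact ⟨(w.symm x, false), by simp⟩
      · exact ⟨(v.symm x, true), by simp⟩)).trans φ

theorem reglue_true {S : Type*} {n : ℕ} (φ : S × Bool ≃ Fin n) (v w : Equiv.Perm S) (x : S) :
    reglue φ v w (x, true) = φ (v x, true) := rfl

theorem reglue_false {S : Type*} {n : ℕ} (φ : S × Bool ≃ Fin n) (v w : Equiv.Perm S) (x : S) :
    reglue φ v w (x, false) = φ (w x, false) := rfl

theorem Models.regluing {S : Type*} {n : ℕ} {φ : S × Bool ≃ Fin n} {f : Surf n}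
    {L : Color → Equiv.Perm S} (h : Models φ f L) (v w : Equiv.Perm S) :
    Models (reglue φ v w) f (fun X => w⁻¹ * L X * v) := by
  intro X x
  obtain ⟨h1, h2⟩ := h X (v x)
  have e : w ((w⁻¹ * L X * v) x) = L X (v x) := by simp
  rw [reglue_true, reglue_false, e]
  exact ⟨h1, h2⟩

theorem Models.isomorphic {S : Type*} {n : ℕ} {φ φ' : S × Bool ≃ Fin n} {f f' : Surf n}
    {L : Color → Equiv.Perm S} (h : Models φ f L) (h' : Models φ' f' L) : Isomorphic n f f' := by
  refine ⟨φ.symm.trans φ', fun X => ?_⟩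
  rw [eq_mul_inv_iff_mul_eq]
  ext y
  obtain ⟨⟨x, b⟩, rfl⟩ := φ.surjective y
  congr 1
  simp only [Equiv.Perm.mul_apply, Equiv.trans_apply, Equiv.symm_apply_apply]
  cases b
  · obtain ⟨z, rfl⟩ := (L X).surjective x
    rw [(h' X z).2, (h X z).2, Equiv.symm_apply_apply]
  · rw [(h' X x).1, (h X x).1, Equiv.symm_apply_apply]

/-- The union of the two copies of a subset of `S`. -/
def double {S : Type*} {n : ℕ} (φ : S × Bool ≃ Fin n) (W : Set S) : Set (Fin n) :=
  {y | (φ.symm y).1 ∈ W}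

theorem mem_double {S : Type*} {n : ℕ} {φ : S × Bool ≃ Fin n} {W : Set S} {x : S} {b : Bool} :
    φ (x, b) ∈ double φ W ↔ x ∈ W := by
  simp [double]

theorem double_reglue {S : Type*} {n : ℕ} (φ : S × Bool ≃ Fin n) {W : Set S} {v w : Equiv.Perm S}
    (hv : ∀ x, v x ∈ W ↔ x ∈ W) (hw : ∀ x, w x ∈ W ↔ x ∈ W) :
    double (reglue φ v w) W = double φ W := by
  ext y
  obtain ⟨⟨x, b⟩, rfl⟩ := (reglue φ v w).surjective y
  rw [mem_double]
  cases b
  · rw [reglue_false, mem_double, hw]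
  · rw [reglue_true, mem_double, hv]

theorem restrictPerm_mem_iff {S : Type*} [Finite S] {v : Equiv.Perm S} {W : Set S}
    (hW : ∀ x ∈ W, v x ∈ W) (x : S) : restrictPerm v W x ∈ W ↔ x ∈ W := by
  by_cases hx : x ∈ W
  · rw [restrictPerm_of_mem hW hx]
    exact closed_iff hW x
  · rw [restrictPerm_of_not_mem hx]

open Classical in
theorem Models.restrict {S : Type*} [Finite S] {n : ℕ} {φ : S × Bool ≃ Fin n} {f : Surf n}
    {L : Color → Equiv.Perm S} (h : Models φ f L) {X : Color} {W : Set S}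
    (hW : ∀ x ∈ W, L X x ∈ W) (x : S) :
    restrictPerm (f X) (double φ W) (φ (x, true)) =
        (if x ∈ W then φ (L X x, false) else φ (x, true)) ∧
      restrictPerm (f X) (double φ W) (φ (L X x, false)) =
        (if x ∈ W then φ (x, true) else φ (L X x, false)) := by
  have hc : ∀ y ∈ double φ W, f X y ∈ double φ W := by
    intro y hy
    obtain ⟨⟨x, b⟩, rfl⟩ := φ.surjective y
    rw [mem_double] at hy
    cases b
    · obtain ⟨z, rfl⟩ := (L X).surjective x
      rw [(h X z).2, mem_double]
      exact (closed_iff hW z).1 hy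
    · rw [(h X x).1, mem_double]
      exact hW x hy
  by_cases hx : x ∈ W
  · rw [if_pos hx, if_pos hx, restrictPerm_of_mem hc (mem_double.2 hx),
      restrictPerm_of_mem hc (mem_double.2 (hW x hx))]
    exact h X x
  · rw [if_neg hx, if_neg hx, restrictPerm_of_not_mem (fun h => hx (mem_double.1 h)),
      restrictPerm_of_not_mem (fun h => hx ((closed_iff hW x).1 (mem_double.1 h)))]
    exact ⟨rfl, rfl⟩

theorem Models.shearing {S : Type*} [Finite S] {n : ℕ} {φ : S × Bool ≃ Fin n} {f : Surf n}
    {L : Color → Equiv.Perm S} (h : Models φ f L) (i : Color) (hG : L Color.G = 1) {W : Set S}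
    (hW : ∀ x ∈ W, L i x ∈ W) :
    Models (reglue φ 1 (restrictPerm (L i) W)⁻¹) (shear f i Color.G (double φ W))
      (fun X => if X = i ∨ X = Color.G then L X else restrictPerm (L i) W * L X) := by
  set t := restrictPerm (L i) W with ht
  have hG' : ∀ x ∈ W, L Color.G x ∈ W := fun x hx => by simpa [hG] using hx
  have e1 : ∀ x, restrictPerm (f i) (double φ W) (restrictPerm (f Color.G) (double φ W)
      (φ (t x, true))) = φ (x, true) := by
    intro x
    have h1 := (h.restrict hG' (t x)).1
    rw [h1, hG, Equiv.Perm.one_apply]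
    by_cases hx : x ∈ W
    · rw [if_pos ((restrictPerm_mem_iff hW x).2 hx), ht, restrictPerm_of_mem hW hx,
        (h.restrict hW x).2, if_pos hx]
    · rw [if_neg (fun h => hx ((restrictPerm_mem_iff hW x).1 h)), ht, restrictPerm_of_not_mem hx,
        (h.restrict hW x).1, if_neg hx]
  have e2 : ∀ x, restrictPerm (f i) (double φ W) (restrictPerm (f Color.G) (double φ W)
      (φ (x, false))) = φ (t x, false) := by
    intro x
    have h1 := (h.restrict hG' x).2
    rw [hG, Equiv.Perm.one_apply] at h1
    rw [h1]
    by_cases hx : x ∈ W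
    · rw [if_pos hx, (h.restrict hW x).1, if_pos hx, ht, restrictPerm_of_mem hW hx]
    · rw [if_neg hx, ht, restrictPerm_of_not_mem hx]
      obtain ⟨z, rfl⟩ := (L i).surjective x
      rw [(h.restrict hW z).2, if_neg fun hz => hx (hW z hz)]
  have hs : ∀ z, t⁻¹ (t z) = z := t.symm_apply_apply
  intro X x
  rw [reglue_true, reglue_false, Equiv.Perm.one_apply, shear]
  by_cases hX : X = i ∨ X = Color.G
  · have hc : ∀ x, L X (t x) = t (L X x) := by
      intro x
      rcases hX with rfl | rfl
      · exact (Equiv.Perm.ext_iff.1 (restrictPerm_comm hW) x).symm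
      · rw [hG]
        rfl
    simp only [if_pos hX, Equiv.Perm.mul_apply]
    obtain ⟨y, rfl⟩ := t.surjective x
    rw [e1, hc, hs, e2, ← hc]
    exact ⟨(h X y).1, (h X (t y)).2⟩
  · simp only [if_neg hX, Equiv.Perm.mul_apply, hs]
    exact h X x

theorem Models.exists_shearPow {S : Type*} [Finite S] {n : ℕ} {φ : S × Bool ≃ Fin n} {f : Surf n}
    {L : Color → Equiv.Perm S} (h : Models φ f L) (i : Color) (hG : L Color.G = 1) {W : Set S}
    (hW : ∀ x ∈ W, L i x ∈ W) (m : ℕ) :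
    ∃ φ' : S × Bool ≃ Fin n, double φ' W = double φ W ∧
      Models φ' (shearPow f i Color.G (double φ W) m)
        (fun X => if X = i ∨ X = Color.G then L X else restrictPerm (L i) W ^ m * L X) := by
  induction m with
  | zero => exact ⟨φ, rfl, by simpa [shearPow] using h⟩
  | succ m ih =>
    obtain ⟨φ', h1, h2⟩ := ih
    have h3 := h2.shearing i (by simpa using hG) (W := W) (by simpa using hW)
    simp only [true_or, if_true] at h3
    refine ⟨reglue φ' 1 (restrictPerm (L i) W)⁻¹, ?_, ?_⟩
    · rw [double_reglue φ' (fun x => Iff.rfl), h1]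
      intro x
      obtain ⟨z, rfl⟩ := (restrictPerm (L i) W).surjective x
      exact (restrictPerm_mem_iff hW _).symm.trans (by simp)
    · rw [shearPow, ← h1]
      convert h3 using 2 with X
      · rw [h1]
      · split_ifs with hX
        · rfl
        · rw [pow_succ', mul_assoc]

theorem Models.isComponent {S : Type*} [Finite S] {n : ℕ} {φ : S × Bool ≃ Fin n} {f : Surf n}
    {L : Color → Equiv.Perm S} (h : Models φ f L) (i : Color) (hG : L Color.G = 1) (x : S) :
    IsComponent n f i Color.G (double φ (cyc (L i) x)) := by
  refine ⟨φ (x, true), ?_⟩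
  set H := Subgroup.closure ({f i, f Color.G} : Set (Equiv.Perm (Fin n))) with hH
  have hi : f i ∈ H := Subgroup.subset_closure (by simp)
  have hg : f Color.G ∈ H := Subgroup.subset_closure (by simp)
  have hGt : ∀ z, f Color.G (φ (z, true)) = φ (z, false) := fun z => by
    simpa [hG] using (h Color.G z).1
  have hGf : ∀ z, f Color.G (φ (z, false)) = φ (z, true) := fun z => by
    simpa [hG] using (h Color.G z).2
  have step : ∀ p ∈ H, ∀ y, y ∈ MulAction.orbit H (φ (x, true)) →
      p y ∈ MulAction.orbit H (φ (x, true)) := by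
    intro p hp y hy
    obtain ⟨q, rfl⟩ := hy
    exact ⟨⟨p, hp⟩ * q, rfl⟩
  apply Set.Subset.antisymm
  · have hpow : ∀ k : ℕ, φ ((L i ^ k) x, true) ∈ MulAction.orbit H (φ (x, true)) := by
      intro k
      induction k with
      | zero => exact MulAction.mem_orbit_self _
      | succ k ih =>
        have := step _ hg _ (step _ hi _ ih)
        rw [(h i _).1, hGf] at this
        rwa [pow_succ', Equiv.Perm.mul_apply]
    intro y hy
    obtain ⟨⟨z, b⟩, rfl⟩ := φ.surjective y
    rw [mem_double] at hy
    obtain ⟨k, rfl⟩ := sameCycle_exists_pow hy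
    cases b
    · have := step _ hg _ (hpow k)
      rwa [hGt] at this
    · exact hpow k
  · rintro y ⟨⟨p, hp⟩, rfl⟩
    have hinv : ∀ X, X = i ∨ X = Color.G → ∀ y ∈ double φ (cyc (L i) x),
        f X y ∈ double φ (cyc (L i) x) := by
      intro X hX y hy
      obtain ⟨⟨z, b⟩, rfl⟩ := φ.surjective y
      rw [mem_double] at hy
      rcases hX with rfl | rfl
      · cases b
        · obtain ⟨w, rfl⟩ := (L X).surjective z
          rw [(h X w).2, mem_double]
          exact (closed_iff (cyc_closed _ _) w).1 hy
        · rw [(h X z).1, mem_double]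
          exact cyc_closed _ _ _ hy
      · cases b
        · rwa [hGf, mem_double]
        · rwa [hGt, mem_double]
    have hp' : ∀ y ∈ double φ (cyc (L i) x), p y ∈ double φ (cyc (L i) x) := by
      induction hp using Subgroup.closure_induction with
      | mem q hq =>
        rcases hq with rfl | rfl
        · exact hinv i (Or.inl rfl)
        · exact hinv _ (Or.inr rfl)
      | one => exact fun y hy => hy
      | mul a b _ _ ha hb => exact fun y hy => ha _ (hb _ hy)
      | inv a _ ha => exact closed_inv ha
    exact hp' _ (mem_double.2 (mem_cyc_self _ _))

/-- The gluing data determined by a pair of permutations. -/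
def levels {S : Type*} (r u : Equiv.Perm S) : Color → Equiv.Perm S
  | Color.R => u
  | Color.G => 1
  | Color.B => r

theorem ShearPowSeq.append {n : ℕ} {L M : ℕ} {f f' f'' : Surf n} (h : ShearPowSeq n L f f')
    (h' : ShearPowSeq n M f' f'') : ShearPowSeq n (L + M) f f'' := by
  induction L generalizing f with
  | zero =>
    obtain rfl : f = f' := h
    simpa using h'
  | succ L ih =>
    obtain ⟨g, h1, h2⟩ := h
    rw [show L + 1 + M = L + M + 1 by omega]
    exact ⟨g, h1, ih h2⟩

theorem Models.step {S : Type*} [Finite S] {n : ℕ} {φ : S × Bool ≃ Fin n} {f : Surf n}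
    {L : Color → Equiv.Perm S} (h : Models φ f L) (i : Color) (hi : GoodPair i Color.G)
    (hG : L Color.G = 1) (x : S) (k : ℕ) :
    ∃ (M : ℕ) (f' : Surf n) (φ' : S × Bool ≃ Fin n), M ≤ 1 ∧ ShearPowSeq n M f f' ∧
      Models φ' f' (fun X => if X = i ∨ X = Color.G then L X else
        restrictPerm (L i) (cyc (L i) x) ^ k * L X) := by
  rcases Nat.eq_zero_or_pos k with rfl | hk
  · exact ⟨0, f, φ, by omega, rfl, by simpa using h⟩
  · obtain ⟨φ', -, h'⟩ := h.exists_shearPow i hG (cyc_closed (L i) x) k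
    exact ⟨1, _, φ', le_rfl, ⟨_, ⟨i, Color.G, _, k, hi, h.isComponent i hG x, hk, rfl⟩, rfl⟩, h'⟩

theorem Conn.exists_seq {S : Type*} [Finite S] {N : ℕ} {r u r' u' : Equiv.Perm S}
    (h : Conn N r u r' u') {n : ℕ} {φ : S × Bool ≃ Fin n} {f : Surf n}
    (hf : Models φ f (levels r u)) :
    ∃ (M : ℕ) (f' : Surf n) (φ' : S × Bool ≃ Fin n), M ≤ N ∧ ShearPowSeq n M f f' ∧
      Models φ' f' (levels r' u') := by
  induction h generalizing φ f with
  | conj r u g =>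
    refine ⟨0, f, reglue φ g⁻¹ g⁻¹, le_rfl, rfl, ?_⟩
    convert hf.regluing g⁻¹ g⁻¹ using 2 with X
    cases X <;> simp [levels]
  | hstep r u x k =>
    obtain ⟨M, f', φ', h1, h2, h3⟩ := hf.step Color.B (Or.inr (Set.pair_comm _ _)) rfl x k
    refine ⟨M, f', φ', h1, h2, ?_⟩
    convert h3 using 2 with X
    cases X <;> simp [levels]
  | vstep r u x k =>
    obtain ⟨M, f', φ', h1, h2, h3⟩ := hf.step Color.R (Or.inl rfl) rfl x k
    refine ⟨M, f', φ', h1, h2, ?_⟩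
    convert h3 using 2 with X
    cases X <;> simp [levels]
  | trans _ _ ih1 ih2 =>
    obtain ⟨M, f', φ', h1, h2, h3⟩ := ih1 hf
    obtain ⟨M', f'', φ'', h1', h2', h3'⟩ := ih2 h3
    exact ⟨M + M', f'', φ'', by omega, h2.append h2', h3'⟩
  | weaken _ hN ih =>
    obtain ⟨M, f', φ', h1, h2, h3⟩ := ih hf
    exact ⟨M, f', φ', h1.trans hN, h2, h3⟩

theorem cycleOf_eq_iff {S : Type*} [Fintype S] [DecidableEq S] {π c : Equiv.Perm S}
    (hc : c ∈ π.cycleFactorsFinset) (x : S) : π.cycleOf x = c ↔ x ∈ c.support := by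
  constructor
  · rintro rfl
    have hx := cycleOf_mem_cycleFactorsFinset_iff.1 hc
    exact mem_support_cycleOf_iff.2 ⟨SameCycle.refl _ _, hx⟩
  · exact fun hx => (cycle_is_cycleOf hx hc).symm

theorem wt_eq {S : Type*} [Fintype S] [DecidableEq S] {π : Equiv.Perm S} {x : S} (hx : π x ≠ x) :
    wt π x = 1 / ((π.cycleOf x).support.card : ℚ) := by
  have : {y | π.SameCycle x y} = ((π.cycleOf x).support : Set S) := by
    ext y
    rw [Finset.mem_coe, mem_support_cycleOf_iff' hx]
    rfl
  rw [wt, this, Set.ncard_coe_finset]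

theorem orbs_eq_add {n : ℕ} (π : Equiv.Perm (Fin n)) :
    orbs π = fixedCount π + π.cycleType.card := by
  have h : (orbs π : ℚ) = (fixedCount π + π.cycleType.card : ℕ) := by
    rw [orbs_eq_sum, ← Finset.sum_filter_add_sum_filter_not Finset.univ (fun x => π x = x),
      Finset.sum_congr rfl fun x hx => wt_of_fixed (Finset.mem_filter.1 hx).2,
      ← Finset.sum_fiberwise_of_maps_to (s := Finset.univ.filter fun x => ¬ π x = x)
        (t := π.cycleFactorsFinset) (g := π.cycleOf)]
    · rw [Finset.sum_congr (s₁ := π.cycleFactorsFinset) rfl (g := fun _ => (1 : ℚ))]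
      · simp [fixedCount, cycleType_def]
      · intro c hc
        have hne : (c.support.card : ℚ) ≠ 0 := by
          have := (mem_cycleFactorsFinset_iff.1 hc).1.two_le_card_support
          positivity
        have e : (Finset.univ.filter fun x => ¬ π x = x).filter (fun x => π.cycleOf x = c) =
            c.support := by
          ext x
          rw [Finset.mem_filter, cycleOf_eq_iff hc]
          refine ⟨fun h => h.2, fun h => ⟨?_, h⟩⟩
          simpa using mem_cycleFactorsFinset_support_le hc h
        rw [e, Finset.sum_congr rfl (g := fun _ => 1 / (c.support.card : ℚ))]
        · rw [Finset.sum_const, nsmul_eq_mul, mul_one_div_cancel hne]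
        · intro x hx
          rw [wt_eq (by simpa using mem_cycleFactorsFinset_support_le hc hx),
            (cycleOf_eq_iff hc x).2 hx]
    · intro x hx
      rw [cycleOf_mem_cycleFactorsFinset_iff]
      simpa using hx
  exact_mod_cast h

theorem two_mul_orbs {n : ℕ} {π : Equiv.Perm (Fin n)} (h : ∀ x, π (π x) = x) :
    2 * orbs π = n + fixedCount π := by
  have h : (2 * orbs π : ℚ) = (n + fixedCount π : ℕ) := by
    rw [orbs_eq_sum, Finset.mul_sum,
      Finset.sum_congr rfl (g := fun x => (1 : ℚ) + if π x = x then 1 else 0)]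
    · rw [Finset.sum_add_distrib, Finset.sum_boole]
      simp [fixedCount]
    · intro x _
      split_ifs with hx
      · rw [wt_of_fixed hx]
        norm_num
      · rw [wt_of_swap (h x) hx]
        norm_num
  exact_mod_cast h

theorem sum_cycleCount {n : ℕ} (π : Equiv.Perm (Fin n)) :
    ∑ i ∈ Finset.Icc 1 n, (cycleCount π i : ℤ) * ((i : ℤ) - 2) = n - 2 * orbs π := by
  have hs : ∀ i ∈ π.cycleType, 2 ≤ i ∧ i ≤ n := fun i hi =>
    ⟨two_le_of_mem_cycleType hi, by
      have h1 := Multiset.le_sum_of_mem hi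
      have h2 := Finset.card_le_univ π.support
      rw [sum_cycleType] at h1
      rw [Fintype.card_fin] at h2
      omega⟩
  have hfix : fixedCount π + π.cycleType.sum = n := by
    have := Finset.card_filter_add_card_filter_not (s := (Finset.univ : Finset (Fin n)))
      (fun x => π x = x)
    rw [Finset.card_univ, Fintype.card_fin] at this
    rw [sum_cycleType]
    exact this
  have h1 : ∀ i ∈ Finset.Icc 1 n, (cycleCount π i : ℤ) * ((i : ℤ) - 2) =
      (if i = 1 then -(fixedCount π : ℤ) else 0) + (π.cycleType.count i : ℤ) * ((i : ℤ) - 2) := by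
    intro i _
    rw [cycleCount]
    split_ifs with hi
    · subst hi
      rw [Multiset.count_eq_zero_of_notMem fun h => by have := hs 1 h; omega]
      simp
    · simp
  have h2 : ∑ i ∈ Finset.Icc 1 n, (π.cycleType.count i : ℤ) * ((i : ℤ) - 2) =
      (π.cycleType.map fun i : ℕ => (i : ℤ) - 2).sum := by
    rw [Finset.sum_multiset_map_count]
    simp only [nsmul_eq_mul]
    symm
    apply Finset.sum_subset
    · intro i hi
      have := hs i (Multiset.mem_toFinset.1 hi)
      rw [Finset.mem_Icc]
      omega
    · intro i _ hi
      rw [Multiset.count_eq_zero_of_notMem fun h => hi (Multiset.mem_toFinset.2 h)]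
      simp
  have h3 : (π.cycleType.map fun i : ℕ => (i : ℤ) - 2).sum =
      (π.cycleType.sum : ℤ) - 2 * π.cycleType.card := by
    rw [Multiset.sum_map_sub]
    simp [mul_comm]
  rw [Finset.sum_congr rfl h1, Finset.sum_add_distrib, h2, h3, Finset.sum_ite_eq', orbs_eq_add]
  split_ifs with h
  · omega
  · have : n = 0 := by simpa using h
    omega

theorem genusFour_eq {n : ℕ} {f : Surf n} (h : ∀ X, f X * f X = 1) :
    genusFour f = 4 * n - 2 * (orbs (f Color.R) + orbs (f Color.G) + orbs (f Color.B) +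
      orbs (prodRGB f)) := by
  have hX : ∀ X, 2 * orbs (f X) = n + fixedCount (f X) := fun X =>
    two_mul_orbs fun x => Equiv.Perm.ext_iff.1 (h X) x
  have h1 := hX Color.R
  have h2 := hX Color.G
  have h3 := hX Color.B
  rw [genusFour, sum_cycleCount, totalFixed]
  push_cast
  omega

/-- The points on cycles of length other than one and two. -/
theorem long_cycles {n K : ℕ} {π : Equiv.Perm (Fin n)} (hK : 3 ≤ K)
    (h : ∀ i, 1 ≤ i → i ≠ 2 → i ≠ K → cycleCount π i = 0) (x : Fin n) :
    π (π x) ≠ x ↔ (π.cycleOf x).support.card = K := by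
  constructor
  · intro hx
    have hx1 : π x ≠ x := fun h => hx (by rw [h, h])
    have hmem : (π.cycleOf x).support.card ∈ π.cycleType := by
      rw [cycleType_def]
      exact Multiset.mem_map_of_mem (Finset.card ∘ support) (Finset.mem_def.1 <|
        cycleOf_mem_cycleFactorsFinset_iff.2 (Equiv.Perm.mem_support.2 hx1))
    have h2 := two_le_of_mem_cycleType hmem
    have h3 : (π.cycleOf x).support.card ≠ 2 := by
      intro e
      have := pow_mod_card_support_cycleOf_self_apply π 2 x
      rw [e] at this
      exact hx this.symm
    by_contra h4
    have h5 := h _ (by omega) h3 h4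
    rw [cycleCount, if_neg (by omega), Multiset.count_eq_zero] at h5
    exact h5 hmem
  · intro hx e
    have hx1 : π x ≠ x := by
      intro e
      rw [(cycleOf_eq_one_iff π).2 e] at hx
      simp at hx
      omega
    have hsub : (π.cycleOf x).support ⊆ {x, π x} := by
      intro y hy
      rw [mem_support_cycleOf_iff' hx1] at hy
      have := mem_of_sameCycle (W := {x, π x}) (by
        rintro z (rfl | rfl)
        · simp
        · simp [e]) hy (by simp)
      simpa using this
    have := Finset.card_le_card hsub
    have h2 := Finset.card_le_two (a := x) (b := π x)
    omega

theorem card_filter_cycleFactors {n K : ℕ} {π : Equiv.Perm (Fin n)} (hK : 3 ≤ K) :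
    (π.cycleFactorsFinset.filter fun c => c.support.card = K).card = cycleCount π K := by
  rw [cycleCount, if_neg (by omega), cycleType_def, Multiset.count_map]
  rw [Finset.card_def, Finset.filter_val]
  congr 1
  apply Multiset.filter_congr
  intro c _
  exact eq_comm

theorem cycleOf_mem_filter {n K : ℕ} {π : Equiv.Perm (Fin n)} (hK : 3 ≤ K) {x : Fin n}
    (hx : (π.cycleOf x).support.card = K) :
    π.cycleOf x ∈ π.cycleFactorsFinset.filter fun c => c.support.card = K := by
  refine Finset.mem_filter.2 ⟨?_, hx⟩
  rw [cycleOf_mem_cycleFactorsFinset_iff, Equiv.Perm.mem_support]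
  intro e
  rw [(cycleOf_eq_one_iff π).2 e] at hx
  simp at hx
  omega

theorem ncard_long_cycles {n K : ℕ} {π : Equiv.Perm (Fin n)} (hK : 3 ≤ K)
    (h : ∀ i, 1 ≤ i → i ≠ 2 → i ≠ K → cycleCount π i = 0) :
    Set.ncard {x | π (π x) ≠ x} = cycleCount π K * K := by
  have e : {x | π (π x) ≠ x} =
      ((Finset.univ.filter fun x => (π.cycleOf x).support.card = K : Finset (Fin n)) : Set _) := by
    ext x
    simp only [Finset.coe_filter, Finset.mem_univ, true_and]
    exact long_cycles hK h x
  rw [e, Set.ncard_coe_finset, ← card_filter_cycleFactors hK,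
    Finset.card_eq_sum_card_fiberwise (f := π.cycleOf)
      (t := π.cycleFactorsFinset.filter fun c => c.support.card = K)]
  · rw [Finset.sum_const_nat]
    intro c hc
    obtain ⟨hc1, hc2⟩ := Finset.mem_filter.1 hc
    rw [← hc2]
    congr 1
    ext x
    rw [Finset.mem_filter, cycleOf_eq_iff hc1]
    refine ⟨fun h => h.2, fun h => ⟨?_, h⟩⟩
    rw [← cycleOf_eq_iff hc1] at h
    simp [h]
  · intro x hx
    exact cycleOf_mem_filter hK (by simpa using hx)

theorem sameCycle_of_cycleOf_eq {n K : ℕ} {π : Equiv.Perm (Fin n)} (hK : 3 ≤ K) {x y : Fin n}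
    (hx : (π.cycleOf x).support.card = K) (h : π.cycleOf x = π.cycleOf y) : π.SameCycle x y := by
  have h1 := cycleOf_mem_cycleFactorsFinset_iff.1 (Finset.mem_filter.1 (cycleOf_mem_filter hK hx)).1
  have h2 := cycleOf_mem_cycleFactorsFinset_iff.1
    (Finset.mem_filter.1 (cycleOf_mem_filter hK (h ▸ hx))).1
  exact (sameCycle_iff_cycleOf_eq_of_mem_support h1 h2).2 h

theorem sameCycle_of_cycleCount_one {n K : ℕ} {π : Equiv.Perm (Fin n)} (hK : 3 ≤ K)
    (h1 : cycleCount π K = 1) {x y : Fin n} (hx : (π.cycleOf x).support.card = K)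
    (hy : (π.cycleOf y).support.card = K) : π.SameCycle x y := by
  rw [← card_filter_cycleFactors hK, Finset.card_eq_one] at h1
  obtain ⟨c, hc⟩ := h1
  have ex := cycleOf_mem_filter hK hx
  have ey := cycleOf_mem_filter hK hy
  rw [hc, Finset.mem_singleton] at ex ey
  exact sameCycle_of_cycleOf_eq hK hx (ex.trans ey.symm)

theorem sameCycle_of_cycleCount_two {n K : ℕ} {π : Equiv.Perm (Fin n)} (hK : 3 ≤ K)
    (h2 : cycleCount π K = 2) {x y z : Fin n} (hx : (π.cycleOf x).support.card = K)
    (hy : (π.cycleOf y).support.card = K) (hz : (π.cycleOf z).support.card = K)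
    (hxy : ¬ π.SameCycle x y) : π.SameCycle x z ∨ π.SameCycle y z := by
  rw [← card_filter_cycleFactors hK, Finset.card_eq_two] at h2
  obtain ⟨c, d, -, hc⟩ := h2
  have ex := cycleOf_mem_filter hK hx
  have ey := cycleOf_mem_filter hK hy
  have ez := cycleOf_mem_filter hK hz
  rw [hc, Finset.mem_insert, Finset.mem_singleton] at ex ey ez
  have hne : π.cycleOf x ≠ π.cycleOf y := fun h => hxy (sameCycle_of_cycleOf_eq hK hx h)
  by_cases h : π.cycleOf x = π.cycleOf z
  · exact Or.inl (sameCycle_of_cycleOf_eq hK hx h)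
  · refine Or.inr (sameCycle_of_cycleOf_eq hK hy ?_)
    grind

theorem IsAbelianWitness.mem_iff {n : ℕ} {f : Surf n} {A : Set (Fin n)}
    (h : IsAbelianWitness n f A) (X : Color) (x : Fin n) : f X x ∈ A ↔ x ∉ A := by
  have h1 : x ∈ A ↔ f X x ∈ Aᶜ := by
    rw [← h.2.2 X]
    exact (f X).injective.mem_set_image.symm
  rw [Set.mem_compl_iff] at h1
  tauto

theorem IsSTS.closed_eq_univ {n : ℕ} {f : Surf n} (h : IsSTS n f) {W : Set (Fin n)}
    (hne : W.Nonempty) (hW : ∀ X, ∀ x ∈ W, f X x ∈ W) : W = Set.univ := by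
  obtain ⟨x, hx⟩ := hne
  refine Set.eq_univ_of_forall fun y => ?_
  obtain ⟨p, hp, rfl⟩ := h.2.2 x y
  have hp' : ∀ y ∈ W, p y ∈ W := by
    induction hp using Subgroup.closure_induction with
    | mem q hq =>
      rcases hq with rfl | rfl | rfl
      · exact hW _
      · exact hW _
      · exact hW _
    | one => exact fun y hy => hy
    | mul a b _ _ ha hb => exact fun y hy => ha _ (hb _ hy)
    | inv a _ ha => exact closed_inv ha
  exact hp' x hx

theorem IsSTS.sq {n : ℕ} {f : Surf n} (h : IsSTS n f) (X : Color) (x : Fin n) :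
    f X (f X x) = x := Equiv.Perm.ext_iff.1 (h.2.1 X) x

/-- A hyperelliptic involution exchanges the two colour classes. -/
theorem IsAbelianWitness.swaps {n m : ℕ} {f : Surf n} {A : Set (Fin n)} {α : Equiv.Perm (Fin n)}
    {q : Surf m} (h : IsAbelianWitness n f A) (hf : IsSTS n f) (hα : IsAut f α)
    (hq : IsQuotientBy n m f α q) (hg : genusFour q = -4) (x : Fin n) : α x ∈ A ↔ x ∉ A := by
  have hα' : ∀ X x, α (f X x) = f X (α x) := fun X x => Equiv.Perm.ext_iff.1 (hα X) x
  by_cases hE : {x | α x ∈ A ↔ x ∈ A}.Nonempty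
  · exfalso
    have hE' := hf.closed_eq_univ hE fun X x (hx : α x ∈ A ↔ x ∈ A) => by
      change α (f X x) ∈ A ↔ f X x ∈ A
      rw [hα', h.mem_iff, h.mem_iff, hx]
    have hE2 : ∀ x, α x ∈ A ↔ x ∈ A := fun x => by
      have : x ∈ {x | α x ∈ A ↔ x ∈ A} := by rw [hE']; trivial
      exact this
    obtain ⟨p, hp, hfib, hcomm⟩ := hq
    have hfix : ∀ (σ : Equiv.Perm (Fin n)) (ρ : Equiv.Perm (Fin m)), (∀ x, p (σ x) = ρ (p x)) →
        (∀ x, σ x ∈ A ↔ x ∉ A) → fixedCount ρ = 0 := by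
      intro σ ρ h1 h2
      rw [fixedCount, Finset.card_eq_zero, Finset.filter_eq_empty_iff]
      intro y _ hy
      obtain ⟨x, rfl⟩ := hp y
      rw [← h1, hfib] at hy
      have h3 := h2 x
      have h4 := hE2 (σ x)
      rcases hy with hy | hy
      · rw [← hy] at h3
        tauto
      · rw [← hy] at h4
        tauto
    have hX : ∀ X, fixedCount (q X) = 0 := fun X => hfix (f X) (q X) (hcomm X) (h.mem_iff X)
    have hP : fixedCount (prodRGB q) = 0 := by
      refine hfix (prodRGB f) (prodRGB q) (fun x => ?_) fun x => ?_
      · simp only [prodRGB, Equiv.Perm.mul_apply, hcomm]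
      · simp only [prodRGB, Equiv.Perm.mul_apply, h.mem_iff]
        tauto
    have : 0 ≤ genusFour q := by
      rw [genusFour, totalFixed, hX, hX, hX]
      simp only [Nat.cast_zero, sub_zero, add_zero]
      refine Finset.sum_nonneg fun i hi => ?_
      rcases Nat.lt_or_ge i 2 with h2 | h2
      · have : i = 1 := by
          rw [Finset.mem_Icc] at hi
          omega
        simp [cycleCount, this, hP]
      · apply mul_nonneg
        · positivity
        · have : (2 : ℤ) ≤ i := by exact_mod_cast h2
          omega
    omega
  · have : ¬ (α x ∈ A ↔ x ∈ A) := fun hx => hE ⟨x, hx⟩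
    tauto

/-- A hyperelliptic Abelian surface is modelled by a pair of permutations with a hyperelliptic
structure. -/
theorem exists_models {n K N ℓ : ℕ} {f : Surf n} {α : Equiv.Perm (Fin n)} (hK : 3 ≤ K)
    (hN : N * K = 2 * ℓ) (hf : IsSTS n f) (hab : IsAbelian n f)
    (hcount : cycleCount (prodRGB f) K = N)
    (hzero : ∀ i, 1 ≤ i → i ≠ 2 → i ≠ K → cycleCount (prodRGB f) i = 0)
    (hα : IsHyperInvolution f α)
    (hsame : ∀ x y, ((prodRGB f).cycleOf x).support.card = K →
      ((prodRGB f).cycleOf (α x)).support.card = K → ((prodRGB f).cycleOf y).support.card = K →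
      (prodRGB f).SameCycle x y ∨ (prodRGB f).SameCycle (α x) y) :
    ∃ m, n = 2 * m ∧ ∃ (r u : Equiv.Perm (Fin m)) (φ : Fin m × Bool ≃ Fin n),
      Models φ f (levels r u) ∧ IsHyp ℓ r u := by
  obtain ⟨A, hA⟩ := hab
  obtain ⟨haut, hα2, -, m, q, hqsts, hq, hg⟩ := hα
  have hsw := hA.swaps hf haut hq hg
  obtain ⟨p, hp, hfib, hcomm⟩ := hq
  have hαα : ∀ x, α (α x) = x := fun x => Equiv.Perm.ext_iff.1 hα2 x
  have hs : ∀ y, ∃ x, x ∈ A ∧ p x = y := by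
    intro y
    obtain ⟨x, rfl⟩ := hp y
    by_cases hx : x ∈ A
    · exact ⟨x, hx, rfl⟩
    · exact ⟨α x, (hsw x).2 hx, ((hfib _ _).2 (Or.inr rfl)).symm⟩
  choose s hsA hps using hs
  have hsp : ∀ x ∈ A, s (p x) = x := by
    intro x hx
    have h1 := hps (p x)
    rw [hfib] at h1
    rcases h1 with h1 | h1
    · exact h1.symm
    · have := hsw (s (p x))
      rw [← h1] at this
      have := hsA (p x)
      tauto
  have hsinj : Function.Injective s := fun y z h => by rw [← hps y, h, hps]
  -- gluing with any map exchanging the classes gives a parametrisation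
  have hbij : ∀ β : Equiv.Perm (Fin n), (∀ x, β (β x) = x) → (∀ x, β x ∈ A ↔ x ∉ A) →
      Function.Bijective fun z : Fin m × Bool => if z.2 then s z.1 else β (s z.1) := by
    intro β hβ hβA
    constructor
    · rintro ⟨y, b⟩ ⟨z, c⟩ h
      have h1 := hsA y
      have h2 := hsA z
      have h3 := hβA (s y)
      have h4 := hβA (s z)
      cases b <;> cases c <;> simp only [if_true, Bool.false_eq_true, if_false] at h
      · rw [hsinj (β.injective h)]
      · rw [h] at h3
        tauto
      · rw [← h] at h4
        tauto
      · rw [hsinj h]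
    · intro x
      by_cases hx : x ∈ A
      · exact ⟨(p x, true), by simp [hsp x hx]⟩
      · refine ⟨(p (β x), false), ?_⟩
        simp only [Bool.false_eq_true, if_false]
        rw [hsp _ ((hβA x).2 hx), hβ]
  let φ := Equiv.ofBijective _ (hbij (f Color.G) (hf.sq _) (hA.mem_iff _))
  have hφt : ∀ y, φ (y, true) = s y := fun y => rfl
  have hφf : ∀ y, φ (y, false) = f Color.G (s y) := fun y => rfl
  have hqsq := hqsts.sq
  set G := q Color.G with hG
  set r := G * q Color.B with hr
  set u := G * q Color.R with hu
  have hGG : G * G = 1 := hqsts.2.1 _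
  have hGr : G * r = q Color.B := by rw [hr, ← mul_assoc, hGG, one_mul]
  have hGu : G * u = q Color.R := by rw [hu, ← mul_assoc, hGG, one_mul]
  have hlev : ∀ X, levels r u X = G * q X := by
    intro X
    cases X
    · rfl
    · exact hGG.symm
    · rfl
  have hmod : Models φ f (levels r u) := by
    intro X y
    have key : f X (s y) = f Color.G (s (G (q X y))) := by
      have h1 : f Color.G (f X (s y)) ∈ A := by
        rw [hA.mem_iff, hA.mem_iff]
        exact not_not.2 (hsA y)
      have h2 := hsp _ h1
      rw [hcomm, hcomm, hps] at h2
      rw [h2, hf.sq]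
    rw [hφt, hφf, hlev, Equiv.Perm.mul_apply, ← key, hf.sq]
    exact ⟨rfl, rfl⟩
  have hn : n = 2 * m := by
    have := Fintype.card_congr φ
    rw [Fintype.card_prod, Fintype.card_fin, Fintype.card_fin, Fintype.card_bool] at this
    omega
  refine ⟨m, hn, r, u, φ, hmod, G, ?_⟩
  set P := prodRGB f with hP
  set π := prodRGB q with hπ
  have hpP : ∀ x, p (P x) = π (p x) := fun x => by
    simp only [hP, hπ, prodRGB, Equiv.Perm.mul_apply, hcomm]
  have hPA : ∀ x, P x ∈ A ↔ x ∉ A := fun x => by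
    simp only [hP, prodRGB, Equiv.Perm.mul_apply, hA.mem_iff]
    tauto
  have hGur : G * u * r = π := by
    rw [hGu, hr, ← mul_assoc]
    rfl
  have hD : ∀ y, u (r y) ≠ r (u y) ↔ π (π y) ≠ y := by
    intro y
    have e1 : u (r y) = G (π y) := rfl
    have e2 : π (G (r (u y))) = y := by
      change q Color.R (G (q Color.B (G (G (q Color.B (G (q Color.R y))))))) = y
      rw [hqsq Color.G, hqsq Color.B, hqsq Color.G, hqsq Color.R]
    rw [e1, not_iff_not]
    constructor
    · intro h
      rwa [← h, hqsq Color.G] at e2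
    · intro h
      rw [π.injective (h.trans e2.symm), hqsq Color.G]
  have hlift : ∀ x, π (π (p x)) ≠ p x ↔ P (P x) ≠ x := by
    intro x
    rw [← hpP, ← hpP, not_iff_not, hfib]
    constructor
    · rintro (h | h)
      · exact h.symm
      · have h1 := hsw (P (P x))
        have h2 := hPA x
        have h3 := hPA (P x)
        rw [← h] at h1
        tauto
    · exact fun h => Or.inl h.symm
  have hlong := long_cycles hK hzero
  have hpα : ∀ x, p (α x) = p x := fun x => ((hfib _ _).2 (Or.inr rfl)).symm
  have hsc : ∀ {x y}, P.SameCycle x y → π.SameCycle (p x) (p y) := by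
    intro x y h
    obtain ⟨i, rfl⟩ := sameCycle_exists_pow h
    have : p ((P ^ i) x) = (π ^ i) (p x) := by
      induction i with
      | zero => rfl
      | succ i ih =>
        rw [pow_succ', pow_succ', Equiv.Perm.mul_apply, Equiv.Perm.mul_apply, hpP,
          ih (sameCycle_pow _ _ _)]
    rw [this]
    exact sameCycle_pow _ _ _
  refine ⟨hqsq _, ?_, ?_, ?_, ?_, ?_, ?_⟩
  · intro y
    have : r * (G * r) = G := by rw [hGr, hr, mul_assoc, hqsts.2.1, mul_one]
    exact Equiv.Perm.ext_iff.1 this y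
  · intro y
    have : u * (G * u) = G := by rw [hGu, hu, mul_assoc, hqsts.2.1, mul_one]
    exact Equiv.Perm.ext_iff.1 this y
  · rintro W ⟨w, hw⟩ hWr hWu
    have hWX : ∀ X, ∀ x ∈ W, levels r u X x ∈ W := by
      intro X x hx
      cases X
      · exact hWu x hx
      · exact hx
      · exact hWr x hx
    have := hf.closed_eq_univ (W := double φ W) ⟨φ (w, true), mem_double.2 hw⟩ (by
      intro X x hx
      obtain ⟨⟨y, b⟩, rfl⟩ := φ.surjective x
      rw [mem_double] at hx
      cases b
      · obtain ⟨z, rfl⟩ := (levels r u X).surjective y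
        rw [(hmod X z).2, mem_double]
        exact (closed_iff (hWX X) z).1 hx
      · rw [(hmod X y).1, mem_double]
        exact hWX X y hx)
    refine Set.eq_univ_of_forall fun y => ?_
    rw [← mem_double (φ := φ) (b := true), this]
    trivial
  · intro y z hy hz
    rw [hGur]
    rw [hD, ← hps y, hlift, hlong] at hy
    rw [hD, ← hps z, hlift, hlong] at hz
    have hy' : (P.cycleOf (α (s y))).support.card = K := by
      rw [← hlong, ← hlift, hpα, hlift, hlong]
      exact hy
    rw [← hps y, ← hps z]
    rcases hsame _ _ hy hy' hz with h | h
    · exact hsc h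
    · have := hsc h
      rwa [hpα] at this
  · have h1 := ncard_long_cycles hK hzero
    rw [hcount, hN] at h1
    let ψ := Equiv.ofBijective _ (hbij α hαα hsw)
    have hpψ : ∀ z, p (ψ z) = z.1 := by
      rintro ⟨y, b⟩
      cases b
      · exact (hpα _).trans (hps y)
      · exact hps y
    have e : {x | P (P x) ≠ x} = ψ '' ({y | u (r y) ≠ r (u y)} ×ˢ Set.univ) := by
      ext x
      obtain ⟨z, rfl⟩ := ψ.surjective x
      rw [ψ.injective.mem_set_image]
      simp only [Set.mem_prod, Set.mem_univ, and_true]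
      change P (P (ψ z)) ≠ ψ z ↔ u (r z.1) ≠ r (u z.1)
      rw [hD, ← hlift, hpψ]
    rw [e, Set.ncard_image_of_injective _ ψ.injective, Set.ncard_prod, Set.ncard_univ,
      Nat.card_eq_fintype_card, Fintype.card_bool] at h1
    omega
  · have := genusFour_eq hqsts.2.1
    rw [hGr, hGu, ← hGu, hGur, hGu, Fintype.card_fin]
    rw [hg, ← hG, ← hπ] at this
    omega

theorem InSTHypA.exists_models {n g μ2 : ℕ} {f : Surf n} (hg : 2 ≤ g) (h : InSTHypA n g μ2 f) :
    ∃ m, n = 2 * m ∧ ∃ (r u : Equiv.Perm (Fin m)) (φ : Fin m × Bool ≃ Fin n),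
      Models φ f (levels r u) ∧ IsHyp (2 * g - 1) r u := by
  obtain ⟨hf, hab, ⟨-, -, h1, h0⟩, α, hα⟩ := h
  exact _root_.exists_models (by omega) (by omega) hf hab h1 h0 hα fun x y hx _ hy =>
    Or.inl (sameCycle_of_cycleCount_one (by omega) h1 hx hy)

theorem InSTHypB.exists_models {n g μ2 : ℕ} {f : Surf n} (hg : 2 ≤ g) (h : InSTHypB n g μ2 f) :
    ∃ m, n = 2 * m ∧ ∃ (r u : Equiv.Perm (Fin m)) (φ : Fin m × Bool ≃ Fin n),
      Models φ f (levels r u) ∧ IsHyp (2 * g) r u := by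
  obtain ⟨hf, hab, ⟨-, -, h2, h0⟩, α, hα, hex⟩ := h
  exact _root_.exists_models (by omega) rfl hf hab h2 h0 hα fun x y hx hx' hy =>
    sameCycle_of_cycleCount_two (by omega) h2 hx hx' hy (hex x hx)

end

/-- There is a constant `C > 0` such that for every `g ≥ 2`, `μ2 ≥ 0`
and `μ = [2^{μ2}, 4g-2]` or `μ = [2^{μ2}, (2g)^2]`, any two square-tiled surfaces in
`ST^hyp_Ab(μ)` are connected by at most `C·g` powers of cylinder shears, up to
isomorphism. -/
theorem stmt16 :
    ∃ C : ℕ, 0 < C ∧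
      ∀ (g μ2 n : ℕ), 2 ≤ g →
        ∀ τ τ' : Surf n,
          ((InSTHypA n g μ2 τ ∧ InSTHypA n g μ2 τ') ∨
            (InSTHypB n g μ2 τ ∧ InSTHypB n g μ2 τ')) →
          ∃ (L : ℕ) (f'' : Surf n),
            L ≤ C * g ∧ ShearPowSeq n L τ f'' ∧ Isomorphic n τ' f'' := by
  refine ⟨77, by norm_num, fun g μ2 n hg τ τ' h => ?_⟩
  obtain ⟨ℓ, h3, h2, ⟨m, hm, r, u, φ, hφ, hr⟩, m', hm', r', u', φ', hφ', hr'⟩ :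
      ∃ ℓ, 3 ≤ ℓ ∧ ℓ ≤ 2 * g ∧
        (∃ m, n = 2 * m ∧ ∃ (r u : Equiv.Perm (Fin m)) (φ : Fin m × Bool ≃ Fin n),
          Models φ τ (levels r u) ∧ IsHyp ℓ r u) ∧
        ∃ m, n = 2 * m ∧ ∃ (r u : Equiv.Perm (Fin m)) (φ : Fin m × Bool ≃ Fin n),
          Models φ τ' (levels r u) ∧ IsHyp ℓ r u := by
    rcases h with ⟨h, h'⟩ | ⟨h, h'⟩
    · exact ⟨2 * g - 1, by omega, by omega, h.exists_models hg, h'.exists_models hg⟩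
    · exact ⟨2 * g, by omega, le_rfl, h.exists_models hg, h'.exists_models hg⟩
  obtain rfl : m = m' := by omega
  obtain ⟨L, f'', ψ, hL, hseq, hψ⟩ := (hr.conn h3 hr').exists_seq hφ
  exact ⟨L, f'', by omega, hseq, hφ'.isomorphic hψ⟩
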